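/- arXiv:0808.1616 — 2 statements merged into one kernel-verified Lean document; each statement's English description precedes it below -/
import Mathlib

section
/- There exists a constant C > 0 such that for every real B ≥ 3 and every real T > 0 one has ∑_{(a,b)} M_{a,b}(B) ≤ C·(B·(log B)⁴·T^{−2/3} + B·(log B)³), where the sum is over ordered pairs (a,b) of positive integers with gcd(a,b) = 1, ab ≠ 1, max{a,b} ≤ √B and T·min{a, b, |a − b|} < max{a,b}. -/
open scoped Classical

/-- `M_{a,b}(B)`: the number of positive integer triples `(x,y,z)` with
`(a²−b²)x² + (a²+b²)y² = 2z²`, `gcd(x,y) = 1` and `max{a,b}·max{x,y} ≤ B`. -/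
noncomputable def Mcount (a b : ℤ) (B : ℝ) : ℕ :=
  Set.ncard {p : ℤ × ℤ × ℤ |
    0 < p.1 ∧ 0 < p.2.1 ∧ 0 < p.2.2 ∧
    (a ^ 2 - b ^ 2) * p.1 ^ 2 + (a ^ 2 + b ^ 2) * p.2.1 ^ 2 = 2 * p.2.2 ^ 2 ∧
    Int.gcd p.1 p.2.1 = 1 ∧
    ((max a b : ℤ) : ℝ) * ((max p.1 p.2.1 : ℤ) : ℝ) ≤ B}

lemma card_le_of_floor_fibers {α : Type*} (S : Finset α) (g : α → ℝ) {h G : ℝ} (hh : 0 < h)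
    (hG : 0 ≤ G) (hgG : ∀ p ∈ S, g p ≤ G) (k : ℕ)
    (hk : ∀ c : ℕ, (S.filter fun p => ⌊g p / h⌋₊ = c).card ≤ k) :
    (S.card : ℝ) ≤ k * (G / h + 1) := by
  have h1 : S.card ≤ k * (Finset.range (⌊G / h⌋₊ + 1)).card := by
    apply Finset.card_le_mul_card_image_of_maps_to (f := fun p => ⌊g p / h⌋₊)
    · intro p hp
      simp only [Finset.mem_range]
      exact Nat.lt_succ_of_le (Nat.floor_le_floor (by gcongr; exact hgG p hp))
    · intro c _
      exact hk c
  rw [Finset.card_range] at h1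
  have h2 : (⌊G / h⌋₊ : ℝ) ≤ G / h := Nat.floor_le (by positivity)
  calc (S.card : ℝ) ≤ k * (⌊G / h⌋₊ + 1) := by exact_mod_cast h1
    _ ≤ _ := by gcongr

lemma abs_sub_lt_of_floor_div_eq {s t h : ℝ} (hh : 0 < h) (hs : 0 ≤ s) (ht : 0 ≤ t)
    (hst : ⌊s / h⌋₊ = ⌊t / h⌋₊) : |s - t| < h := by
  have h1 := Nat.floor_le (a := s / h) (by positivity)
  have h2 := Nat.lt_floor_add_one (s / h)
  have h3 := Nat.floor_le (a := t / h) (by positivity)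
  have h4 := Nat.lt_floor_add_one (t / h)
  rw [hst] at h1 h2
  have : |s / h - t / h| < 1 := by rw [abs_lt]; constructor <;> linarith
  rwa [← sub_div, abs_div, abs_of_pos hh, div_lt_one hh] at this

lemma eq_of_coprime_of_cross_eq {x y x' y' : ℤ} (hx : 0 < x) (hx' : 0 < x')
    (h : IsCoprime x y) (h' : IsCoprime x' y') (e : x * y' = x' * y) :
    x = x' ∧ y = y' := by
  have h1 : x ∣ x' := h.dvd_of_dvd_mul_right ⟨y', e.symm⟩
  have h2 : x' ∣ x := h'.dvd_of_dvd_mul_right ⟨y, e⟩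
  have h3 : x = x' := Int.dvd_antisymm hx.le hx'.le h1 h2
  subst h3
  exact ⟨rfl, (mul_left_cancel₀ hx.ne' e).symm⟩

lemma mul_dvd_two_mul {m n k s t : ℤ} (hm : m ∣ k) (hn : n ∣ k) (h : m * s + n * t = 2) :
    m * n ∣ 2 * k := by
  obtain ⟨u, hu⟩ := hm
  obtain ⟨v, hv⟩ := hn
  exact ⟨v * s + u * t, by rw [← h]; linear_combination (m * s) * hv + (n * t) * hu⟩

lemma dvd_four_mul_minor {A a e f y z y' z' : ℤ} (hA : A = e * f) (hc : IsCoprime A a)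
    (h1 : e ∣ 2 * (z - a * y)) (h2 : f ∣ z + a * y) (h1' : e ∣ 2 * (z' - a * y'))
    (h2' : f ∣ z' + a * y') : A ∣ 4 * (z * y' - z' * y) := by
  apply hc.dvd_of_dvd_mul_left
  have : a * (4 * (z * y' - z' * y)) =
      2 * (z - a * y) * (z' + a * y') - 2 * (z' - a * y') * (z + a * y) := by ring
  rw [this, hA]
  exact dvd_sub (mul_dvd_mul h1 h2') (mul_dvd_mul h1' h2)

lemma dvd_of_dvd_mul_of_gcd {A w v : ℤ} (hA : A ≠ 0) (h : A ∣ w * v) :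
    A = (Int.gcd A w : ℤ) * (A / Int.gcd A w) ∧ A / Int.gcd A w ∣ v := by
  have hg : (Int.gcd A w : ℤ) ∣ A := Int.gcd_dvd_left ..
  have hg0 : (Int.gcd A w : ℤ) ≠ 0 := by
    intro h0; rw [h0] at hg; exact hA (zero_dvd_iff.1 hg)
  have h1 : A = (Int.gcd A w : ℤ) * (A / Int.gcd A w) := (Int.mul_ediv_cancel' hg).symm
  refine ⟨h1, ?_⟩
  have h2 : A ∣ (Int.gcd A w : ℤ) * v := by
    rw [Int.coe_gcd]; exact dvd_gcd_mul_of_dvd_mul h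
  refine (mul_dvd_mul_iff_left hg0).1 ?_
  rwa [← h1]

/-- Determinant of three integer vectors. -/
def det3 (p q r : ℤ × ℤ × ℤ) : ℤ :=
  p.1 * (q.2.1 * r.2.2 - q.2.2 * r.2.1) - p.2.1 * (q.1 * r.2.2 - q.2.2 * r.1) +
    p.2.2 * (q.1 * r.2.1 - q.2.1 * r.1)

/-- The class of a point: the divisors of `a² - b²` and `a² + b²` it cuts out. -/
def conicClass (a b : ℤ) (p : ℤ × ℤ × ℤ) : ℕ × ℕ :=
  (Int.gcd (a ^ 2 - b ^ 2) (2 * (p.2.2 - a * p.2.1)), Int.gcd (a ^ 2 + b ^ 2) (2 * (p.2.2 - a * p.1)))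

def OnConic (a b : ℤ) (p : ℤ × ℤ × ℤ) : Prop :=
  (a ^ 2 - b ^ 2) * p.1 ^ 2 + (a ^ 2 + b ^ 2) * p.2.1 ^ 2 = 2 * p.2.2 ^ 2

lemma dvd_eight_mul_det3 {a b : ℤ} (hab : IsCoprime a b) (hA : a ^ 2 - b ^ 2 ≠ 0)
    (hB : a ^ 2 + b ^ 2 ≠ 0) {p q r : ℤ × ℤ × ℤ} (hp : OnConic a b p) (hq : OnConic a b q)
    (hr : OnConic a b r) (hpq : conicClass a b p = conicClass a b q)
    (hpr : conicClass a b p = conicClass a b r) :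
    (a ^ 2 - b ^ 2) * (a ^ 2 + b ^ 2) ∣ 8 * det3 p q r := by
  obtain ⟨s, t, hst⟩ : IsCoprime (a ^ 2) (b ^ 2) := hab.pow
  have hcA : IsCoprime (a ^ 2 - b ^ 2) a := by
    have : IsCoprime (b ^ 2) a := hab.symm.pow_left
    have h2 : a ^ 2 - b ^ 2 = -(b ^ 2 + a * (-a)) := by ring
    rw [h2]; exact (this.add_mul_left_left _).neg_left
  have hcB : IsCoprime (a ^ 2 + b ^ 2) a := by
    have : IsCoprime (b ^ 2) a := hab.symm.pow_left
    have h2 : a ^ 2 + b ^ 2 = b ^ 2 + a * a := by ring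
    rw [h2]; exact this.add_mul_left_left _
  have key : ∀ {p}, OnConic a b p →
      a ^ 2 - b ^ 2 ∣ 2 * (p.2.2 - a * p.2.1) * (p.2.2 + a * p.2.1) ∧
      a ^ 2 + b ^ 2 ∣ 2 * (p.2.2 - a * p.1) * (p.2.2 + a * p.1) := by
    intro p hp
    unfold OnConic at hp
    exact ⟨⟨p.1 ^ 2 - p.2.1 ^ 2, by linear_combination -hp⟩,
      ⟨p.2.1 ^ 2 - p.1 ^ 2, by linear_combination -hp⟩⟩
  have mA : ∀ {p q}, OnConic a b p → OnConic a b q → conicClass a b p = conicClass a b q →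
      a ^ 2 - b ^ 2 ∣ 4 * (p.2.2 * q.2.1 - q.2.2 * p.2.1) ∧
      a ^ 2 + b ^ 2 ∣ 4 * (p.2.2 * q.1 - q.2.2 * p.1) := by
    intro p q hp hq h
    simp only [conicClass, Prod.mk.injEq] at h
    have hp1 := dvd_of_dvd_mul_of_gcd hA (key hp).1
    have hq1 := dvd_of_dvd_mul_of_gcd hA (key hq).1
    have hp2 := dvd_of_dvd_mul_of_gcd hB (key hp).2
    have hq2 := dvd_of_dvd_mul_of_gcd hB (key hq).2
    rw [← h.1] at hq1
    rw [← h.2] at hq2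
    refine ⟨dvd_four_mul_minor hp1.1 hcA (Int.gcd_dvd_right ..) hp1.2 ?_ hq1.2,
      dvd_four_mul_minor hp2.1 hcB (Int.gcd_dvd_right ..) hp2.2 ?_ hq2.2⟩
    · rw [h.1]; exact Int.gcd_dvd_right ..
    · rw [h.2]; exact Int.gcd_dvd_right ..
  have hqr := hpq.symm.trans hpr
  have e : 8 * det3 p q r = 2 * (4 * det3 p q r) := by ring
  rw [e]
  apply mul_dvd_two_mul (s := s - t) (t := s + t) _ _ (by linear_combination 2 * hst)
  · have : 4 * det3 p q r = (4 * (r.2.2 * q.2.1 - q.2.2 * r.2.1)) * p.1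
        + (4 * (p.2.2 * r.2.1 - r.2.2 * p.2.1)) * q.1
        + (4 * (q.2.2 * p.2.1 - p.2.2 * q.2.1)) * r.1 := by unfold det3; ring
    rw [this]
    exact dvd_add (dvd_add (((mA hr hq hqr.symm).1).mul_right _) (((mA hp hr hpr).1).mul_right _))
      (((mA hq hp hpq.symm).1).mul_right _)
  · have : 4 * det3 p q r = (4 * (q.2.2 * r.1 - r.2.2 * q.1)) * p.2.1
        + (4 * (r.2.2 * p.1 - p.2.2 * r.1)) * q.2.1
        + (4 * (p.2.2 * q.1 - q.2.2 * p.1)) * r.2.1 := by unfold det3; ring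
    rw [this]
    exact dvd_add (dvd_add (((mA hq hr hqr).2).mul_right _) (((mA hr hp hpr.symm).2).mul_right _))
      (((mA hp hq hpq).2).mul_right _)

/-- The rational parameter of a point of the conic, from projecting away from `(1, 1, a)`. -/
noncomputable def conicParam (a : ℤ) (p : ℤ × ℤ × ℤ) : ℝ :=
  ((p.1 : ℝ) + p.2.1) / (p.2.2 + a * p.2.1)

/-- The scalar relating a point of the conic to the standard parametrisation. -/
noncomputable def conicScale (a b : ℤ) (p : ℤ × ℤ × ℤ) : ℝ :=
  2 * ((p.2.2 : ℝ) + a * p.2.1) * (p.2.2 + a * p.1) / ((a ^ 2 + b ^ 2) * (p.1 + p.2.1))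

lemma conic_parametrisation {a b : ℤ} (ha : 0 < a) {p : ℤ × ℤ × ℤ} (hp : OnConic a b p)
    (hx : 0 < p.1) (hy : 0 < p.2.1) (hz : 0 < p.2.2) :
    (p.1 : ℝ) - p.2.1 = conicScale a b p * (a * conicParam a p - 1) ∧
    (p.1 : ℝ) + p.2.1 = conicScale a b p * conicParam a p *
      (a - (a ^ 2 - b ^ 2) * conicParam a p / 2) ∧
    (p.2.2 : ℝ) + a * p.2.1 = conicScale a b p * (a - (a ^ 2 - b ^ 2) * conicParam a p / 2) := by
  obtain ⟨x, y, z⟩ := p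
  simp only [OnConic] at hp hx hy hz
  have hp' : ((a : ℝ) ^ 2 - b ^ 2) * x ^ 2 + (a ^ 2 + b ^ 2) * y ^ 2 = 2 * z ^ 2 := by
    exact_mod_cast hp
  have ha' : (0 : ℝ) < a := by exact_mod_cast ha
  have hx' : (0 : ℝ) < x := by exact_mod_cast hx
  have hy' : (0 : ℝ) < y := by exact_mod_cast hy
  have hz' : (0 : ℝ) < z := by exact_mod_cast hz
  have h1 : (z : ℝ) + a * y ≠ 0 := by positivity
  have h2 : (z : ℝ) + a * x ≠ 0 := by positivity
  have h3 : (x : ℝ) + y ≠ 0 := by positivity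
  have h4 : (a : ℝ) ^ 2 + b ^ 2 ≠ 0 := by positivity
  simp only [conicScale, conicParam]
  have h5 : (a : ℝ) - (a ^ 2 - b ^ 2) * ((x + y) / (z + a * y)) / 2 =
      (a ^ 2 + b ^ 2) * (x + y) / (2 * (z + a * x)) := by
    field_simp
    linear_combination (-(a : ℝ)) * hp'
  rw [h5]
  refine ⟨?_, ?_, ?_⟩ <;> field_simp
  linear_combination -hp'

lemma eight_mul_det3_eq {a b : ℤ} (ha : 0 < a) {p q r : ℤ × ℤ × ℤ} (hp : OnConic a b p)
    (hq : OnConic a b q) (hr : OnConic a b r)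
    (hp0 : 0 < p.1 ∧ 0 < p.2.1 ∧ 0 < p.2.2) (hq0 : 0 < q.1 ∧ 0 < q.2.1 ∧ 0 < q.2.2)
    (hr0 : 0 < r.1 ∧ 0 < r.2.1 ∧ 0 < r.2.2) :
    ((8 * det3 p q r : ℤ) : ℝ) = (((a ^ 2 - b ^ 2) * (a ^ 2 + b ^ 2) : ℤ) : ℝ) *
      ((conicScale a b p * conicScale a b q * conicScale a b r) *
        ((conicParam a p - conicParam a q) * (conicParam a q - conicParam a r) *
          (conicParam a p - conicParam a r))) := by
  have key : ∀ {p}, OnConic a b p → (0 < p.1 ∧ 0 < p.2.1 ∧ 0 < p.2.2) → ∃ l s : ℝ,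
      conicScale a b p = l ∧ conicParam a p = s ∧
      (p.1 : ℝ) = l * (s * (a - (a ^ 2 - b ^ 2) * s / 2) + (a * s - 1)) / 2 ∧
      (p.2.1 : ℝ) = l * (s * (a - (a ^ 2 - b ^ 2) * s / 2) - (a * s - 1)) / 2 ∧
      (p.2.2 : ℝ) = l * (a - (a ^ 2 - b ^ 2) * s / 2) -
        a * (l * (s * (a - (a ^ 2 - b ^ 2) * s / 2) - (a * s - 1)) / 2) := by
    intro p hp h
    obtain ⟨h1, h2, h3⟩ := conic_parametrisation ha hp h.1 h.2.1 h.2.2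
    have hy : (p.2.1 : ℝ) = conicScale a b p * (conicParam a p *
      (a - (a ^ 2 - b ^ 2) * conicParam a p / 2) - (a * conicParam a p - 1)) / 2 := by
      linear_combination (h2 - h1) / 2
    exact ⟨_, _, rfl, rfl, by linear_combination (h2 + h1) / 2, hy, by rw [← hy]; linear_combination h3⟩
  obtain ⟨l, s, e1, e2, e3, e4, e5⟩ := key hp hp0
  obtain ⟨l', s', e1', e2', e3', e4', e5'⟩ := key hq hq0
  obtain ⟨l'', s'', e1'', e2'', e3'', e4'', e5''⟩ := key hr hr0
  unfold det3
  push_cast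
  rw [e1, e2, e1', e2', e1'', e2'', e3, e4, e5, e3', e4', e5', e3'', e4'', e5'']
  ring

lemma conicParam_injective {a b : ℤ} (ha : 0 < a) {p q : ℤ × ℤ × ℤ} (hp : OnConic a b p)
    (hq : OnConic a b q) (hp0 : 0 < p.1 ∧ 0 < p.2.1 ∧ 0 < p.2.2)
    (hq0 : 0 < q.1 ∧ 0 < q.2.1 ∧ 0 < q.2.2) (hpc : IsCoprime p.1 p.2.1)
    (hqc : IsCoprime q.1 q.2.1) (h : conicParam a p = conicParam a q) : p = q := by
  obtain ⟨h1, h2, -⟩ := conic_parametrisation ha hp hp0.1 hp0.2.1 hp0.2.2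
  obtain ⟨h1', h2', -⟩ := conic_parametrisation ha hq hq0.1 hq0.2.1 hq0.2.2
  rw [h] at h1 h2
  have hx : (p.1 : ℝ) * q.2.1 = q.1 * p.2.1 := by
    have : ((p.1 : ℝ) - p.2.1) * (q.1 + q.2.1) = (q.1 - q.2.1) * (p.1 + p.2.1) := by
      rw [h1, h2, h1', h2']; ring
    linarith
  obtain ⟨ex, ey⟩ := eq_of_coprime_of_cross_eq hp0.1 hq0.1 hpc hqc
    (by exact_mod_cast hx)
  have ez : p.2.2 = q.2.2 := by
    unfold OnConic at hp hq
    rw [ex, ey] at hp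
    have : p.2.2 ^ 2 = q.2.2 ^ 2 := by linarith
    exact (pow_left_inj₀ hp0.2.2.le hq0.2.2.le two_ne_zero).1 this
  exact Prod.ext ex (Prod.ext ey ez)

/-- The positive primitive points of height at most `H` on the conic. -/
structure IsConicPoint (a b : ℤ) (H : ℝ) (p : ℤ × ℤ × ℤ) : Prop where
  onConic : OnConic a b p
  pos : 0 < p.1 ∧ 0 < p.2.1 ∧ 0 < p.2.2
  coprime : IsCoprime p.1 p.2.1
  fst_le : (p.1 : ℝ) ≤ H
  snd_le : (p.2.1 : ℝ) ≤ H

lemma IsConicPoint.conicScale_mul_le {a b : ℤ} {H M : ℝ} (ha : 0 < a) (hb : 0 < b)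
    (hM : M = max (a : ℝ) b) {p : ℤ × ℤ × ℤ} (hp : IsConicPoint a b H p) :
    0 < conicParam a p ∧ 0 < conicScale a b p ∧
      conicScale a b p * (1 + M * conicParam a p) ≤ 24 * H := by
  obtain ⟨hp, ⟨hx, hy, hz⟩, -, h1, h2⟩ := hp
  obtain ⟨x, y, z⟩ := p
  simp only [OnConic] at hp hx hy hz h1 h2
  have hp' : ((a : ℝ) ^ 2 - b ^ 2) * x ^ 2 + (a ^ 2 + b ^ 2) * y ^ 2 = 2 * z ^ 2 := by
    exact_mod_cast hp
  have ha' : (0 : ℝ) < a := by exact_mod_cast ha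
  have hb' : (0 : ℝ) < b := by exact_mod_cast hb
  have hx' : (0 : ℝ) < x := by exact_mod_cast hx
  have hy' : (0 : ℝ) < y := by exact_mod_cast hy
  have hz' : (0 : ℝ) < z := by exact_mod_cast hz
  have haM : (a : ℝ) ≤ M := hM ▸ le_max_left _ _
  have hbM : (b : ℝ) ≤ M := hM ▸ le_max_right _ _
  have hM0 : 0 < M := ha'.trans_le haM
  have ha2 : (a : ℝ) ^ 2 ≤ M ^ 2 := by gcongr
  have hb2 : (b : ℝ) ^ 2 ≤ M ^ 2 := by gcongr
  have hN : M ^ 2 ≤ (a : ℝ) ^ 2 + b ^ 2 := by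
    rcases max_choice (a : ℝ) b with h | h <;> rw [hM, h] <;> nlinarith
  have hzM : (z : ℝ) ≤ M * (x + y) := by
    have : (z : ℝ) ^ 2 ≤ (M * (x + y)) ^ 2 := by
      have e1 : (a : ℝ) ^ 2 * (x ^ 2 + y ^ 2) ≤ M ^ 2 * (x ^ 2 + y ^ 2) := by gcongr
      have e2 : (b : ℝ) ^ 2 * y ^ 2 ≤ M ^ 2 * y ^ 2 := by gcongr
      have e3 : 0 ≤ (b : ℝ) ^ 2 * x ^ 2 := by positivity
      have e4 : 0 ≤ M ^ 2 * (x * y) := by positivity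
      have e5 : 0 ≤ M ^ 2 * x ^ 2 := by positivity
      nlinarith
    exact (pow_le_pow_iff_left₀ hz'.le (by positivity) two_ne_zero).1 this
  have hay : (z : ℝ) + a * y ≤ 2 * M * (x + y) := by nlinarith
  have hax : (z : ℝ) + a * x ≤ 2 * M * (x + y) := by nlinarith
  simp only [conicScale, conicParam]
  refine ⟨by positivity, by positivity, ?_⟩
  have e : 2 * ((z : ℝ) + a * y) * (z + a * x) / ((a ^ 2 + b ^ 2) * (x + y)) *
      (1 + M * ((x + y) / (z + a * y))) =
      (2 * ((z : ℝ) + a * y) * (z + a * x) / (x + y) + 2 * M * (z + a * x)) / (a ^ 2 + b ^ 2) := by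
    field_simp
  rw [e, div_le_iff₀ (by positivity)]
  have h3 : 2 * ((z : ℝ) + a * y) * (z + a * x) / (x + y) ≤ 8 * M ^ 2 * (x + y) := by
    rw [div_le_iff₀ (by positivity)]
    calc 2 * ((z : ℝ) + a * y) * (z + a * x) ≤ 2 * (2 * M * (x + y)) * (2 * M * (x + y)) := by
          gcongr
      _ = _ := by ring
  have h4 : 2 * M * (z + a * x) ≤ 4 * M ^ 2 * (x + y) := by nlinarith
  have h5 : M ^ 2 * (x + y) ≤ (a ^ 2 + b ^ 2) * (2 * H) := by
    gcongr
    linarith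
  linarith

lemma sq_mul_conicParam_le {a b : ℤ} (ha : 0 < a) (hb : 0 < b) {M : ℝ}
    (hM : M = max (a : ℝ) b) {Q : ℝ} (hQ : 1 ≤ Q) (hQa : M ≤ Q * a) (hQab : M ≤ Q * |(a : ℝ) - b|)
    {p : ℤ × ℤ × ℤ} (hp : OnConic a b p) (hp0 : 0 < p.1 ∧ 0 < p.2.1 ∧ 0 < p.2.2) :
    (M * conicParam a p) ^ 2 ≤ 6 * Q ^ 3 := by
  obtain ⟨x, y, z⟩ := p
  simp only [OnConic] at hp hp0
  obtain ⟨hx, hy, hz⟩ := hp0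
  have hp' : ((a : ℝ) ^ 2 - b ^ 2) * x ^ 2 + (a ^ 2 + b ^ 2) * y ^ 2 = 2 * z ^ 2 := by
    exact_mod_cast hp
  have ha' : (0 : ℝ) < a := by exact_mod_cast ha
  have hb' : (0 : ℝ) < b := by exact_mod_cast hb
  have hx' : (0 : ℝ) < x := by exact_mod_cast hx
  have hy' : (0 : ℝ) < y := by exact_mod_cast hy
  have hz' : (0 : ℝ) < z := by exact_mod_cast hz
  have haM : (a : ℝ) ≤ M := hM ▸ le_max_left _ _
  have hbM : (b : ℝ) ≤ M := hM ▸ le_max_right _ _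
  have hM0 : 0 < M := ha'.trans_le haM
  have hM1 : M ≤ a + b := by rw [hM]; exact max_le (by linarith) (by linarith)
  have hQ3 : Q ≤ Q ^ 3 := le_self_pow₀ hQ (by norm_num)
  have hsq : ((x : ℝ) + y) ^ 2 ≤ 2 * (x ^ 2 + y ^ 2) := by nlinarith [sq_nonneg ((x : ℝ) - y)]
  simp only [conicParam]
  rw [← mul_div_assoc, div_pow, div_le_iff₀ (by positivity)]
  rcases le_total (b : ℝ) a with h | h
  · have hMa : M = a := by rw [hM, max_eq_left h]
    rw [abs_of_nonneg (by linarith)] at hQab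
    have hA : M ^ 2 ≤ Q * ((a : ℝ) ^ 2 - b ^ 2) := by
      calc M ^ 2 = M * M := sq M
        _ ≤ (Q * (a - b)) * (a + b) := by gcongr
        _ = _ := by ring
    have hB : M ^ 2 ≤ Q * ((a : ℝ) ^ 2 + b ^ 2) := by nlinarith
    have h1 : M ^ 2 * (x ^ 2 + y ^ 2) ≤ Q * (2 * z ^ 2) := by
      rw [← hp']
      have e1 : M ^ 2 * x ^ 2 ≤ Q * ((a : ℝ) ^ 2 - b ^ 2) * x ^ 2 := by gcongr
      have e2 : M ^ 2 * y ^ 2 ≤ Q * ((a : ℝ) ^ 2 + b ^ 2) * y ^ 2 := by gcongr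
      linarith
    calc (M * ((x : ℝ) + y)) ^ 2 = M ^ 2 * (x + y) ^ 2 := by ring
      _ ≤ M ^ 2 * (2 * (x ^ 2 + y ^ 2)) := by gcongr
      _ ≤ 4 * Q * z ^ 2 := by linarith
      _ ≤ 6 * Q ^ 3 * (z + a * y) ^ 2 := by
        gcongr
        · norm_num
        · nlinarith
  · have hMb : M = b := by rw [hM, max_eq_right h]
    rw [abs_of_nonpos (by linarith)] at hQab
    have hA : M ^ 2 ≤ Q * ((b : ℝ) ^ 2 - a ^ 2) := by
      calc M ^ 2 = M * M := sq M
        _ ≤ (Q * (-((a : ℝ) - b))) * (a + b) := by gcongr; linarith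
        _ = _ := by ring
    have ha2 : (a : ℝ) ^ 2 ≤ M ^ 2 := by gcongr
    have h1 : M ^ 2 * x ^ 2 ≤ M ^ 2 * (2 * Q * y ^ 2) := by
      calc M ^ 2 * x ^ 2 ≤ Q * ((b : ℝ) ^ 2 - a ^ 2) * x ^ 2 := by gcongr
        _ = Q * (((b : ℝ) ^ 2 - a ^ 2) * x ^ 2) := by ring
        _ ≤ Q * (((a : ℝ) ^ 2 + b ^ 2) * y ^ 2) :=
          mul_le_mul_of_nonneg_left (by nlinarith) (by linarith)
        _ ≤ Q * ((M ^ 2 + M ^ 2) * y ^ 2) := by gcongr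
        _ = _ := by ring
    have h2 : (x : ℝ) ^ 2 ≤ 2 * Q * y ^ 2 := le_of_mul_le_mul_left h1 (by positivity)
    have h3 : ((x : ℝ) + y) ^ 2 ≤ 6 * Q * y ^ 2 := by
      have : (y : ℝ) ^ 2 ≤ Q * y ^ 2 := le_mul_of_one_le_left (by positivity) hQ
      linarith
    calc (M * ((x : ℝ) + y)) ^ 2 = M ^ 2 * (x + y) ^ 2 := by ring
      _ ≤ (Q * a) ^ 2 * (6 * Q * y ^ 2) := by gcongr
      _ = 6 * Q ^ 3 * (a * y) ^ 2 := by ring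
      _ ≤ 6 * Q ^ 3 * (z + a * y) ^ 2 := by gcongr; linarith

lemma abs_sub_le_of_abs_log_sub_le {u v h : ℝ} (hu : 0 < u) (hv : 0 < v) (hh : h ≤ 1)
    (huv : |Real.log u - Real.log v| ≤ h) : |u - v| ≤ 2 * h * u := by
  have h1 : v = u * Real.exp (Real.log v - Real.log u) := by
    rw [Real.exp_sub, Real.exp_log hu, Real.exp_log hv]; field_simp
  have h2 := Real.abs_exp_sub_one_le (x := Real.log v - Real.log u)
    (by rw [abs_sub_comm]; exact huv.trans hh)
  rw [abs_sub_comm (Real.log v)] at h2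
  have h3 : v - u = u * (Real.exp (Real.log v - Real.log u) - 1) := by
    rw [mul_sub, ← h1, mul_one]
  rw [abs_sub_comm, h3, abs_mul, abs_of_pos hu]
  nlinarith

lemma card_conicClass_le {a b : ℤ} {H M h : ℝ} (ha : 0 < a) (hb : 0 < b) (hne : a ≠ b)
    (hab : IsCoprime a b) (hM : M = max (a : ℝ) b) (hh : 0 < h) (hh1 : h ≤ 1)
    (hhH : 48 * H * h < M) {n : ℕ} (hn : 1 ≤ n) (hna : M ≤ 2 ^ n * a)
    (hnab : M ≤ 2 ^ n * |(a : ℝ) - b|) (F : Finset (ℤ × ℤ × ℤ))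
    (hF : ∀ p ∈ F, IsConicPoint a b H p)
    (hcl : ∀ p ∈ F, ∀ q ∈ F, conicClass a b p = conicClass a b q) :
    (F.card : ℝ) ≤ 2 * (3 * n / h + 1) := by
  have ha' : (0 : ℝ) < a := by exact_mod_cast ha
  have hM0 : 0 < M := ha'.trans_le (hM ▸ le_max_left _ _)
  set g : ℤ × ℤ × ℤ → ℝ := fun p => Real.log (1 + M * conicParam a p) with hg
  have hσ : ∀ p ∈ F, 0 < conicParam a p := fun p hp =>
    ((hF p hp).conicScale_mul_le ha hb hM).1
  have hu : ∀ p ∈ F, 1 ≤ 1 + M * conicParam a p := fun p hp => by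
    have := mul_pos hM0 (hσ p hp); linarith
  have hg0 : ∀ p ∈ F, 0 ≤ g p := fun p hp => Real.log_nonneg (hu p hp)
  have hgG : ∀ p ∈ F, g p ≤ 3 * n := by
    intro p hp
    have h1 := sq_mul_conicParam_le ha hb hM (one_le_pow₀ (by norm_num)) hna hnab
      (hF p hp).onConic (hF p hp).pos
    have h2 : (8 : ℝ) ≤ 8 ^ n := le_self_pow₀ (by norm_num) (by omega)
    have h3 : 1 + M * conicParam a p ≤ 8 ^ n := by
      have e : ((2 : ℝ) ^ n) ^ 3 = 8 ^ n := by rw [← pow_mul, mul_comm, pow_mul]; norm_num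
      rw [e] at h1
      have : (M * conicParam a p) ^ 2 ≤ (8 ^ n - 1) ^ 2 := by nlinarith
      have := abs_le_of_sq_le_sq this (by linarith)
      linarith [le_abs_self (M * conicParam a p)]
    have h4 : (8 : ℝ) = 2 ^ 3 := by norm_num
    calc g p ≤ Real.log (8 ^ n) := Real.log_le_log (by linarith [hu p hp]) h3
      _ = n * (3 * Real.log 2) := by rw [Real.log_pow, h4, Real.log_pow]; norm_num
      _ ≤ n * (3 * 1) := by gcongr; linarith [Real.log_two_lt_d9]
      _ = 3 * n := by ring
  refine card_le_of_floor_fibers F g hh (by positivity) hgG 2 fun c => ?_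
  by_contra! hcon
  obtain ⟨p, hp, q, hq, r, hr, hpq, hpr, hqr⟩ := Finset.two_lt_card.1 hcon
  rw [Finset.mem_filter] at hp hq hr
  have key : ∀ {p q}, p ∈ F → q ∈ F → ⌊g p / h⌋₊ = c → ⌊g q / h⌋₊ = c →
      |conicParam a p - conicParam a q| ≤ 2 * h * (1 + M * conicParam a p) / M := by
    intro p q hp hq hpc hqc
    have h1 := abs_sub_lt_of_floor_div_eq hh (hg0 p hp) (hg0 q hq) (hpc.trans hqc.symm)
    have h2 := abs_sub_le_of_abs_log_sub_le (by linarith [hu p hp]) (by linarith [hu q hq]) hh1 h1.le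
    rw [le_div_iff₀ hM0]
    have h3 : (1 + M * conicParam a p) - (1 + M * conicParam a q) =
      (conicParam a p - conicParam a q) * M := by ring
    rwa [h3, abs_mul, abs_of_pos hM0] at h2
  have hA : a ^ 2 - b ^ 2 ≠ 0 := by
    intro h0
    exact hne ((pow_left_inj₀ ha.le hb.le two_ne_zero).1 (by linarith))
  have hB : a ^ 2 + b ^ 2 ≠ 0 := by positivity
  have Fp := hF p hp.1
  have Fq := hF q hq.1
  have Fr := hF r hr.1
  have hdvd := dvd_eight_mul_det3 hab hA hB Fp.onConic Fq.onConic Fr.onConic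
    (hcl p hp.1 q hq.1) (hcl p hp.1 r hr.1)
  have heq := eight_mul_det3_eq ha Fp.onConic Fq.onConic Fr.onConic Fp.pos Fq.pos Fr.pos
  obtain ⟨-, lp, bp⟩ := Fp.conicScale_mul_le ha hb hM
  obtain ⟨-, lq, bq⟩ := Fq.conicScale_mul_le ha hb hM
  obtain ⟨-, lr, br⟩ := Fr.conicScale_mul_le ha hb hM
  have inj : ∀ {p q}, IsConicPoint a b H p → IsConicPoint a b H q → p ≠ q →
      conicParam a p - conicParam a q ≠ 0 := fun hp hq hpq h0 =>
    hpq (conicParam_injective ha hp.onConic hq.onConic hp.pos hq.pos hp.coprime hq.coprime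
      (sub_eq_zero.1 h0))
  have hdet0 : 8 * det3 p q r ≠ 0 := by
    intro h0
    rw [h0, Int.cast_zero, eq_comm, mul_eq_zero] at heq
    rcases heq with h1 | h1
    · exact mul_ne_zero hA hB (by exact_mod_cast h1)
    · exact mul_ne_zero (mul_pos (mul_pos lp lq) lr).ne'
        (mul_ne_zero (mul_ne_zero (inj Fp Fq hpq) (inj Fq Fr hqr)) (inj Fp Fr hpr)) h1
  have hle : |(a ^ 2 - b ^ 2) * (a ^ 2 + b ^ 2)| ≤ |8 * det3 p q r| :=
    Int.le_of_dvd (abs_pos.2 hdet0) ((abs_dvd_abs _ _).2 hdvd)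
  have hle' : |(((a ^ 2 - b ^ 2) * (a ^ 2 + b ^ 2) : ℤ) : ℝ)| ≤ |((8 * det3 p q r : ℤ) : ℝ)| := by
    exact_mod_cast hle
  have hpos : 0 < |(((a ^ 2 - b ^ 2) * (a ^ 2 + b ^ 2) : ℤ) : ℝ)| :=
    abs_pos.2 (by exact_mod_cast mul_ne_zero hA hB)
  rw [heq, abs_mul] at hle'
  have hone := le_of_mul_le_mul_left ((mul_one _).trans_le hle') hpos
  rw [abs_mul, abs_of_pos (mul_pos (mul_pos lp lq) lr), abs_mul, abs_mul] at hone
  have d1 := key hp.1 hq.1 hp.2 hq.2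
  have d2 := key hq.1 hr.1 hq.2 hr.2
  have d3 := key hr.1 hp.1 hr.2 hp.2
  rw [abs_sub_comm] at d3
  have up := hu p hp.1
  have uq := hu q hq.1
  have ur := hu r hr.1
  set U := 1 + M * conicParam a p
  set V := 1 + M * conicParam a q
  set W := 1 + M * conicParam a r
  have hH : 0 < H := by
    have : (0 : ℝ) < p.1 := by exact_mod_cast Fp.pos.1
    exact this.trans_le Fp.fst_le
  have hfin : conicScale a b p * conicScale a b q * conicScale a b r *
      (|conicParam a p - conicParam a q| * |conicParam a q - conicParam a r| *
        |conicParam a p - conicParam a r|) < 1 := by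
    calc _ ≤ conicScale a b p * conicScale a b q * conicScale a b r *
          ((2 * h * U / M) * (2 * h * V / M) * (2 * h * W / M)) := by gcongr
      _ = (conicScale a b p * U) * (conicScale a b q * V) * (conicScale a b r * W) *
          (2 * h / M) ^ 3 := by ring
      _ ≤ (24 * H) * (24 * H) * (24 * H) * (2 * h / M) ^ 3 := by gcongr
      _ = (48 * H * h / M) ^ 3 := by ring
      _ < 1 := pow_lt_one₀ (by positivity) ((div_lt_one hM0).2 hhH) (by norm_num)
  linarith

lemma Mcount_le {a b : ℤ} {B M : ℝ} (ha : 0 < a) (hb : 0 < b) (hne : a ≠ b)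
    (hab : IsCoprime a b) (hM : M = max (a : ℝ) b) (hMB : M ^ 2 ≤ B) {n : ℕ} (hn : 1 ≤ n)
    (hna : M ≤ 2 ^ n * a) (hnab : M ≤ 2 ^ n * |(a : ℝ) - b|) :
    (Mcount a b B : ℝ) ≤ 296 * n * (B / M ^ 2) * ((a - b).natAbs.divisors.card *
      (a + b).natAbs.divisors.card * (a ^ 2 + b ^ 2).natAbs.divisors.card) := by
  have ha' : (0 : ℝ) < a := by exact_mod_cast ha
  have hM0 : 0 < M := ha'.trans_le (hM ▸ le_max_left _ _)
  have hM2 : 0 < M ^ 2 := by positivity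
  have hB0 : 0 < B := hM2.trans_le hMB
  have hA : a ^ 2 - b ^ 2 ≠ 0 := by
    intro h0
    exact hne ((pow_left_inj₀ ha.le hb.le two_ne_zero).1 (by linarith))
  have hB : a ^ 2 + b ^ 2 ≠ 0 := by positivity
  unfold Mcount
  set S := {p : ℤ × ℤ × ℤ |
    0 < p.1 ∧ 0 < p.2.1 ∧ 0 < p.2.2 ∧
    (a ^ 2 - b ^ 2) * p.1 ^ 2 + (a ^ 2 + b ^ 2) * p.2.1 ^ 2 = 2 * p.2.2 ^ 2 ∧
    Int.gcd p.1 p.2.1 = 1 ∧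
    ((max a b : ℤ) : ℝ) * ((max p.1 p.2.1 : ℤ) : ℝ) ≤ B} with hS
  by_cases hfin : S.Finite
  swap
  · rw [Set.Infinite.ncard hfin]
    push_cast
    positivity
  rw [Set.ncard_eq_toFinset_card S hfin]
  have hpt : ∀ p ∈ hfin.toFinset, IsConicPoint a b (B / M) p := by
    intro p hp
    rw [Set.Finite.mem_toFinset] at hp
    obtain ⟨h1, h2, h3, h4, h5, h6⟩ := hp
    push_cast at h6
    rw [← hM] at h6
    refine ⟨h4, ⟨h1, h2, h3⟩, Int.isCoprime_iff_gcd_eq_one.2 h5, ?_, ?_⟩ <;>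
      rw [le_div_iff₀' hM0] <;> refine le_trans ?_ h6 <;> gcongr
    · exact le_max_left _ _
    · exact le_max_right _ _
  have hfib : ∀ c : ℕ × ℕ, ((hfin.toFinset.filter fun p => conicClass a b p = c).card : ℝ) ≤
      296 * n * (B / M ^ 2) := by
    intro c
    have h := card_conicClass_le (H := B / M) (h := M ^ 2 / (49 * B)) ha hb hne hab hM
      (by positivity) (by rw [div_le_one (by positivity)]; linarith)
      (by
        have : 48 * (B / M) * (M ^ 2 / (49 * B)) = 48 / 49 * M := by field_simp
        rw [this]; linarith) hn hna hnab (hfin.toFinset.filter fun p => conicClass a b p = c)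
      (fun p hp => hpt p (Finset.mem_of_mem_filter p hp))
      (fun p hp q hq => by
        rw [(Finset.mem_filter.1 hp).2, (Finset.mem_filter.1 hq).2])
    refine h.trans ?_
    have h1 : 1 ≤ B / M ^ 2 := (one_le_div hM2).2 hMB
    have h2 : (1 : ℝ) ≤ n := by exact_mod_cast hn
    have h3 : 3 * (n : ℝ) / (M ^ 2 / (49 * B)) = 147 * n * (B / M ^ 2) := by field_simp; ring
    rw [h3]
    nlinarith
  have hcard : (hfin.toFinset.card : ℝ) ≤ (((a ^ 2 - b ^ 2).natAbs.divisors ×ˢ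
      (a ^ 2 + b ^ 2).natAbs.divisors).card : ℝ) * (296 * n * (B / M ^ 2)) := by
    rw [Finset.card_eq_sum_card_fiberwise (f := conicClass a b)
      (t := (a ^ 2 - b ^ 2).natAbs.divisors ×ˢ (a ^ 2 + b ^ 2).natAbs.divisors)]
    · push_cast
      rw [← nsmul_eq_mul]
      exact Finset.sum_le_card_nsmul _ _ _ fun c _ => hfib c
    · intro p _
      simp only [conicClass, Finset.coe_product, Set.mem_prod, Finset.mem_coe, Nat.mem_divisors,
        Int.natAbs_ne_zero]
      exact ⟨⟨Int.gcd_dvd_natAbs_left .., hA⟩, ⟨Int.gcd_dvd_natAbs_left .., hB⟩⟩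
  refine hcard.trans ?_
  rw [Finset.card_product, mul_comm]
  have hmul : (a ^ 2 - b ^ 2).natAbs.divisors.card ≤
      (a - b).natAbs.divisors.card * (a + b).natAbs.divisors.card := by
    have : a ^ 2 - b ^ 2 = (a - b) * (a + b) := by ring
    rw [this, Int.natAbs_mul, Nat.divisors_mul]
    exact Finset.card_mul_le (α := ℕ)
  push_cast
  gcongr
  exact_mod_cast hmul

lemma card_divisors_le_two_mul {n N : ℕ} (hN : n < (N + 1) ^ 2) :
    n.divisors.card ≤ 2 * ((Finset.Icc 1 N).filter (· ∣ n)).card := by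
  rcases Nat.eq_zero_or_pos n with rfl | hn
  · simp
  set D := (Finset.Icc 1 N).filter (· ∣ n)
  have hsub : n.divisors ⊆ D ∪ D.image (n / ·) := by
    intro d hd
    have hdn := Nat.dvd_of_mem_divisors hd
    have hd0 := Nat.pos_of_mem_divisors hd
    have hq0 : 0 < n / d := Nat.div_pos (Nat.le_of_dvd hn hdn) hd0
    have hmul : d * (n / d) = n := Nat.mul_div_cancel' hdn
    rw [Finset.mem_union]
    by_cases h : d ≤ N
    · left
      exact Finset.mem_filter.2 ⟨Finset.mem_Icc.2 ⟨hd0, h⟩, hdn⟩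
    · right
      refine Finset.mem_image.2 ⟨n / d, Finset.mem_filter.2 ⟨Finset.mem_Icc.2 ⟨hq0, ?_⟩,
        Nat.div_dvd_of_dvd hdn⟩, Nat.div_div_self hdn hn.ne'⟩
      by_contra! h'
      push Not at h
      have : (N + 1) * (N + 1) ≤ d * (n / d) := Nat.mul_le_mul h h'
      nlinarith
  calc n.divisors.card ≤ (D ∪ D.image (n / ·)).card := Finset.card_le_card hsub
    _ ≤ D.card + (D.image (n / ·)).card := Finset.card_union_le _ _
    _ ≤ D.card + D.card := Nat.add_le_add_left Finset.card_image_le _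
    _ = 2 * D.card := by ring

/-- `u + iv` divides `a + ib` in the Gaussian integers, in coordinates. -/
def GaussDvd (u v a b : ℤ) : Prop := ∃ c e : ℤ, a = u * c - v * e ∧ b = u * e + v * c

lemma exists_gaussDvd {a b : ℤ} (hab : IsCoprime a b) {d : ℤ} (hd : 0 < d)
    (hdvd : d ∣ a ^ 2 + b ^ 2) : ∃ u v : ℤ, u ^ 2 + v ^ 2 = d ∧ GaussDvd u v a b := by
  obtain ⟨m, hm⟩ := hdvd
  set α : GaussianInt := ⟨a, b⟩ with hα
  set γ : GaussianInt := EuclideanDomain.gcd (d : GaussianInt) α with hγ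
  have hd0 : (d : GaussianInt) ≠ 0 := by exact_mod_cast hd.ne'
  obtain ⟨δ, hδ⟩ : γ ∣ (d : GaussianInt) := EuclideanDomain.gcd_dvd_left _ _
  obtain ⟨β, hβ⟩ : γ ∣ α := EuclideanDomain.gcd_dvd_right _ _
  have hbez := EuclideanDomain.gcd_eq_gcd_ab (d : GaussianInt) α
  rw [← hγ] at hbez
  have hγ0 : γ ≠ 0 := by rintro h; rw [h, zero_mul] at hδ; exact hd0 hδ
  have hcop : IsCoprime δ β := by
    refine ⟨EuclideanDomain.gcdA (d : GaussianInt) α, EuclideanDomain.gcdB (d : GaussianInt) α, ?_⟩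
    apply mul_left_cancel₀ hγ0
    rw [mul_one]
    conv_rhs => rw [hbez]
    linear_combination (-EuclideanDomain.gcdA (d : GaussianInt) α) * hδ -
      (EuclideanDomain.gcdB (d : GaussianInt) α) * hβ
  have hnorm : α * star α = d * m := by
    rw [← Zsqrtd.norm_eq_mul_conj]
    have : α.norm = d * m := by rw [← hm]; simp [Zsqrtd.norm, hα]; ring
    rw [this]; push_cast; ring
  have h1 : β * star α = δ * m := by
    apply mul_left_cancel₀ hγ0
    rw [← mul_assoc, ← hβ, hnorm, hδ]; ring
  have h2 : δ ∣ star α := hcop.dvd_of_dvd_mul_left ⟨m, h1⟩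
  have h3 : star δ ∣ α := by
    obtain ⟨c, hc⟩ := h2
    exact ⟨star c, by rw [← star_mul', ← hc, star_star]⟩
  have h4 : star δ ∣ (d : GaussianInt) := by
    refine ⟨star γ, ?_⟩
    rw [← star_mul', mul_comm, ← hδ]
    ext <;> simp
  obtain ⟨ε, hε⟩ : star δ ∣ γ := by
    rw [hbez]; exact dvd_add (h4.mul_right _) (h3.mul_right _)
  have h5 : (d : GaussianInt) = (δ.norm : GaussianInt) * ε := by
    rw [hδ, hε, Zsqrtd.norm_eq_mul_conj]; ring
  have hre : d = δ.norm * ε.re := by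
    have := congrArg Zsqrtd.re h5
    simpa using this
  have him : 0 = δ.norm * ε.im := by
    have := congrArg Zsqrtd.im h5
    simpa using this
  have hδ0 : δ.norm ≠ 0 := by rintro h; rw [h, zero_mul] at hre; exact hd.ne' hre
  have him0 : ε.im = 0 := by
    rcases mul_eq_zero.1 him.symm with h | h
    · exact absurd h hδ0
    · exact h
  have hε' : ε = (ε.re : GaussianInt) := by ext <;> simp [him0]
  have hεα : ((ε.re : ℤ) : GaussianInt) ∣ α := by
    rw [← hε', hβ, hε]; exact (Dvd.intro_left _ rfl : ε ∣ star δ * ε).mul_right _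
  rw [Zsqrtd.intCast_dvd] at hεα
  have hunit : IsUnit ε.re := hab.isUnit_of_dvd' hεα.1 hεα.2
  have hδn : 0 ≤ δ.norm := GaussianInt.norm_nonneg δ
  have hone : ε.re = 1 := by
    rcases Int.isUnit_iff.1 hunit with h | h
    · exact h
    · rw [h] at hre; linarith
  rw [hone, mul_one] at hre
  obtain ⟨c, hc⟩ := h3
  refine ⟨δ.re, -δ.im, ?_, c.re, c.im, ?_, ?_⟩
  · rw [hre]; simp [Zsqrtd.norm]; ring
  · have := congrArg Zsqrtd.re hc
    simp [hα] at this
    linarith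
  · have := congrArg Zsqrtd.im hc
    simp [hα] at this
    linarith

/-- The nonzero Gaussian integers whose coordinates are at most `N` in absolute value. -/
noncomputable def gaussBox (N : ℕ) : Finset (ℤ × ℤ) := (Finset.Icc 1 N).biUnion fun k => Finset.box k

lemma card_divisors_sq_add_sq_le {a b : ℤ} (hab : IsCoprime a b) {X : ℕ}
    (hX : a ^ 2 + b ^ 2 ≤ 2 * (X : ℤ) ^ 2) :
    (a ^ 2 + b ^ 2).natAbs.divisors.card ≤
      2 * ((gaussBox (Nat.sqrt (2 * X))).filter fun w => GaussDvd w.1 w.2 a b).card := by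
  have hlt : (a ^ 2 + b ^ 2).natAbs < (2 * X + 1) ^ 2 := by
    zify
    rw [abs_of_nonneg (by positivity)]
    nlinarith [Int.natCast_nonneg X]
  refine (card_divisors_le_two_mul hlt).trans (Nat.mul_le_mul_left 2 ?_)
  apply Finset.card_le_card_of_surjOn (fun w : ℤ × ℤ => (w.1 ^ 2 + w.2 ^ 2).natAbs)
  intro d hd
  simp only [Finset.coe_filter, Finset.mem_Icc, Set.mem_ofPred_eq] at hd
  obtain ⟨⟨hd1, hd2⟩, hd3⟩ := hd
  obtain ⟨u, v, huv, hg⟩ := exists_gaussDvd hab (d := d) (by exact_mod_cast hd1)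
    (Int.natCast_dvd.2 hd3)
  refine ⟨(u, v), ?_, by simp [huv]⟩
  simp only [Finset.coe_filter, Set.mem_ofPred_eq]
  refine ⟨?_, hg⟩
  simp only [gaussBox, Finset.mem_biUnion, Finset.mem_Icc, Int.mem_box]
  refine ⟨_, ⟨?_, ?_⟩, rfl⟩
  · by_contra! h
    have hu : u = 0 := by omega
    have hv : v = 0 := by omega
    subst hu hv
    simp at huv
    omega
  · refine max_le (Nat.le_sqrt'.2 ?_) (Nat.le_sqrt'.2 ?_) <;> zify <;> rw [sq_abs] <;>
      nlinarith [sq_nonneg u, sq_nonneg v]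

lemma dvd_four_mul_cross {d₁ d₂ u v a b a' b' : ℤ} (hab : IsCoprime a b)
    (h₁ : d₁ ∣ a - b) (h₁' : d₁ ∣ a' - b') (h₂ : d₂ ∣ a + b) (h₂' : d₂ ∣ a' + b')
    (hw : GaussDvd u v a b) (hw' : GaussDvd u v a' b') :
    d₁ * d₂ * (u ^ 2 + v ^ 2) ∣ 4 * (a * b' - a' * b) := by
  obtain ⟨c, e, hc, he⟩ := hw
  obtain ⟨c', e', hc', he'⟩ := hw'
  obtain ⟨k₁, hk₁⟩ := h₁
  obtain ⟨k₂, hk₂⟩ := h₂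
  obtain ⟨k₁', hk₁'⟩ := h₁'
  obtain ⟨k₂', hk₂'⟩ := h₂'
  have g₁ : d₁ ∣ a * b' - a' * b :=
    ⟨k₁ * b' - k₁' * b, by linear_combination b' * hk₁ - b * hk₁'⟩
  have g₂ : d₂ ∣ a * b' - a' * b :=
    ⟨k₂ * b' - k₂' * b, by linear_combination b' * hk₂ - b * hk₂'⟩
  have g₃ : u ^ 2 + v ^ 2 ∣ a * b' - a' * b :=
    ⟨c * e' - c' * e, by rw [hc, he, hc', he']; ring⟩
  obtain ⟨s, t, hst⟩ := hab
  have g₄ : d₁ * d₂ ∣ 2 * (a * b' - a' * b) :=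
    mul_dvd_two_mul (s := k₁ * (s - t)) (t := k₂ * (s + t)) g₁ g₂ (by
      linear_combination 2 * hst - (s - t) * hk₁ - (s + t) * hk₂)
  obtain ⟨s, t, hst⟩ : IsCoprime (a ^ 2) (b ^ 2) := IsCoprime.pow ⟨s, t, hst⟩
  have g₅ := mul_dvd_two_mul (s := k₁ * k₂ * (s - t)) (t := (c ^ 2 + e ^ 2) * (s + t)) g₄
    (g₃.mul_left 2) (by
      have e₁ : a ^ 2 - b ^ 2 = d₁ * k₁ * (d₂ * k₂) := by rw [← hk₁, ← hk₂]; ring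
      have e₂ : a ^ 2 + b ^ 2 = (u ^ 2 + v ^ 2) * (c ^ 2 + e ^ 2) := by rw [hc, he]; ring
      linear_combination 2 * hst - (s - t) * e₁ - (s + t) * e₂)
  rwa [← mul_assoc] at g₅

/-- The conditions cutting out coprime pairs of size about `X` in the lattice attached to
`d₁ ∣ a - b`, `d₂ ∣ a + b` and `u + iv ∣ a + ib`. -/
structure IsLatticePair (X : ℝ) (d₁ d₂ u v : ℤ) (q : ℤ × ℤ) : Prop where
  pos : 0 < q.1 ∧ 0 < q.2
  coprime : IsCoprime q.1 q.2
  lt : X < 2 * max (q.1 : ℝ) q.2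
  le : max (q.1 : ℝ) q.2 ≤ X
  dvd_sub : d₁ ∣ q.1 - q.2
  dvd_add : d₂ ∣ q.1 + q.2
  gaussDvd : GaussDvd u v q.1 q.2

lemma card_latticePair_linear_le {X Y : ℝ} (hX : 0 < X) (hY : 0 ≤ Y) {d₁ d₂ u v : ℤ}
    (hd₁ : 0 < d₁) (hd₂ : 0 < d₂) (huv : 0 < u ^ 2 + v ^ 2) {l m : ℤ} (hlm : l ≠ m)
    (P : Finset (ℤ × ℤ)) (hP : ∀ q ∈ P, IsLatticePair X d₁ d₂ u v q)
    (hY' : ∀ q ∈ P, |(l * q.1 + m * q.2 : ℝ)| ≤ Y) :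
    (P.card : ℝ) ≤ 1 + 64 * (X * Y) / (d₁ * d₂ * (u ^ 2 + v ^ 2)) := by
  have hd₁' : (0 : ℝ) < d₁ := by exact_mod_cast hd₁
  have hd₂' : (0 : ℝ) < d₂ := by exact_mod_cast hd₂
  have huv' : (0 : ℝ) < u ^ 2 + v ^ 2 := by exact_mod_cast huv
  set D : ℝ := d₁ * d₂ * (u ^ 2 + v ^ 2) with hD
  have hD0 : 0 < D := by positivity
  have hn : ∀ q ∈ P, X / 2 < (q.1 + q.2 : ℝ) ∧ (q.1 + q.2 : ℝ) ≤ 2 * X := by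
    intro q hq
    have h := hP q hq
    have h1 : (0 : ℝ) < q.1 := by exact_mod_cast h.pos.1
    have h2 : (0 : ℝ) < q.2 := by exact_mod_cast h.pos.2
    have h3 : max (q.1 : ℝ) q.2 ≤ q.1 + q.2 := max_le (by linarith) (by linarith)
    have h4 := h.lt
    have h5 := max_le_iff.1 h.le
    constructor <;> linarith
  set t : ℤ × ℤ → ℝ := fun q => (l * q.1 + m * q.2) / (q.1 + q.2) with ht
  have htb : ∀ q ∈ P, |t q| ≤ 2 * Y / X := by
    intro q hq
    obtain ⟨h1, -⟩ := hn q hq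
    have h0 : (0 : ℝ) < q.1 + q.2 := by linarith
    simp only [ht]
    rw [abs_div, abs_of_pos h0, div_le_div_iff₀ h0 hX]
    have := hY' q hq
    nlinarith
  have h := card_le_of_floor_fibers P (fun q => t q + 2 * Y / X) (h := D / (16 * X ^ 2))
    (G := 4 * Y / X) (by positivity) (by positivity)
    (fun q hq => by
      have := (abs_le.1 (htb q hq)).2
      have e : 4 * Y / X = 2 * Y / X + 2 * Y / X := by ring
      linarith) 1 ?_
  · refine h.trans (le_of_eq ?_)
    field_simp
    ring
  · intro c
    rw [Finset.card_le_one]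
    intro q hq q' hq'
    rw [Finset.mem_filter] at hq hq'
    by_contra hne
    have h1 := abs_sub_lt_of_floor_div_eq (by positivity)
      (by linarith [(abs_le.1 (htb q hq.1)).1]) (by linarith [(abs_le.1 (htb q' hq'.1)).1])
      (hq.2.trans hq'.2.symm)
    rw [add_sub_add_right_eq_sub] at h1
    have Hq := hP q hq.1
    have Hq' := hP q' hq'.1
    have hn1 := hn q hq.1
    have hn2 := hn q' hq'.1
    have p1 : (0 : ℝ) < q.1 + q.2 := by linarith
    have p2 : (0 : ℝ) < q'.1 + q'.2 := by linarith
    have hΔ : q.1 * q'.2 - q'.1 * q.2 ≠ 0 := by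
      intro h0
      obtain ⟨e1, e2⟩ := eq_of_coprime_of_cross_eq Hq.pos.1 Hq'.pos.1 Hq.coprime
        Hq'.coprime (sub_eq_zero.1 h0)
      exact hne (Prod.ext e1 e2)
    have hdvd := dvd_four_mul_cross Hq.coprime Hq.dvd_sub Hq'.dvd_sub Hq.dvd_add Hq'.dvd_add
      Hq.gaussDvd Hq'.gaussDvd
    have hle := Int.le_of_dvd (abs_pos.2 (mul_ne_zero four_ne_zero hΔ)) ((dvd_abs _ _).2 hdvd)
    have hle' : D ≤ 4 * |(q.1 * q'.2 - q'.1 * q.2 : ℝ)| := by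
      rw [abs_mul, abs_of_pos (by norm_num : (0 : ℤ) < 4)] at hle
      rw [hD]; exact_mod_cast hle
    have hlm' : (1 : ℝ) ≤ |(l : ℝ) - m| := by
      exact_mod_cast Int.one_le_abs (sub_ne_zero.2 hlm)
    have e : t q - t q' = ((l : ℝ) - m) * (q.1 * q'.2 - q'.1 * q.2) /
        ((q.1 + q.2) * (q'.1 + q'.2)) := by
      simp only [ht]
      field_simp
      ring
    rw [e, abs_div, abs_mul, abs_of_pos (mul_pos p1 p2),
      div_lt_div_iff₀ (by positivity) (by positivity)] at h1
    have h2 : |(q.1 * q'.2 - q'.1 * q.2 : ℝ)| ≤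
        |(l : ℝ) - m| * |(q.1 * q'.2 - q'.1 * q.2 : ℝ)| :=
      le_mul_of_one_le_left (abs_nonneg _) hlm'
    have h3 : ((q.1 + q.2 : ℝ) * (q'.1 + q'.2)) ≤ (2 * X) * (2 * X) := by
      gcongr
      · exact hn1.2
      · exact hn2.2
    have h4 : D * ((q.1 + q.2 : ℝ) * (q'.1 + q'.2)) ≤ D * ((2 * X) * (2 * X)) := by gcongr
    have h5 : D / 4 * (16 * X ^ 2) ≤
        |(l : ℝ) - m| * |(q.1 * q'.2 - q'.1 * q.2 : ℝ)| * (16 * X ^ 2) := by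
      gcongr
      linarith
    linarith

lemma card_latticePair_le {X Y : ℝ} (hX : 0 < X) (hY : 0 ≤ Y) {d₁ d₂ u v : ℤ}
    (hd₁ : 0 < d₁) (hd₂ : 0 < d₂) (huv : 0 < u ^ 2 + v ^ 2)
    (P : Finset (ℤ × ℤ)) (hP : ∀ q ∈ P, IsLatticePair X d₁ d₂ u v q)
    (hY' : ∀ q ∈ P, ((min q.1 (min q.2 |q.1 - q.2|) : ℤ) : ℝ) ≤ Y) :
    (P.card : ℝ) ≤ 3 + 192 * (X * Y) / (d₁ * d₂ * (u ^ 2 + v ^ 2)) := by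
  set P₁ := P.filter fun q => (q.1 : ℝ) ≤ Y
  set P₂ := P.filter fun q => (q.2 : ℝ) ≤ Y
  set P₃ := P.filter fun q => |(q.1 : ℝ) - q.2| ≤ Y
  have hsub : P ⊆ P₁ ∪ P₂ ∪ P₃ := by
    intro q hq
    have h := hY' q hq
    push_cast at h
    rw [min_le_iff, min_le_iff] at h
    simp only [P₁, P₂, P₃, Finset.mem_union, Finset.mem_filter]
    tauto
  have hcard : P.card ≤ P₁.card + P₂.card + P₃.card :=
    (Finset.card_le_card hsub).trans ((Finset.card_union_le _ _).trans
      (Nat.add_le_add_right (Finset.card_union_le _ _) _))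
  have h₁ := card_latticePair_linear_le hX hY hd₁ hd₂ huv (l := 1) (m := 0) (by norm_num) P₁
    (fun q hq => hP q (Finset.mem_of_mem_filter q hq)) (fun q hq => by
      have h := Finset.mem_filter.1 hq
      have : (0 : ℝ) < q.1 := by exact_mod_cast (hP q h.1).pos.1
      simpa [abs_of_pos this] using h.2)
  have h₂ := card_latticePair_linear_le hX hY hd₁ hd₂ huv (l := 0) (m := 1) (by norm_num) P₂
    (fun q hq => hP q (Finset.mem_of_mem_filter q hq)) (fun q hq => by
      have h := Finset.mem_filter.1 hq
      have : (0 : ℝ) < q.2 := by exact_mod_cast (hP q h.1).pos.2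
      simpa [abs_of_pos this] using h.2)
  have h₃ := card_latticePair_linear_le hX hY hd₁ hd₂ huv (l := 1) (m := -1) (by norm_num) P₃
    (fun q hq => hP q (Finset.mem_of_mem_filter q hq)) (fun q hq => by
      simpa [← sub_eq_add_neg] using (Finset.mem_filter.1 hq).2)
  have hcard' : (P.card : ℝ) ≤ P₁.card + P₂.card + P₃.card := by exact_mod_cast hcard
  have e : 192 * (X * Y) / ((d₁ : ℝ) * d₂ * (u ^ 2 + v ^ 2)) =
    3 * (64 * (X * Y) / (d₁ * d₂ * (u ^ 2 + v ^ 2))) := by ring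
  linarith

lemma sum_gaussBox_le (N : ℕ) {c : ℝ} (hc : 0 ≤ c) :
    ∑ w ∈ gaussBox N, (3 + c / ((w.1 : ℝ) ^ 2 + w.2 ^ 2)) ≤
      24 * N ^ 2 + 8 * c * (harmonic N : ℝ) := by
  have hdisj : Set.PairwiseDisjoint (↑(Finset.Icc 1 N) : Set ℕ)
      (fun k => (Finset.box k : Finset (ℤ × ℤ))) := by
    intro i _ j _ hij
    rw [Function.onFun, Finset.disjoint_left]
    intro w hi hj
    rw [Int.mem_box] at hi hj
    exact hij (hi.symm.trans hj)
  have hk : ∀ k ∈ Finset.Icc 1 N, ∑ w ∈ (Finset.box k : Finset (ℤ × ℤ)),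
      (3 + c / ((w.1 : ℝ) ^ 2 + w.2 ^ 2)) ≤ 24 * N + 8 * c * (k : ℝ)⁻¹ := by
    intro k hk
    obtain ⟨hk1, hkN⟩ := Finset.mem_Icc.1 hk
    have hk0 : (0 : ℝ) < k := by exact_mod_cast hk1
    have hkN' : (k : ℝ) ≤ N := by exact_mod_cast hkN
    calc _ ≤ ∑ w ∈ (Finset.box k : Finset (ℤ × ℤ)), (3 + c / (k : ℝ) ^ 2) := by
          apply Finset.sum_le_sum
          intro w hw
          rw [Int.mem_box] at hw
          have : (k : ℝ) ^ 2 ≤ (w.1 : ℝ) ^ 2 + w.2 ^ 2 := by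
            rw [← hw]
            rcases max_choice w.1.natAbs w.2.natAbs with h | h <;>
              rw [h, Nat.cast_natAbs, Int.cast_abs, sq_abs] <;> nlinarith
          gcongr
      _ = 24 * k + 8 * c * (k : ℝ)⁻¹ := by
          rw [Finset.sum_const, Int.card_box (by omega)]
          simp only [nsmul_eq_mul]
          push_cast
          field_simp
          ring
      _ ≤ _ := by gcongr
  rw [gaussBox, Finset.sum_biUnion hdisj]
  refine (Finset.sum_le_sum hk).trans (le_of_eq ?_)
  have hH : (harmonic N : ℝ) = ∑ k ∈ Finset.Icc 1 N, (k : ℝ)⁻¹ := by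
    rw [harmonic_eq_sum_Icc]; push_cast; rfl
  rw [Finset.sum_add_distrib, ← Finset.mul_sum, ← Finset.mul_sum, Finset.sum_const, ← hH,
    Nat.card_Icc, nsmul_eq_mul, Nat.add_sub_cancel]
  ring

lemma sum_divisors_le {X : ℕ} (hX : 1 ≤ X) {Y : ℝ} (hY : 0 ≤ Y) (P : Finset (ℤ × ℤ))
    (hpos : ∀ q ∈ P, 0 < q.1 ∧ 0 < q.2) (hcop : ∀ q ∈ P, IsCoprime q.1 q.2)
    (hlt : ∀ q ∈ P, (X : ℤ) < 2 * max q.1 q.2) (hle : ∀ q ∈ P, max q.1 q.2 ≤ X)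
    (hY' : ∀ q ∈ P, ((min q.1 (min q.2 |q.1 - q.2|) : ℤ) : ℝ) ≤ Y) :
    ∑ q ∈ P, (((q.1 - q.2).natAbs.divisors.card : ℝ) * (q.1 + q.2).natAbs.divisors.card *
        (q.1 ^ 2 + q.2 ^ 2).natAbs.divisors.card) ≤
      768 * (X : ℝ) ^ 2 + 12288 * (X * Y) * (1 + Real.log (Nat.sqrt (2 * X))) ^ 3 := by
  set N := Nat.sqrt (2 * X) with hN
  have hX0 : (0 : ℝ) < X := by exact_mod_cast hX
  have hlt' : 2 * X < (N + 1) ^ 2 := Nat.lt_succ_sqrt' _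
  have hN2 : (N : ℝ) ^ 2 ≤ 2 * X := by exact_mod_cast Nat.sqrt_le' (2 * X)
  set I := Finset.Icc 1 N ×ˢ (Finset.Icc 1 N ×ˢ gaussBox N) with hI
  set Rel : ℤ × ℤ → ℕ × ℕ × ℤ × ℤ → Prop := fun q i =>
    i.1 ∣ (q.1 - q.2).natAbs ∧ i.2.1 ∣ (q.1 + q.2).natAbs ∧ GaussDvd i.2.2.1 i.2.2.2 q.1 q.2
    with hRel
  have hterm : ∀ q ∈ P, (q.1 - q.2).natAbs.divisors.card * (q.1 + q.2).natAbs.divisors.card *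
      (q.1 ^ 2 + q.2 ^ 2).natAbs.divisors.card ≤ 8 * (I.filter (Rel q)).card := by
    intro q hq
    obtain ⟨h1, h2⟩ := hpos q hq
    obtain ⟨h3, h4⟩ := max_le_iff.1 (hle q hq)
    have c1 := card_divisors_le_two_mul (n := (q.1 - q.2).natAbs) (N := N) (by omega)
    have c2 := card_divisors_le_two_mul (n := (q.1 + q.2).natAbs) (N := N) (by omega)
    have c3 := card_divisors_sq_add_sq_le (hcop q hq) (X := X) (by nlinarith)
    have e : I.filter (Rel q) = (Finset.Icc 1 N).filter (· ∣ (q.1 - q.2).natAbs) ×ˢ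
        ((Finset.Icc 1 N).filter (· ∣ (q.1 + q.2).natAbs) ×ˢ
        (gaussBox N).filter fun w => GaussDvd w.1 w.2 q.1 q.2) := by
      ext i
      simp only [hI, hRel, Finset.mem_filter, Finset.mem_product]
      tauto
    rw [e, Finset.card_product, Finset.card_product]
    calc _ ≤ _ := Nat.mul_le_mul (Nat.mul_le_mul c1 c2) c3
      _ = _ := by ring
  have hsum : ∑ q ∈ P, (((q.1 - q.2).natAbs.divisors.card : ℝ) *
      (q.1 + q.2).natAbs.divisors.card * (q.1 ^ 2 + q.2 ^ 2).natAbs.divisors.card) ≤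
      8 * ∑ i ∈ I, ((P.filter fun q => Rel q i).card : ℝ) := by
    have h1 := Finset.sum_card_bipartiteAbove_eq_sum_card_bipartiteBelow (s := P) (t := I) Rel
    simp only [Finset.bipartiteAbove, Finset.bipartiteBelow] at h1
    have h2 := Finset.sum_le_sum hterm
    rw [← Finset.mul_sum, h1] at h2
    exact_mod_cast h2
  have hfib : ∀ i ∈ I, ((P.filter fun q => Rel q i).card : ℝ) ≤
      3 + 192 * (X * Y) / (i.1 * i.2.1) / ((i.2.2.1 : ℝ) ^ 2 + i.2.2.2 ^ 2) := by
    rintro ⟨d₁, d₂, u, v⟩ hi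
    simp only [hI, Finset.mem_product, Finset.mem_Icc, gaussBox, Finset.mem_biUnion,
      Int.mem_box] at hi
    obtain ⟨h1, h2, k, hk, hkw⟩ := hi
    have huv : 0 < u ^ 2 + v ^ 2 := by
      by_contra! h
      have hu : u = 0 := by nlinarith
      have hv : v = 0 := by nlinarith
      subst hu hv
      simp at hkw
      omega
    have := card_latticePair_le (X := X) (d₁ := d₁) (d₂ := d₂) hX0 hY (by omega) (by omega) huv
      (P.filter fun q => Rel q (d₁, d₂, u, v)) (fun q hq => by
        obtain ⟨hq, r1, r2, r3⟩ := Finset.mem_filter.1 hq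
        exact ⟨hpos q hq, hcop q hq, by exact_mod_cast hlt q hq, by exact_mod_cast hle q hq,
          Int.natCast_dvd.2 r1, Int.natCast_dvd.2 r2, r3⟩)
      (fun q hq => hY' q (Finset.mem_of_mem_filter q hq))
    rw [div_div]
    exact_mod_cast this
  have hH : (harmonic N : ℝ) ≤ 1 + Real.log N := by exact_mod_cast harmonic_le_one_add_log N
  have hH0 : (0 : ℝ) ≤ harmonic N := by
    rw [harmonic_eq_sum_Icc]; push_cast; positivity
  have hHs : ∑ d ∈ Finset.Icc 1 N, (d : ℝ)⁻¹ = harmonic N := by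
    rw [harmonic_eq_sum_Icc]; push_cast; rfl
  have hI' : ∑ i ∈ I, ((P.filter fun q => Rel q i).card : ℝ) ≤
      24 * (N : ℝ) ^ 4 + 1536 * (X * Y) * (harmonic N : ℝ) ^ 3 := by
    refine (Finset.sum_le_sum hfib).trans ?_
    rw [hI, Finset.sum_product]
    simp only [Finset.sum_product]
    calc _ ≤ ∑ d₁ ∈ Finset.Icc 1 N, ∑ d₂ ∈ Finset.Icc 1 N,
          (24 * (N : ℝ) ^ 2 + 8 * (192 * (X * Y) / (d₁ * d₂)) * (harmonic N : ℝ)) :=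
          Finset.sum_le_sum fun d₁ _ => Finset.sum_le_sum fun d₂ _ =>
            sum_gaussBox_le N (by positivity)
      _ = ∑ d₁ ∈ Finset.Icc 1 N, ∑ d₂ ∈ Finset.Icc 1 N,
          (24 * (N : ℝ) ^ 2 + 1536 * (X * Y) * (harmonic N : ℝ) * ((d₁ : ℝ)⁻¹ * (d₂ : ℝ)⁻¹)) := by
          refine Finset.sum_congr rfl fun d₁ _ => Finset.sum_congr rfl fun d₂ _ => ?_
          rw [div_eq_mul_inv, mul_inv]; ring
      _ = _ := by
          simp only [Finset.sum_add_distrib, ← Finset.mul_sum, ← Finset.sum_mul, hHs,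
            Finset.sum_const, Nat.card_Icc, nsmul_eq_mul]
          push_cast
          ring
  have hN4 : (N : ℝ) ^ 4 ≤ 4 * (X : ℝ) ^ 2 := by
    calc (N : ℝ) ^ 4 = ((N : ℝ) ^ 2) ^ 2 := by ring
      _ ≤ (2 * (X : ℝ)) ^ 2 := by gcongr
      _ = _ := by ring
  have hH3 : (X * Y) * (harmonic N : ℝ) ^ 3 ≤ (X * Y) * (1 + Real.log N) ^ 3 := by gcongr
  linarith

lemma exists_dyadic_ratio {m M N : ℕ} (hm : 1 ≤ m) (hmM : m ≤ M) (hMN : M ≤ N) :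
    ∃ n, 1 ≤ n ∧ M ≤ 2 ^ n * m ∧
      n ≤ ((Finset.range (Nat.log 2 N + 2)).filter fun k => 2 ^ k * m ≤ M).card := by
  refine ⟨Nat.log 2 (M / m) + 1, by omega, ?_, ?_⟩
  · have h := Nat.lt_pow_succ_log_self (b := 2) (by norm_num) (M / m)
    exact ((Nat.div_lt_iff_lt_mul hm).1 h).le
  · have hq : M / m ≠ 0 := (Nat.div_pos hmM hm).ne'
    have hlog : Nat.log 2 (M / m) ≤ Nat.log 2 N :=
      Nat.log_mono_right ((Nat.div_le_self _ _).trans hMN)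
    rw [← Finset.card_range (Nat.log 2 (M / m) + 1)]
    apply Finset.card_le_card
    intro k hk
    rw [Finset.mem_range] at hk
    refine Finset.mem_filter.2 ⟨Finset.mem_range.2 (by omega), ?_⟩
    calc 2 ^ k * m ≤ 2 ^ Nat.log 2 (M / m) * m := by gcongr <;> omega
      _ ≤ M / m * m := Nat.mul_le_mul_right _ (Nat.pow_log_le_self 2 hq)
      _ ≤ M := Nat.div_mul_le_self _ _

lemma exists_dyadic_size {M N : ℕ} (hM : 1 ≤ M) (hMN : M ≤ N) :
    ∃ j ∈ Finset.range (Nat.log 2 N + 2), 2 ^ j < 2 * M ∧ M ≤ 2 ^ j := by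
  refine ⟨Nat.clog 2 M, Finset.mem_range.2 ?_, ?_, Nat.le_pow_clog (by norm_num) _⟩
  · have h1 : Nat.clog 2 M ≤ Nat.clog 2 N := Nat.clog_mono_right _ hMN
    have h2 : Nat.clog 2 N ≤ Nat.log 2 N + 1 :=
      Nat.clog_le_of_le_pow (Nat.lt_pow_succ_log_self (by norm_num) N).le
    omega
  · rcases hM.eq_or_lt with rfl | h
    · simp
    · have h1 := Nat.pow_pred_clog_lt_self (b := 2) (by norm_num) h
      have h2 : 0 < Nat.clog 2 M := Nat.clog_pos (by norm_num) h
      obtain ⟨c, hc⟩ := Nat.exists_eq_succ_of_ne_zero h2.ne'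
      rw [hc] at h1 ⊢
      rw [Nat.pred_succ] at h1
      rw [pow_succ]
      omega

/-- The product of the three divisor counts controlling `Mcount`. -/
noncomputable def divisorWeight (q : ℤ × ℤ) : ℝ :=
  (q.1 - q.2).natAbs.divisors.card * (q.1 + q.2).natAbs.divisors.card *
    (q.1 ^ 2 + q.2 ^ 2).natAbs.divisors.card

lemma divisorWeight_nonneg (q : ℤ × ℤ) : 0 ≤ divisorWeight q := by
  unfold divisorWeight; positivity

/-- The pair `q` has size about `2 ^ j` and is unbalanced by a factor at least `2 ^ k`. -/
def IsDyadic (j k : ℕ) (q : ℤ × ℤ) : Prop :=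
  (2 : ℤ) ^ j < 2 * max q.1 q.2 ∧ max q.1 q.2 ≤ 2 ^ j ∧
    2 ^ k * min q.1 (min q.2 |q.1 - q.2|) ≤ max q.1 q.2

lemma Mcount_le_dyadic_sum {q : ℤ × ℤ} {B : ℝ} {N : ℕ} (h₁ : 0 < q.1) (h₂ : 0 < q.2)
    (hne : q.1 ≠ q.2) (hq : IsCoprime q.1 q.2) (hN : max q.1 q.2 ≤ N) (hNB : (N : ℝ) ^ 2 ≤ B) :
    (Mcount q.1 q.2 B : ℝ) ≤ ∑ j ∈ Finset.range (Nat.log 2 N + 2),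
      ∑ k ∈ Finset.range (Nat.log 2 N + 2),
        1184 * B / 4 ^ j * (if IsDyadic j k q then divisorWeight q else 0) := by
  obtain ⟨a, b⟩ := q
  simp only at h₁ h₂ hne hq hN ⊢
  have hW := divisorWeight_nonneg (a, b)
  have hB : 0 ≤ B := (by positivity : (0 : ℝ) ≤ (N : ℝ) ^ 2).trans hNB
  obtain ⟨M, hM⟩ := Int.eq_ofNat_of_zero_le (h₁.le.trans (le_max_left a b))
  have hab : 0 < |a - b| := abs_pos.2 (sub_ne_zero.2 hne)
  have hm0 : 0 < min a (min b |a - b|) := lt_min h₁ (lt_min h₂ hab)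
  obtain ⟨m, hm⟩ := Int.eq_ofNat_of_zero_le hm0.le
  have hm1 : 1 ≤ m := by omega
  have hmM : m ≤ M := by
    have h1 : min a (min b |a - b|) ≤ a := min_le_left _ _
    have h2 : a ≤ max a b := le_max_left _ _
    omega
  have hMN : M ≤ N := by omega
  obtain ⟨n, hn1, hn, hcard⟩ := exists_dyadic_ratio hm1 hmM hMN
  obtain ⟨j, hj, hj1, hj2⟩ := exists_dyadic_size (hm1.trans hmM) hMN
  have hM0 : (0 : ℝ) < M := by exact_mod_cast (hm1.trans hmM)
  have hMreal : (M : ℝ) = max (a : ℝ) b := by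
    have : ((max a b : ℤ) : ℝ) = ((M : ℤ) : ℝ) := by rw [hM]
    push_cast at this
    exact this.symm
  have hmreal : (m : ℝ) = min (a : ℝ) (min b |(a : ℝ) - b|) := by
    have : ((min a (min b |a - b|) : ℤ) : ℝ) = ((m : ℤ) : ℝ) := by rw [hm]
    push_cast at this
    exact this.symm
  have hn' : (M : ℝ) ≤ 2 ^ n * m := by exact_mod_cast hn
  have hMB : (M : ℝ) ^ 2 ≤ B := by
    refine le_trans ?_ hNB
    gcongr
  have key := Mcount_le h₁ h₂ hne hq hMreal hMB hn1
    (hn'.trans (by rw [hmreal]; gcongr; exact min_le_left _ _))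
    (hn'.trans (by
      rw [hmreal]; gcongr; exact (min_le_right _ _).trans (min_le_right _ _)))
  have hinner : ∑ k ∈ Finset.range (Nat.log 2 N + 2),
      1184 * B / 4 ^ j * (if IsDyadic j k (a, b) then divisorWeight (a, b) else 0) =
      1184 * B / 4 ^ j * (((Finset.range (Nat.log 2 N + 2)).filter
        fun k => 2 ^ k * m ≤ M).card * divisorWeight (a, b)) := by
    rw [← Finset.mul_sum, ← Finset.sum_filter, Finset.sum_const, nsmul_eq_mul]
    congr 4
    ext k
    simp only [Finset.mem_filter, IsDyadic, hM, hm]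
    have e1 : (2 : ℤ) ^ j < 2 * (M : ℤ) := by exact_mod_cast hj1
    have e2 : (M : ℤ) ≤ 2 ^ j := by exact_mod_cast hj2
    have e3 : (2 : ℤ) ^ k * (m : ℤ) ≤ M ↔ 2 ^ k * m ≤ M := by exact_mod_cast Iff.rfl
    simp only [e1, e2, e3, true_and]
  have hsq : B / (M : ℝ) ^ 2 ≤ 4 * B / 4 ^ j := by
    have h4 : (4 : ℝ) ^ j = (2 ^ j) ^ 2 := by rw [← pow_mul, mul_comm, pow_mul]; norm_num
    have h5 : (2 : ℝ) ^ j ≤ 2 * M := by exact_mod_cast hj1.le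
    rw [div_le_div_iff₀ (by positivity) (by positivity), h4]
    calc B * (2 ^ j) ^ 2 ≤ B * (2 * M) ^ 2 := by gcongr
      _ = _ := by ring
  have hcard' : (n : ℝ) ≤ ((Finset.range (Nat.log 2 N + 2)).filter
        fun k => 2 ^ k * m ≤ M).card := by exact_mod_cast hcard
  calc (Mcount a b B : ℝ) ≤ 296 * n * (B / (M : ℝ) ^ 2) * divisorWeight (a, b) := key
    _ ≤ 296 * ((Finset.range (Nat.log 2 N + 2)).filter fun k => 2 ^ k * m ≤ M).card *
        (4 * B / 4 ^ j) * divisorWeight (a, b) := by gcongr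
    _ = _ := by rw [hinner]; ring
    _ ≤ _ := Finset.single_le_sum (f := fun j => ∑ k ∈ Finset.range (Nat.log 2 N + 2),
        1184 * B / 4 ^ j * (if IsDyadic j k (a, b) then divisorWeight (a, b) else 0))
        (fun i _ => Finset.sum_nonneg fun k _ => by
          split_ifs <;> positivity) hj

lemma le_of_pow_three_le {m X T t r : ℝ} {k : ℕ} (hm : 0 ≤ m) (hX : 0 ≤ X) (hT : 0 < T)
    (ht : 0 ≤ t) (hr : 0 ≤ r) (htT : t ^ 3 * T ^ 2 = 1) (hr2 : r ^ 3 * 2 = 1)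
    (h₁ : T * m ≤ X) (h₂ : 2 ^ k * m ≤ X) : m ≤ X * (t * r ^ k) := by
  refine le_of_pow_le_pow_left₀ three_ne_zero (by positivity) ?_
  have hk : (r ^ k) ^ 3 * 2 ^ k = 1 := by
    rw [← pow_mul, mul_comm k 3, pow_mul, ← mul_pow, hr2, one_pow]
  calc m ^ 3 = t ^ 3 * (r ^ k) ^ 3 * ((T * m) * (T * m) * (2 ^ k * m)) := by
        linear_combination (-m ^ 3) * htT - m ^ 3 * t ^ 3 * T ^ 2 * hk
    _ ≤ t ^ 3 * (r ^ k) ^ 3 * (X * X * X) := by gcongr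
    _ = _ := by ring

lemma geom_sum_le_five {r : ℝ} (hr : 0 ≤ r) (hr2 : r ^ 3 * 2 = 1) (K : ℕ) :
    ∑ k ∈ Finset.range K, r ^ k ≤ 5 := by
  have h45 : r ≤ 4 / 5 := by
    refine le_of_pow_le_pow_left₀ three_ne_zero (by norm_num) ?_
    linarith
  have h := mul_neg_geom_sum r K
  have h0 : 0 ≤ ∑ k ∈ Finset.range K, r ^ k := by positivity
  have h1 : 0 ≤ r ^ K := by positivity
  nlinarith

theorem sum_Mcount_unbalanced_bound :
    ∃ C : ℝ, 0 < C ∧ ∀ B : ℝ, 3 ≤ B → ∀ T : ℝ, 0 < T →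
      ∑ q ∈ (Finset.Icc (1 : ℤ) ⌊Real.sqrt B⌋ ×ˢ
          Finset.Icc (1 : ℤ) ⌊Real.sqrt B⌋).filter
          (fun q => Int.gcd q.1 q.2 = 1 ∧ q.1 * q.2 ≠ 1 ∧
            ((max q.1 q.2 : ℤ) : ℝ) ≤ Real.sqrt B ∧
            T * ((min q.1 (min q.2 |q.1 - q.2|) : ℤ) : ℝ) < ((max q.1 q.2 : ℤ) : ℝ)),
        (Mcount q.1 q.2 B : ℝ) ≤
        C * (B * Real.log B ^ 4 * T ^ (-(2 : ℝ) / 3) + B * Real.log B ^ 3) := by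
  refine ⟨1184 * 12288 * 27 * 15, by norm_num, fun B hB T hT => ?_⟩
  have hB0 : 0 < B := by linarith
  set S := (Finset.Icc (1 : ℤ) ⌊Real.sqrt B⌋ ×ˢ Finset.Icc (1 : ℤ) ⌊Real.sqrt B⌋).filter
    (fun q => Int.gcd q.1 q.2 = 1 ∧ q.1 * q.2 ≠ 1 ∧ ((max q.1 q.2 : ℤ) : ℝ) ≤ Real.sqrt B ∧
      T * ((min q.1 (min q.2 |q.1 - q.2|) : ℤ) : ℝ) < ((max q.1 q.2 : ℤ) : ℝ)) with hS
  set L := Real.log B with hL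
  have hL1 : 1 ≤ L := by
    rw [hL, Real.le_log_iff_exp_le hB0]
    linarith [Real.exp_one_lt_d9]
  set N := ⌊Real.sqrt B⌋₊ with hN
  have hsB : 0 ≤ Real.sqrt B := Real.sqrt_nonneg B
  have hsB1 : 1 ≤ Real.sqrt B := Real.one_le_sqrt.2 (by linarith)
  have hNs : (N : ℝ) ≤ Real.sqrt B := Nat.floor_le hsB
  have hN0 : N ≠ 0 := (Nat.floor_pos.2 hsB1).ne'
  have hNB : (N : ℝ) ^ 2 ≤ B := by
    calc (N : ℝ) ^ 2 ≤ Real.sqrt B ^ 2 := by gcongr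
      _ = B := Real.sq_sqrt hB0.le
  set K := Nat.log 2 N + 2 with hK
  have hpow : (2 : ℝ) ^ Nat.log 2 N ≤ Real.sqrt B := by
    refine le_trans ?_ hNs
    exact_mod_cast Nat.pow_log_le_self 2 hN0
  have hlog2 := Real.log_two_gt_d9
  have hlog2' := Real.log_two_lt_d9
  have hKL : (K : ℝ) ≤ 3 * L := by
    have h := Real.log_le_log (by positivity) hpow
    rw [Real.log_pow, Real.log_sqrt hB0.le, ← hL] at h
    rw [hK]
    push_cast
    have : (0 : ℝ) ≤ (Nat.log 2 N : ℝ) := by positivity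
    nlinarith
  set t := T ^ (-(2 : ℝ) / 3) with ht
  have ht0 : 0 < t := Real.rpow_pos_of_pos hT _
  have htT : t ^ 3 * T ^ 2 = 1 := by
    rw [ht, ← Real.rpow_natCast, ← Real.rpow_natCast, ← Real.rpow_mul hT.le,
      ← Real.rpow_add hT]
    norm_num
  set r := (2 : ℝ) ^ (-(1 : ℝ) / 3) with hr
  have hr0 : 0 < r := by positivity
  have hr2 : r ^ 3 * 2 = 1 := by
    rw [hr, ← Real.rpow_natCast, ← Real.rpow_mul zero_le_two]
    norm_num
  have hmem : ∀ q ∈ S, 0 < q.1 ∧ 0 < q.2 ∧ q.1 ≠ q.2 ∧ IsCoprime q.1 q.2 ∧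
      max q.1 q.2 ≤ N ∧
      T * ((min q.1 (min q.2 |q.1 - q.2|) : ℤ) : ℝ) ≤ ((max q.1 q.2 : ℤ) : ℝ) := by
    rintro ⟨a, b⟩ hq
    simp only [hS, Finset.mem_filter, Finset.mem_product, Finset.mem_Icc] at hq
    obtain ⟨⟨⟨ha, ha'⟩, hb, hb'⟩, hg, hne, hmax, hT'⟩ := hq
    have hcop : IsCoprime a b := Int.isCoprime_iff_gcd_eq_one.2 hg
    refine ⟨by simp only; omega, by simp only; omega, ?_, hcop, ?_, hT'.le⟩
    · intro h
      simp only at h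
      subst h
      rw [Int.gcd_self] at hg
      apply hne
      have : a = 1 := by omega
      rw [this, one_mul]
    · rw [hN, Int.natCast_floor_eq_floor hsB]
      exact max_le ha' hb'
  have hcell : ∀ j ∈ Finset.range K, ∀ k ∈ Finset.range K,
      1184 * B / 4 ^ j * ∑ q ∈ S.filter (IsDyadic j k), divisorWeight q ≤
      1184 * B * (768 + 12288 * 27 * L ^ 3 * t * r ^ k) := by
    intro j hj k _
    set X : ℕ := 2 ^ j with hX
    have hXr : (X : ℝ) = 2 ^ j := by rw [hX]; push_cast; rfl
    have hX1 : 1 ≤ X := Nat.one_le_two_pow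
    have hX0 : (0 : ℝ) < X := by exact_mod_cast hX1
    have hX4 : (4 : ℝ) ^ j = (X : ℝ) ^ 2 := by
      rw [hXr, ← pow_mul, mul_comm, pow_mul]; norm_num
    have h := sum_divisors_le hX1 (Y := X * (t * r ^ k)) (by positivity)
      (S.filter (IsDyadic j k))
      (fun q hq => by
        have := hmem q (Finset.mem_of_mem_filter q hq); exact ⟨this.1, this.2.1⟩)
      (fun q hq => (hmem q (Finset.mem_of_mem_filter q hq)).2.2.2.1)
      (fun q hq => by
        have := (Finset.mem_filter.1 hq).2.1; rw [hX]; exact_mod_cast this)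
      (fun q hq => by
        have := (Finset.mem_filter.1 hq).2.2.1; rw [hX]; exact_mod_cast this)
      (fun q hq => by
        obtain ⟨hq, -, hd1, hd2⟩ := Finset.mem_filter.1 hq
        obtain ⟨h1, h2, hne, -, -, h3⟩ := hmem q hq
        have hMX : ((max q.1 q.2 : ℤ) : ℝ) ≤ X := by rw [hXr]; exact_mod_cast hd1
        have hm0 : 0 < min q.1 (min q.2 |q.1 - q.2|) :=
          lt_min h1 (lt_min h2 (abs_pos.2 (sub_ne_zero.2 hne)))
        refine le_of_pow_three_le (by exact_mod_cast hm0.le) hX0.le hT ht0.le hr0.le htT hr2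
          (h3.trans hMX) (le_trans ?_ hMX)
        exact_mod_cast hd2)
    have hΛ : 1 + Real.log (Nat.sqrt (2 * X)) ≤ 3 * L := by
      have hj' : j ≤ Nat.log 2 N + 1 := by rw [Finset.mem_range] at hj; omega
      have h1 : ((Nat.sqrt (2 * X) : ℕ) : ℝ) ≤ 4 * Real.sqrt B := by
        calc ((Nat.sqrt (2 * X) : ℕ) : ℝ) ≤ ((2 * X : ℕ) : ℝ) := by
              exact_mod_cast Nat.sqrt_le_self _
          _ = 2 * 2 ^ j := by push_cast; rw [hXr]
          _ ≤ 2 * 2 ^ (Nat.log 2 N + 1) := by gcongr; norm_num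
          _ = 4 * 2 ^ Nat.log 2 N := by ring
          _ ≤ _ := by gcongr
      have h2 : 0 < Nat.sqrt (2 * X) := Nat.sqrt_pos.2 (by omega)
      have h3 := Real.log_le_log (by exact_mod_cast h2) h1
      rw [Real.log_mul (by norm_num) (by positivity), Real.log_sqrt hB0.le, ← hL,
        show (4 : ℝ) = 2 ^ 2 by norm_num, Real.log_pow] at h3
      push_cast at h3
      linarith
    have hΛ0 : 0 ≤ 1 + Real.log (Nat.sqrt (2 * X)) := by
      have := Real.log_natCast_nonneg (Nat.sqrt (2 * X))
      linarith
    calc 1184 * B / 4 ^ j * ∑ q ∈ S.filter (IsDyadic j k), divisorWeight q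
        ≤ 1184 * B / 4 ^ j * (768 * (X : ℝ) ^ 2 + 12288 * (X * (X * (t * r ^ k))) *
          (1 + Real.log (Nat.sqrt (2 * X))) ^ 3) := by
          gcongr; exact h
      _ ≤ 1184 * B / 4 ^ j * (768 * (X : ℝ) ^ 2 + 12288 * (X * (X * (t * r ^ k))) *
          (3 * L) ^ 3) := by gcongr
      _ = _ := by rw [hX4]; field_simp; ring
  calc ∑ q ∈ S, (Mcount q.1 q.2 B : ℝ)
      ≤ ∑ q ∈ S, ∑ j ∈ Finset.range K, ∑ k ∈ Finset.range K,
        1184 * B / 4 ^ j * (if IsDyadic j k q then divisorWeight q else 0) :=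
        Finset.sum_le_sum fun q hq => by
          obtain ⟨h1, h2, hne, hcop, hle, -⟩ := hmem q hq
          exact Mcount_le_dyadic_sum h1 h2 hne hcop hle hNB
    _ = ∑ j ∈ Finset.range K, ∑ k ∈ Finset.range K,
        1184 * B / 4 ^ j * ∑ q ∈ S.filter (IsDyadic j k), divisorWeight q := by
        rw [Finset.sum_comm]
        refine Finset.sum_congr rfl fun j _ => ?_
        rw [Finset.sum_comm]
        refine Finset.sum_congr rfl fun k _ => ?_
        rw [← Finset.mul_sum, Finset.sum_filter (IsDyadic j k)]
    _ ≤ ∑ j ∈ Finset.range K, ∑ k ∈ Finset.range K,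
        1184 * B * (768 + 12288 * 27 * L ^ 3 * t * r ^ k) :=
        Finset.sum_le_sum fun j hj => Finset.sum_le_sum fun k hk => hcell j hj k hk
    _ = 1184 * B * (768 * ((K : ℝ) * K) +
        12288 * 27 * L ^ 3 * t * (K * ∑ k ∈ Finset.range K, r ^ k)) := by
        simp only [← Finset.mul_sum, Finset.sum_add_distrib, Finset.sum_const,
          Finset.card_range, nsmul_eq_mul]
        ring
    _ ≤ 1184 * B * (768 * ((3 * L) * (3 * L)) + 12288 * 27 * L ^ 3 * t * ((3 * L) * 5)) := by
        gcongr
        exact geom_sum_le_five hr0.le hr2 K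
    _ = 1184 * 768 * 9 * (B * L ^ 2) + 1184 * 12288 * 27 * 15 * (B * L ^ 4 * t) := by ring
    _ ≤ 1184 * 12288 * 27 * 15 * (B * L ^ 3) +
        1184 * 12288 * 27 * 15 * (B * L ^ 4 * t) := by
        have h23 : L ^ 2 ≤ L ^ 3 := pow_le_pow_right₀ hL1 (by norm_num)
        have hL3 : 0 ≤ B * L ^ 3 := by positivity
        have := mul_le_mul_of_nonneg_left h23 hB0.le
        linarith
    _ = _ := by ring
end

section
/- There exists a constant C > 0 such that for every real x ≥ 2 and every real y > 0 one has ∑_{(a,b)} τ(b⁴ − a⁴)/(b^{5/3}·(b − a)^{1/3}) ≤ C·(log x)³·log(y + 2), where the sum is over pairs (a,b) of positive integers with a < b ≤ x and b > x/y. -/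
open scoped Classical

/-- The divisor function `τ(n)`. -/
def tauFn (n : ℕ) : ℕ := n.divisors.card

/-- A weak form of Mertens' first theorem. -/
theorem sum_primesBelow_log_div_le (N : ℕ) :
    ∑ p ∈ N.primesBelow, Real.log p / p ≤ 2 * Real.log N := by
  rcases Nat.eq_zero_or_pos N with rfl | hN
  · simp
  have hdvd : ∏ p ∈ N.primesBelow, p ^ (N / p) ∣ N.factorial := by
    apply Finset.prod_dvd_of_isRelPrime
    · intro p hp q hq hpq
      have hp' := Nat.prime_of_mem_primesBelow hp
      have hq' := Nat.prime_of_mem_primesBelow hq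
      exact (Nat.coprime_iff_isRelPrime).1
        (Nat.Coprime.pow _ _ ((Nat.coprime_primes hp' hq').2 hpq))
    · intro p hp
      have hp' := Nat.prime_of_mem_primesBelow hp
      rw [hp'.pow_dvd_factorial_iff (b := Nat.log p N + 2) (by omega)]
      have := Finset.single_le_sum (f := fun i => N / p ^ i) (s := Finset.Ico 1 (Nat.log p N + 2))
        (fun i _ => Nat.zero_le _) (a := 1) (by simp)
      simpa using this
  have hle : ∏ p ∈ N.primesBelow, p ^ (N / p) ≤ N ^ N :=
    (Nat.le_of_dvd N.factorial_pos hdvd).trans N.factorial_le_pow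
  have hlog : ∑ p ∈ N.primesBelow, ((N / p : ℕ) : ℝ) * Real.log p ≤ N * Real.log N := by
    have h1 : Real.log ((∏ p ∈ N.primesBelow, p ^ (N / p) : ℕ) : ℝ) ≤ Real.log ((N ^ N : ℕ) : ℝ) := by
      apply Real.log_le_log
      · exact_mod_cast Finset.prod_pos fun p hp =>
          pow_pos (Nat.prime_of_mem_primesBelow hp).pos _
      · exact_mod_cast hle
    push_cast at h1
    rw [Real.log_prod (fun p hp => by
      have := (Nat.prime_of_mem_primesBelow hp).pos
      positivity), Real.log_pow] at h1
    simpa [Real.log_pow] using h1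
  have hN' : (0 : ℝ) < N := by exact_mod_cast hN
  have key : N * ∑ p ∈ N.primesBelow, Real.log p / p
      ≤ 2 * ∑ p ∈ N.primesBelow, ((N / p : ℕ) : ℝ) * Real.log p := by
    rw [Finset.mul_sum, Finset.mul_sum]
    apply Finset.sum_le_sum
    intro p hp
    have hp' := Nat.prime_of_mem_primesBelow hp
    have hlt := Nat.lt_of_mem_primesBelow hp
    have h0 : (0 : ℝ) < p := by exact_mod_cast hp'.pos
    have h1 : 1 ≤ N / p := (Nat.one_le_div_iff hp'.pos).2 hlt.le
    have h2 : N ≤ 2 * (N / p) * p := by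
      have := Nat.lt_div_mul_add hp'.pos (a := N)
      nlinarith
    have h3 : (N : ℝ) ≤ 2 * ((N / p : ℕ) : ℝ) * p := by exact_mod_cast h2
    have h4 : 0 ≤ Real.log p := Real.log_natCast_nonneg p
    have h5 : (N : ℝ) / p ≤ 2 * ((N / p : ℕ) : ℝ) := by rwa [div_le_iff₀ h0]
    calc (N : ℝ) * (Real.log p / p) = (N / p) * Real.log p := by ring
      _ ≤ 2 * ((N / p : ℕ) : ℝ) * Real.log p := by gcongr
      _ = _ := by ring
  have : N * ∑ p ∈ N.primesBelow, Real.log p / p ≤ N * (2 * Real.log N) := by linarith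
  exact le_of_mul_le_mul_left this hN'

theorem norm_dirichletCharacter_mul_prime_cpow_le {n : ℕ} (χ : DirichletCharacter ℂ n)
    (p : Nat.Primes) (s : ℝ) : ‖χ (p : ℕ) * ((p : ℕ) : ℂ) ^ (-(s : ℂ))‖ ≤ ((p : ℕ) : ℝ) ^ (-s) := by
  rw [norm_mul]
  have h : ‖((p : ℕ) : ℂ) ^ (-(s : ℂ))‖ = ((p : ℕ) : ℝ) ^ (-s) := by
    rw [Complex.norm_natCast_cpow_of_pos p.2.pos]
    simp
  rw [h]
  exact mul_le_of_le_one_left (by positivity) (χ.norm_le_one _)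

theorem summable_re_dirichletCharacter_prime {n : ℕ} (χ : DirichletCharacter ℂ n) {s : ℝ}
    (hs : 1 < s) :
    Summable fun p : Nat.Primes => (χ (p : ℕ) * ((p : ℕ) : ℂ) ^ (-(s : ℂ))).re := by
  refine Summable.of_norm_bounded (g := fun p : Nat.Primes => ((p : ℕ) : ℝ) ^ (-s))
    (Nat.Primes.summable_rpow.2 (by linarith)) fun p => ?_
  exact (Complex.abs_re_le_norm _).trans (norm_dirichletCharacter_mul_prime_cpow_le χ p s)

theorem tsum_re_dirichletCharacter_prime_le {n : ℕ} (χ : DirichletCharacter ℂ n) {s : ℝ}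
    (hs : 1 < s) :
    ∑' p : Nat.Primes, (χ (p : ℕ) * ((p : ℕ) : ℂ) ^ (-(s : ℂ))).re ≤
      Real.log ‖LSeries (fun n => χ n) s‖ + ∑' p : Nat.Primes, ((p : ℕ) : ℝ) ^ (-2 : ℝ) := by
  have hs' : 1 < (s : ℂ).re := by simpa using hs
  have hsum := χ.summable_neg_log_one_sub_mul_prime_cpow hs'
  have hsq : Summable fun p : Nat.Primes => ((p : ℕ) : ℝ) ^ (-2 : ℝ) :=
    Nat.Primes.summable_rpow.2 (by norm_num)
  rw [← χ.LSeries_eulerProduct_exp_log hs', Complex.norm_exp, Real.log_exp, Complex.re_tsum hsum,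
    ← Summable.tsum_add (Complex.hasSum_re hsum.hasSum).summable hsq]
  refine Summable.tsum_le_tsum (fun p => ?_) (summable_re_dirichletCharacter_prime χ hs)
    ((Complex.hasSum_re hsum.hasSum).summable.add hsq)
  set w := χ (p : ℕ) * ((p : ℕ) : ℂ) ^ (-(s : ℂ)) with hw
  have hp2 : (2 : ℝ) ≤ (p : ℕ) := by exact_mod_cast p.2.two_le
  have hnorm : ‖w‖ ≤ ((p : ℕ) : ℝ) ^ (-1 : ℝ) :=
    (norm_dirichletCharacter_mul_prime_cpow_le χ p s).trans
      (Real.rpow_le_rpow_of_exponent_le (by linarith) (by linarith))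
  have hhalf : ‖w‖ ≤ 1 / 2 := by
    refine hnorm.trans ?_
    rw [Real.rpow_neg_one, one_div]
    gcongr
  have hlog := Complex.norm_log_one_sub_inv_sub_self_le (z := w) (by linarith)
  have hre : w.re ≤ 1 / 2 := (Complex.re_le_norm w).trans hhalf
  rw [Complex.log_inv _ (fun h => by
    have := (Complex.arg_eq_pi_iff.1 h).1
    simp at this
    linarith)] at hlog
  have h1 : w.re - (-Complex.log (1 - w)).re ≤ ‖w‖ ^ 2 * (1 - ‖w‖)⁻¹ / 2 := by
    refine le_trans ?_ hlog
    rw [norm_sub_rev, ← Complex.sub_re]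
    exact Complex.re_le_norm _
  have h2 : (1 - ‖w‖)⁻¹ ≤ 2 := by
    rw [inv_le_comm₀ (by linarith) (by norm_num)]
    linarith
  have h3 : ‖w‖ ^ 2 * (1 - ‖w‖)⁻¹ / 2 ≤ ‖w‖ ^ 2 := by
    nlinarith [sq_nonneg ‖w‖]
  have h4 : ‖w‖ ^ 2 ≤ ((p : ℕ) : ℝ) ^ (-2 : ℝ) := by
    calc ‖w‖ ^ 2 ≤ (((p : ℕ) : ℝ) ^ (-1 : ℝ)) ^ 2 := by gcongr
      _ = _ := by rw [← Real.rpow_natCast, ← Real.rpow_mul (by positivity)]; norm_num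
  linarith

/-- The nontrivial Dirichlet character modulo `4`. -/
noncomputable def chiFour : DirichletCharacter ℂ 4 :=
  ZMod.χ₄.ringHomComp (Int.castRingHom ℂ)

theorem chiFour_natCast (n : ℕ) : chiFour n = ((ZMod.χ₄ n : ℤ) : ℂ) := rfl

theorem chiFour_ne_one : chiFour ≠ 1 := by
  intro h
  have h1 := congrArg (fun χ : DirichletCharacter ℂ 4 => χ ((3 : ℕ) : ZMod 4)) h
  simp only [chiFour_natCast] at h1
  rw [ZMod.χ₄_nat_eq_if_mod_four, MulChar.one_apply
    (by rw [ZMod.isUnit_iff_coprime]; norm_num)] at h1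
  norm_num at h1

theorem exists_bound_LSeries_mod_four : ∃ C : ℝ, 1 ≤ C ∧ ∀ s : ℝ, 1 < s → s ≤ 2 →
    ‖LSeries (fun n => chiFour n) s‖ ≤ C ∧
    (s - 1) * ‖LSeries (fun n => (1 : DirichletCharacter ℂ 4) n) s‖ ≤ C := by
  have hc1 : ContinuousOn (fun s : ℝ => chiFour.LFunction s) (Set.Icc 1 2) :=
    ((DirichletCharacter.differentiable_LFunction chiFour_ne_one).continuous.comp
      Complex.continuous_ofReal).continuousOn
  have hc2 : ContinuousOn (fun s : ℝ => DirichletCharacter.LFunctionTrivChar₁ 4 s)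
      (Set.Icc 1 2) :=
    ((DirichletCharacter.differentiable_LFunctionTrivChar₁ 4).continuous.comp
      Complex.continuous_ofReal).continuousOn
  obtain ⟨C1, h1⟩ := isCompact_Icc.exists_bound_of_continuousOn hc1
  obtain ⟨C2, h2⟩ := isCompact_Icc.exists_bound_of_continuousOn hc2
  refine ⟨max 1 (max C1 C2), le_max_left _ _, fun s hs hs2 => ?_⟩
  have hs' : 1 < (s : ℂ).re := by simpa using hs
  have hne : (s : ℂ) ≠ 1 := by
    intro h
    rw [h] at hs'
    simp at hs'
  constructor
  · rw [← DirichletCharacter.LFunction_eq_LSeries _ hs']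
    exact (h1 s ⟨hs.le, hs2⟩).trans ((le_max_left _ _).trans (le_max_right _ _))
  · have := h2 s ⟨hs.le, hs2⟩
    simp only [DirichletCharacter.LFunctionTrivChar₁, Function.update_of_ne hne, norm_mul] at this
    rw [← DirichletCharacter.LFunction_eq_LSeries _ hs']
    have h3 : ‖(s : ℂ) - 1‖ = s - 1 := by
      rw [← Complex.ofReal_one, ← Complex.ofReal_sub, Complex.norm_real, Real.norm_eq_abs,
        abs_of_pos (by linarith)]
    rw [h3] at this
    exact this.trans ((le_max_right _ _).trans (le_max_right _ _))

theorem log_norm_LSeries_le_log {n : ℕ} (χ : DirichletCharacter ℂ n) {s B : ℝ}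
    (hs : 1 < s) (hB : ‖LSeries (fun n => χ n) s‖ ≤ B) :
    Real.log ‖LSeries (fun n => χ n) s‖ ≤ Real.log B := by
  refine Real.log_le_log ?_ hB
  rw [← χ.LSeries_eulerProduct_exp_log (by simpa using hs)]
  exact norm_pos_iff.2 (Complex.exp_ne_zero _)

theorem inv_le_rpow_neg_add {p σ : ℝ} (hp : 0 < p) :
    1 / p ≤ p ^ (-(1 + σ)) + σ * (Real.log p / p) := by
  have h1 : p ^ (-(1 + σ)) = p⁻¹ * Real.exp (-σ * Real.log p) := by
    rw [neg_add, Real.rpow_add hp, Real.rpow_neg_one, Real.rpow_def_of_pos hp]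
    ring_nf
  have h2 := Real.add_one_le_exp (-σ * Real.log p)
  rw [h1]
  have h3 : p⁻¹ * (-σ * Real.log p + 1) ≤ p⁻¹ * Real.exp (-σ * Real.log p) := by gcongr
  calc 1 / p = p⁻¹ * (-σ * Real.log p + 1) + σ * (Real.log p / p) := by field_simp; ring
    _ ≤ _ := by linarith

theorem re_chars_mul_cpow (p : ℕ) (hp : p.Prime) (s : ℝ) :
    3 * ((1 : DirichletCharacter ℂ 4) p * (p : ℂ) ^ (-(s : ℂ))).re +
      (chiFour p * (p : ℂ) ^ (-(s : ℂ))).re =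
    (if p = 2 then 0 else (3 + (ZMod.χ₄ p : ℤ)) * (p : ℝ) ^ (-s)) := by
  have hc : (p : ℂ) ^ (-(s : ℂ)) = (((p : ℝ) ^ (-s) : ℝ) : ℂ) := by
    rw [Complex.ofReal_cpow (by positivity)]
    simp
  have h2 : (chiFour p * (p : ℂ) ^ (-(s : ℂ))).re = (ZMod.χ₄ p : ℤ) * (p : ℝ) ^ (-s) := by
    rw [hc, chiFour_natCast, ← Complex.ofReal_intCast, ← Complex.ofReal_mul, Complex.ofReal_re]
  rw [h2]
  split_ifs with h
  · subst h
    rw [MulChar.map_nonunit _ (by rw [ZMod.isUnit_iff_coprime]; norm_num),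
      ZMod.χ₄_nat_eq_if_mod_four]
    simp
  · have hu : IsUnit ((p : ℕ) : ZMod 4) := by
      rw [ZMod.isUnit_iff_coprime]
      have : Nat.Coprime p 2 := (Nat.coprime_primes hp Nat.prime_two).2 h
      exact Nat.Coprime.mul_right this this
    rw [MulChar.one_apply hu, one_mul, hc, Complex.ofReal_re]
    ring

theorem exists_sum_primes_three_add_chiFour_le : ∃ C : ℝ, 0 ≤ C ∧ ∀ N : ℕ, 2 ≤ N →
    ∑ p ∈ N.primesBelow, (3 + (ZMod.χ₄ p : ℤ) : ℝ) / p ≤ 3 * Real.log (Real.log N) + C := by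
  obtain ⟨B, hB1, hB⟩ := exists_bound_LSeries_mod_four
  set K : ℝ := ∑' p : Nat.Primes, ((p : ℕ) : ℝ) ^ (-2 : ℝ) with hK
  have hK0 : 0 ≤ K := tsum_nonneg fun p => by positivity
  have hlB : 0 ≤ Real.log B := Real.log_nonneg hB1
  have hl2 : 0 < Real.log 2 := Real.log_pos one_lt_two
  refine ⟨3 / 2 + 4 + 4 * Real.log B + 3 * Real.log 2 + 4 * K, by positivity, fun N hN => ?_⟩
  have hlN : Real.log 2 ≤ Real.log N := Real.log_le_log (by norm_num) (by exact_mod_cast hN)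
  have hlN0 : 0 < Real.log N := by linarith
  have hl2' := Real.log_two_gt_d9
  set σ : ℝ := 1 / (2 * Real.log N) with hσ
  have hσ0 : 0 < σ := by positivity
  have hσ1 : σ ≤ 1 := by
    rw [hσ, div_le_one (by positivity)]
    linarith
  have hσN : σ * Real.log N = 1 / 2 := by
    rw [hσ]
    field_simp
  set s : ℝ := 1 + σ with hs
  have hs1 : 1 < s := by linarith
  obtain ⟨hL1, hL0⟩ := hB s hs1 (by linarith)
  set f : ℕ → ℝ := fun p => if p = 2 then 0 else (3 + (ZMod.χ₄ p : ℤ)) * (p : ℝ) ^ (-s) with hf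
  have hχ : ∀ p : ℕ, (0 : ℝ) ≤ 3 + (ZMod.χ₄ p : ℤ) ∧ (3 + (ZMod.χ₄ p : ℤ) : ℝ) ≤ 4 := by
    intro p
    rw [ZMod.χ₄_nat_eq_if_mod_four]
    split_ifs <;> norm_num
  have hf0 : ∀ p, 0 ≤ f p := by
    intro p
    simp only [hf]
    split_ifs
    · rfl
    · exact mul_nonneg (hχ p).1 (by positivity)
  have hsum0 := summable_re_dirichletCharacter_prime (1 : DirichletCharacter ℂ 4) hs1
  have hsum1 := summable_re_dirichletCharacter_prime chiFour hs1
  have hfeq : ∀ p : Nat.Primes, f p =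
      3 * ((1 : DirichletCharacter ℂ 4) (p : ℕ) * ((p : ℕ) : ℂ) ^ (-(s : ℂ))).re +
      (chiFour (p : ℕ) * ((p : ℕ) : ℂ) ^ (-(s : ℂ))).re :=
    fun p => (re_chars_mul_cpow p p.2 s).symm
  have hfsum : Summable fun p : Nat.Primes => f p := by
    simp only [hfeq]
    exact (hsum0.mul_left 3).add hsum1
  have htsum : ∑' p : Nat.Primes, f p ≤ 3 * (Real.log (B / σ) + K) + (Real.log B + K) := by
    simp only [hfeq]
    rw [Summable.tsum_add (hsum0.mul_left 3) hsum1, tsum_mul_left]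
    have h0 := tsum_re_dirichletCharacter_prime_le (1 : DirichletCharacter ℂ 4) hs1
    have h1 := tsum_re_dirichletCharacter_prime_le chiFour hs1
    have h0' := log_norm_LSeries_le_log (1 : DirichletCharacter ℂ 4) hs1 (B := B / σ) (by
      rw [le_div_iff₀ hσ0]
      have : s - 1 = σ := by rw [hs]; ring
      rw [this] at hL0
      linarith)
    have h1' := log_norm_LSeries_le_log chiFour hs1 hL1
    linarith
  have hfin : ∑ p ∈ N.primesBelow, f p ≤ ∑' p : Nat.Primes, f p := by
    have h1 : ∑ p ∈ N.primesBelow, f p =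
        ∑ p ∈ N.primesBelow.subtype Nat.Prime, f (p : Nat.Primes) := by
      rw [Finset.sum_subtype_of_mem (p := Nat.Prime) f
        fun p hp => Nat.prime_of_mem_primesBelow hp]
    rw [h1]
    exact Summable.sum_le_tsum (f := fun p : Nat.Primes => f p) _ (fun p _ => hf0 p) hfsum
  have hterm : ∀ p ∈ N.primesBelow, (3 + (ZMod.χ₄ p : ℤ) : ℝ) / p ≤
      (if p = 2 then 3 / 2 else 0) + f p + 4 * σ * (Real.log p / p) := by
    intro p hp
    have hp' := Nat.prime_of_mem_primesBelow hp
    have h0 : (0 : ℝ) < p := by exact_mod_cast hp'.pos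
    have hlp : 0 ≤ Real.log p / p := div_nonneg (Real.log_natCast_nonneg p) h0.le
    by_cases h2 : p = 2
    · have h3 : (ZMod.χ₄ (p : ℕ) : ℤ) = 0 := by
        rw [ZMod.χ₄_nat_eq_if_mod_four, h2]
        rfl
      have : 0 ≤ 4 * σ * (Real.log p / p) := by positivity
      have hfp := hf0 p
      rw [h3, if_pos h2]
      have : (3 + ((0 : ℤ) : ℝ)) / (p : ℝ) = 3 / 2 := by rw [h2]; norm_num
      linarith
    · simp only [hf, if_neg h2]
      have h4 := inv_le_rpow_neg_add (σ := σ) h0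
      have h5 : (3 + (ZMod.χ₄ p : ℤ) : ℝ) * (1 / p) ≤
          (3 + (ZMod.χ₄ p : ℤ)) * ((p : ℝ) ^ (-s) + σ * (Real.log p / p)) :=
        mul_le_mul_of_nonneg_left h4 (hχ p).1
      have h6 : (3 + (ZMod.χ₄ p : ℤ) : ℝ) * (σ * (Real.log p / p)) ≤
          4 * (σ * (Real.log p / p)) :=
        mul_le_mul_of_nonneg_right (hχ p).2 (by positivity)
      rw [div_eq_mul_one_div]
      linarith
  have hlogdiv : Real.log (B / σ) = Real.log B + Real.log 2 + Real.log (Real.log N) := by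
    have : B / σ = B * (2 * Real.log N) := by
      rw [hσ]
      field_simp
    rw [this, Real.log_mul (by positivity) (by positivity), Real.log_mul (by positivity)
      (by positivity)]
    ring
  have hmert := sum_primesBelow_log_div_le N
  calc ∑ p ∈ N.primesBelow, (3 + (ZMod.χ₄ p : ℤ) : ℝ) / p
      ≤ ∑ p ∈ N.primesBelow, ((if p = 2 then 3 / 2 else 0) + f p + 4 * σ * (Real.log p / p)) :=
        Finset.sum_le_sum hterm
    _ = ∑ p ∈ N.primesBelow, (if p = 2 then (3 / 2 : ℝ) else 0) + ∑ p ∈ N.primesBelow, f p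
        + 4 * σ * ∑ p ∈ N.primesBelow, Real.log p / p := by
        rw [Finset.sum_add_distrib, Finset.sum_add_distrib, Finset.mul_sum]
    _ ≤ 3 / 2 + (3 * (Real.log (B / σ) + K) + (Real.log B + K)) + 4 * σ * (2 * Real.log N) := by
        gcongr
        · rw [Finset.sum_ite_eq']
          split_ifs <;> norm_num
        · exact hfin.trans htsum
    _ = _ := by
        rw [hlogdiv]
        linear_combination 8 * hσN

/-- The number of solutions of `t ^ 4 = 1` in `ℤ/e`. -/
noncomputable def numFourthRoots (e : ℕ) : ℕ := Nat.card {t : ZMod e // t ^ 4 = 1}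

theorem numFourthRoots_one : numFourthRoots 1 = 1 := by
  rw [numFourthRoots, Nat.card_eq_one_iff_unique]
  exact ⟨⟨fun a b => Subtype.ext (Subsingleton.elim _ _)⟩, ⟨⟨1, one_pow 4⟩⟩⟩

theorem numFourthRoots_mul {m n : ℕ} (h : m.Coprime n) :
    numFourthRoots (m * n) = numFourthRoots m * numFourthRoots n := by
  rw [numFourthRoots, numFourthRoots, numFourthRoots, ← Nat.card_prod]
  refine Nat.card_congr (((ZMod.chineseRemainder h).toEquiv.subtypeEquiv
    (q := fun t : ZMod m × ZMod n => t.1 ^ 4 = 1 ∧ t.2 ^ 4 = 1) fun t => ?_).trans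
    (Equiv.subtypeProdEquivProd (p := fun t : ZMod m => t ^ 4 = 1)
      (q := fun t : ZMod n => t ^ 4 = 1)))
  rw [← (ZMod.chineseRemainder h).injective.eq_iff, map_pow, map_one, Prod.ext_iff]
  rfl

theorem numFourthRoots_le_card {e : ℕ} {s : Finset (ZMod e)}
    (h : ∀ t : ZMod e, t ^ 4 = 1 → t ∈ s) : numFourthRoots e ≤ s.card := by
  have hsub : {t : ZMod e | t ^ 4 = 1} ⊆ s := fun t ht => h t ht
  have := Set.ncard_le_ncard hsub s.finite_toSet
  rw [Set.ncard_coe_finset] at this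
  exact this

theorem numFourthRoots_odd_prime_pow_le {p : ℕ} (hp : p.Prime) (hp2 : p ≠ 2) (v : ℕ) :
    numFourthRoots (p ^ v) ≤ 4 := by
  have : NeZero (p ^ v) := ⟨pow_ne_zero _ hp.ne_zero⟩
  have hcyc := ZMod.isCyclic_units_of_prime_pow p hp hp2 v
  have h4 := IsCyclic.card_pow_eq_one_le (α := (ZMod (p ^ v))ˣ) (n := 4) (by norm_num)
  refine (numFourthRoots_le_card (s := (Finset.univ.filter
    fun u : (ZMod (p ^ v))ˣ => u ^ 4 = 1).image Units.val) fun t ht => ?_).trans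
    (Finset.card_image_le.trans h4)
  obtain ⟨u, rfl⟩ := IsUnit.of_pow_eq_one ht (by norm_num)
  exact Finset.mem_image.2 ⟨u, by simpa [Units.ext_iff] using ht, rfl⟩

theorem two_pow_dvd_sub_or_add_of_dvd_pow_four_sub_one {x : ℤ} {v : ℕ} (h : (2 : ℤ) ^ (v + 3) ∣ x ^ 4 - 1) :
    (2 : ℤ) ^ (v + 1) ∣ x - 1 ∨ (2 : ℤ) ^ (v + 1) ∣ x + 1 := by
  have hodd : Odd x := by
    by_contra hx
    rw [Int.not_odd_iff_even] at hx
    obtain ⟨k, rfl⟩ := hx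
    have h2 : (2 : ℤ) ∣ (k + k) ^ 4 - 1 := (dvd_pow_self 2 (by omega)).trans h
    have h3 : (2 : ℤ) ∣ (k + k) ^ 4 := ⟨8 * k ^ 4, by ring⟩
    have := (Int.dvd_iff_dvd_of_dvd_sub h2).1 h3
    omega
  obtain ⟨k, rfl⟩ := hodd
  have h1 : (2 : ℤ) ^ (v + 3) ∣ 2 ^ 3 * ((2 * k * (k + 1) + 1) * (k * (k + 1))) := by
    convert h using 1
    ring
  rw [pow_add, mul_comm] at h1
  have h2 := Int.dvd_of_mul_dvd_mul_left (by norm_num) h1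
  have hc : IsCoprime ((2 : ℤ) ^ v) (2 * k * (k + 1) + 1) :=
    IsCoprime.pow_left ⟨-(k * (k + 1)), 1, by ring⟩
  have h3 := hc.dvd_of_dvd_mul_left h2
  rcases Int.even_or_odd k with hk | hk
  · have hc' : IsCoprime ((2 : ℤ) ^ v) (k + 1) := by
      obtain ⟨j, rfl⟩ := hk
      exact IsCoprime.pow_left ⟨-j, 1, by ring⟩
    left
    have h4 := mul_dvd_mul_left 2 (hc'.dvd_of_dvd_mul_right h3)
    rw [pow_succ', show 2 * k + 1 - 1 = 2 * k by ring]
    exact h4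
  · have hc' : IsCoprime ((2 : ℤ) ^ v) k := by
      obtain ⟨j, rfl⟩ := hk
      exact IsCoprime.pow_left ⟨-j, 1, by ring⟩
    right
    have h4 := mul_dvd_mul_left 2 (hc'.dvd_of_dvd_mul_left h3)
    rw [pow_succ', show 2 * k + 1 + 1 = 2 * (k + 1) by ring]
    exact h4

theorem numFourthRoots_two_pow_le (v : ℕ) : numFourthRoots (2 ^ v) ≤ 8 := by
  have : NeZero (2 ^ v) := ⟨pow_ne_zero _ two_ne_zero⟩
  rcases lt_or_ge v 3 with hv | hv
  · refine (numFourthRoots_le_card (s := Finset.univ) fun t _ => Finset.mem_univ t).trans ?_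
    rw [Finset.card_univ, ZMod.card]
    interval_cases v <;> norm_num
  obtain ⟨w, rfl⟩ := Nat.exists_eq_add_of_le' hv
  have h4 : (2 : ZMod (2 ^ (w + 3))) ^ (w + 1) * 4 = 0 := by
    have := ZMod.natCast_self (2 ^ (w + 3))
    push_cast at this
    rw [← this]
    ring
  have hmod : ∀ k : ℤ, (2 : ZMod (2 ^ (w + 3))) ^ (w + 1) * k =
      2 ^ (w + 1) * ((k % 4).toNat : ℕ) := by
    intro k
    have h5 : ((k % 4).toNat : ℤ) = k % 4 := Int.toNat_of_nonneg (Int.emod_nonneg _ (by norm_num))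
    rw [← Int.cast_natCast, h5]
    conv_lhs => rw [← Int.emod_add_mul_ediv k 4]
    push_cast
    linear_combination ((k / 4 : ℤ) : ZMod (2 ^ (w + 3))) * h4
  refine (numFourthRoots_le_card (s := ((Finset.range 4).image fun i : ℕ =>
      (1 : ZMod (2 ^ (w + 3))) + 2 ^ (w + 1) * (i : ZMod (2 ^ (w + 3)))) ∪
      ((Finset.range 4).image fun i : ℕ =>
      (-1 : ZMod (2 ^ (w + 3))) + 2 ^ (w + 1) * (i : ZMod (2 ^ (w + 3))))) fun t ht => ?_).trans
    ((Finset.card_union_le _ _).trans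
      (add_le_add Finset.card_image_le Finset.card_image_le))
  obtain ⟨x, rfl⟩ := ZMod.intCast_surjective t
  have hdvd : (2 : ℤ) ^ (w + 3) ∣ x ^ 4 - 1 := by
    have : ((x ^ 4 - 1 : ℤ) : ZMod (2 ^ (w + 3))) = 0 := by
      push_cast
      rw [ht, sub_self]
    rw [ZMod.intCast_zmod_eq_zero_iff_dvd] at this
    exact_mod_cast this
  have hlt : ∀ k : ℤ, (k % 4).toNat < 4 := by
    intro k
    omega
  rw [Finset.mem_union, Finset.mem_image, Finset.mem_image]
  rcases two_pow_dvd_sub_or_add_of_dvd_pow_four_sub_one hdvd with ⟨k, hk⟩ | ⟨k, hk⟩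
  · left
    refine ⟨(k % 4).toNat, Finset.mem_range.2 (hlt k), ?_⟩
    rw [← hmod, show x = 1 + 2 ^ (w + 1) * k by linarith]
    push_cast
    ring
  · right
    refine ⟨(k % 4).toNat, Finset.mem_range.2 (hlt k), ?_⟩
    rw [← hmod, show x = -1 + 2 ^ (w + 1) * k by linarith]
    push_cast
    ring

theorem numFourthRoots_prime_pow_le {p : ℕ} (hp : p.Prime) (v : ℕ) :
    numFourthRoots (p ^ v) ≤ 8 := by
  by_cases h : p = 2
  · rw [h]
    exact numFourthRoots_two_pow_le v
  · exact (numFourthRoots_odd_prime_pow_le hp h v).trans (by norm_num)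

theorem numFourthRoots_prime_le {p : ℕ} (hp : p.Prime) :
    (numFourthRoots p : ℝ) ≤ 3 + (ZMod.χ₄ p : ℤ) := by
  have : Fact p.Prime := ⟨hp⟩
  rw [ZMod.χ₄_nat_eq_if_mod_four]
  split_ifs with h2 h1
  · have hp2 : p = 2 := (hp.eq_one_or_self_of_dvd 2 (Nat.dvd_of_mod_eq_zero h2)).resolve_left
      (by norm_num) |>.symm
    have : numFourthRoots p ≤ 2 := by
      refine (numFourthRoots_le_card (s := Finset.univ) fun t _ => Finset.mem_univ t).trans ?_
      rw [Finset.card_univ, ZMod.card, hp2]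
    have h3 : (numFourthRoots p : ℝ) ≤ 2 := by exact_mod_cast this
    norm_num
    linarith
  · have h3 := numFourthRoots_odd_prime_pow_le hp (by rintro rfl; norm_num at h2) 1
    rw [pow_one] at h3
    have : (numFourthRoots p : ℝ) ≤ 4 := by exact_mod_cast h3
    norm_num
    exact h3
  · have : numFourthRoots p ≤ 2 := by
      refine (numFourthRoots_le_card (s := {1, -1}) fun t ht => ?_).trans Finset.card_le_two
      have h3 : (t ^ 2 - 1) * (t ^ 2 + 1) = 0 := by linear_combination ht
      rcases mul_eq_zero.1 h3 with h4 | h4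
      · have h5 : t ^ 2 = 1 := by linear_combination h4
        simpa using h5
      · exact absurd (ZMod.mod_four_ne_three_of_sq_eq_neg_one (y := t)
          (by linear_combination h4)) (by omega)
    have h3 : (numFourthRoots p : ℝ) ≤ 2 := by exact_mod_cast this
    norm_num
    linarith

/-- The arithmetic function `n ↦ τ(n) n ^ η`. -/
noncomputable def tauRpow (η : ℝ) : ArithmeticFunction ℝ :=
  ⟨fun n => n.divisors.card * (n : ℝ) ^ η, by simp⟩

theorem tauRpow_apply (η : ℝ) (n : ℕ) : tauRpow η n = n.divisors.card * (n : ℝ) ^ η := rfl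

theorem tauRpow_prime_pow (η : ℝ) {p : ℕ} (hp : p.Prime) (v : ℕ) :
    tauRpow η (p ^ v) = (v + 1) * (p : ℝ) ^ (η * v) := by
  rw [tauRpow_apply, Nat.divisors_prime_pow hp, Finset.card_map, Finset.card_range, Nat.cast_pow,
    ← Real.rpow_natCast, ← Real.rpow_mul (by positivity), mul_comm η]
  push_cast
  rfl

theorem isMultiplicative_tauRpow (η : ℝ) : (tauRpow η).IsMultiplicative := by
  refine ⟨by simp [tauRpow_apply], fun {m n} h => ?_⟩
  rw [tauRpow_apply, tauRpow_apply, tauRpow_apply, Nat.Coprime.card_divisors_mul h, Nat.cast_mul,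
    Nat.cast_mul, Real.mul_rpow (by positivity) (by positivity)]
  ring

/-- The Möbius transform of `n ↦ τ(n) n ^ η`. -/
noncomputable def tauRpowMoebius (η : ℝ) : ArithmeticFunction ℝ :=
  tauRpow η * (ArithmeticFunction.moebius : ArithmeticFunction ℝ)

theorem isMultiplicative_tauRpowMoebius (η : ℝ) : (tauRpowMoebius η).IsMultiplicative :=
  (isMultiplicative_tauRpow η).mul ArithmeticFunction.isMultiplicative_moebius.intCast

theorem sum_divisors_tauRpowMoebius (η : ℝ) (n : ℕ) :
    ∑ e ∈ n.divisors, tauRpowMoebius η e = tauRpow η n := by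
  rw [← ArithmeticFunction.coe_mul_zeta_apply, tauRpowMoebius, mul_assoc,
    ArithmeticFunction.coe_moebius_mul_coe_zeta, mul_one]

theorem tauRpowMoebius_prime_pow_succ (η : ℝ) {p : ℕ} (hp : p.Prime) (v : ℕ) :
    tauRpowMoebius η (p ^ (v + 1)) =
      (v + 2) * (p : ℝ) ^ (η * (v + 1)) - (v + 1) * (p : ℝ) ^ (η * v) := by
  have h1 := sum_divisors_tauRpowMoebius η (p ^ (v + 1))
  have h0 := sum_divisors_tauRpowMoebius η (p ^ v)
  rw [Nat.sum_divisors_prime_pow hp, tauRpow_prime_pow η hp] at h0 h1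
  rw [Finset.sum_range_succ, h0] at h1
  push_cast at h1
  linarith

theorem tauRpowMoebius_prime_pow_nonneg {η : ℝ} (hη : 0 ≤ η) {p : ℕ} (hp : p.Prime) (v : ℕ) :
    0 ≤ tauRpowMoebius η (p ^ v) := by
  rcases v with _ | v
  · rw [pow_zero, (isMultiplicative_tauRpowMoebius η).map_one]
    norm_num
  · rw [tauRpowMoebius_prime_pow_succ η hp, sub_nonneg]
    have h1 : (1 : ℝ) ≤ p := by exact_mod_cast hp.one_le
    gcongr <;> linarith

theorem tauRpowMoebius_nonneg {η : ℝ} (hη : 0 ≤ η) (n : ℕ) : 0 ≤ tauRpowMoebius η n := by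
  rcases eq_or_ne n 0 with rfl | hn
  · simp
  rw [(isMultiplicative_tauRpowMoebius η).multiplicative_factorization _ hn]
  exact Finset.prod_nonneg fun p hp =>
    tauRpowMoebius_prime_pow_nonneg hη (Nat.prime_of_mem_primeFactors hp) _

theorem exp_sub_one_le_mul_exp {x A : ℝ} (hx : 0 ≤ x) (hxA : x ≤ A) :
    Real.exp x - 1 ≤ x * Real.exp A := by
  have h1 := Real.add_one_le_exp (-x)
  have h2 : Real.exp x * (-x + 1) ≤ Real.exp x * Real.exp (-x) := by gcongr
  rw [← Real.exp_add, add_neg_cancel, Real.exp_zero] at h2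
  have h3 : x * Real.exp x ≤ x * Real.exp A := by gcongr
  linarith

/-- The Euler-product summand attached to `tauRpowMoebius` and the congruence `t ^ 4 = 1`. -/
noncomputable def rootWeight (η : ℝ) (e : ℕ) : ℝ :=
  tauRpowMoebius η e * numFourthRoots e / e

theorem rootWeight_nonneg {η : ℝ} (hη : 0 ≤ η) (e : ℕ) : 0 ≤ rootWeight η e :=
  div_nonneg (mul_nonneg (tauRpowMoebius_nonneg hη e) (by positivity)) (by positivity)

theorem rootWeight_one (η : ℝ) : rootWeight η 1 = 1 := by
  rw [rootWeight, (isMultiplicative_tauRpowMoebius η).map_one, numFourthRoots_one]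
  norm_num

theorem rootWeight_mul (η : ℝ) {m n : ℕ} (h : m.Coprime n) :
    rootWeight η (m * n) = rootWeight η m * rootWeight η n := by
  rw [rootWeight, rootWeight, rootWeight, (isMultiplicative_tauRpowMoebius η).map_mul_of_coprime h,
    numFourthRoots_mul h]
  push_cast
  rw [mul_mul_mul_comm, mul_div_mul_comm]

theorem rootWeight_prime_le {η A : ℝ} (hη : 0 ≤ η) {p : ℕ} (hp : p.Prime)
    (hA : η * Real.log p ≤ A) :
    rootWeight η p ≤ (3 + (ZMod.χ₄ p : ℤ)) / p + 8 * Real.exp A * η * (Real.log p / p) := by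
  have h0 : (0 : ℝ) < p := by exact_mod_cast hp.pos
  have h1 := tauRpowMoebius_prime_pow_succ η hp 0
  rw [zero_add, pow_one] at h1
  norm_num at h1
  have h2 : (p : ℝ) ^ η - 1 ≤ η * Real.log p * Real.exp A := by
    rw [Real.rpow_def_of_pos h0, mul_comm (Real.log _)]
    exact exp_sub_one_le_mul_exp (mul_nonneg hη (Real.log_natCast_nonneg p)) hA
  have h3 := numFourthRoots_prime_le hp
  have h4 : (numFourthRoots p : ℝ) ≤ 4 := h3.trans (by
    rw [ZMod.χ₄_nat_eq_if_mod_four]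
    split_ifs <;> norm_num)
  have h5 : 0 ≤ (p : ℝ) ^ η - 1 := by
    rw [sub_nonneg]
    exact Real.one_le_rpow (by exact_mod_cast hp.one_le) hη
  rw [rootWeight, h1]
  have h6 : (2 * (p : ℝ) ^ η - 1) * numFourthRoots p ≤
      (3 + (ZMod.χ₄ p : ℤ)) + 8 * Real.exp A * η * Real.log p := by
    have h7 : ((p : ℝ) ^ η - 1) * numFourthRoots p ≤ ((p : ℝ) ^ η - 1) * 4 := by gcongr
    linarith
  calc _ ≤ ((3 + (ZMod.χ₄ p : ℤ)) + 8 * Real.exp A * η * Real.log p) / (p : ℝ) := by gcongr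
    _ = _ := by ring

theorem rootWeight_prime_pow_add_two_le {η : ℝ} (hη1 : η ≤ 1 / 8) {p : ℕ}
    (hp : p.Prime) (w : ℕ) :
    rootWeight η (p ^ (w + 2)) ≤
      (p : ℝ) ^ (-(7 / 4) : ℝ) * (8 * (w + 3) * ((2 : ℝ) ^ (-(7 / 8) : ℝ)) ^ w) := by
  have h0 : (0 : ℝ) < p := by exact_mod_cast hp.pos
  have h1' : (1 : ℝ) ≤ p := by exact_mod_cast hp.one_le
  have hg : tauRpowMoebius η (p ^ (w + 2)) ≤ (w + 3) * (p : ℝ) ^ (η * (w + 2)) := by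
    have h1 := tauRpowMoebius_prime_pow_succ η hp (w + 1)
    push_cast at h1
    have h2 : 0 ≤ ((w : ℝ) + 1 + 1) * (p : ℝ) ^ (η * ((w : ℝ) + 1)) := by positivity
    have h3 : (p : ℝ) ^ (η * ((w : ℝ) + 1 + 1)) = (p : ℝ) ^ (η * ((w : ℝ) + 2)) := by ring_nf
    rw [show w + 1 + 1 = w + 2 by ring, h3] at h1
    rw [h1]
    linarith
  have hn : (numFourthRoots (p ^ (w + 2)) : ℝ) ≤ 8 := by
    exact_mod_cast numFourthRoots_prime_pow_le hp (w + 2)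
  have hp1 : (p : ℝ) ^ (η * (w + 2)) / ((p ^ (w + 2) : ℕ) : ℝ) ≤
      (p : ℝ) ^ (-(7 / 4) : ℝ) * ((2 : ℝ) ^ (-(7 / 8) : ℝ)) ^ w := by
    have h2 : (p : ℝ) ^ (-(7 / 8) : ℝ) ≤ (2 : ℝ) ^ (-(7 / 8) : ℝ) :=
      Real.rpow_le_rpow_of_nonpos (by norm_num) (by exact_mod_cast hp.two_le) (by norm_num)
    calc (p : ℝ) ^ (η * (w + 2)) / ((p ^ (w + 2) : ℕ) : ℝ)
        = (p : ℝ) ^ ((η - 1) * (w + 2)) := by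
          rw [Nat.cast_pow, ← Real.rpow_natCast, ← Real.rpow_sub h0]
          push_cast
          ring_nf
      _ ≤ (p : ℝ) ^ (-(7 / 4) + (-(7 / 8)) * w : ℝ) := by
          apply Real.rpow_le_rpow_of_exponent_le h1'
          have : (0 : ℝ) ≤ w := by positivity
          nlinarith
      _ = (p : ℝ) ^ (-(7 / 4) : ℝ) * ((p : ℝ) ^ (-(7 / 8) : ℝ)) ^ w := by
          rw [Real.rpow_add h0, Real.rpow_mul h0.le, Real.rpow_natCast]
      _ ≤ _ := by gcongr
  calc rootWeight η (p ^ (w + 2))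
      ≤ ((w + 3) * (p : ℝ) ^ (η * (w + 2))) * 8 / ((p ^ (w + 2) : ℕ) : ℝ) := by
        rw [rootWeight]
        gcongr
    _ = 8 * (w + 3) * ((p : ℝ) ^ (η * (w + 2)) / ((p ^ (w + 2) : ℕ) : ℝ)) := by ring
    _ ≤ 8 * (w + 3) * ((p : ℝ) ^ (-(7 / 4) : ℝ) * ((2 : ℝ) ^ (-(7 / 8) : ℝ)) ^ w) := by gcongr
    _ = _ := by ring

theorem summable_linear_mul_geometric :
    Summable fun w : ℕ => 8 * ((w : ℝ) + 3) * ((2 : ℝ) ^ (-(7 / 8) : ℝ)) ^ w := by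
  have hr : ‖(2 : ℝ) ^ (-(7 / 8) : ℝ)‖ < 1 := by
    rw [Real.norm_of_nonneg (by positivity)]
    exact Real.rpow_lt_one_of_one_lt_of_neg (by norm_num) (by norm_num)
  have h1 := (summable_pow_mul_geometric_of_norm_lt_one 1 hr).mul_left 8
  have h2 := (summable_geometric_of_norm_lt_one hr).mul_left 24
  refine (h1.add h2).congr fun w => ?_
  ring

theorem summable_rootWeight_prime_pow {η : ℝ} (hη : 0 ≤ η) (hη1 : η ≤ 1 / 8) {p : ℕ}
    (hp : p.Prime) : Summable fun v => rootWeight η (p ^ v) := by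
  rw [← summable_nat_add_iff 2]
  exact Summable.of_nonneg_of_le (fun w => rootWeight_nonneg hη _)
    (fun w => rootWeight_prime_pow_add_two_le hη1 hp w)
    (summable_linear_mul_geometric.mul_left _)

theorem tsum_rootWeight_prime_pow_le {η A : ℝ} (hη : 0 ≤ η) (hη1 : η ≤ 1 / 8) {p : ℕ}
    (hp : p.Prime) (hA : η * Real.log p ≤ A) :
    ∑' v, rootWeight η (p ^ v) ≤ Real.exp ((3 + (ZMod.χ₄ p : ℤ)) / p +
      8 * Real.exp A * η * (Real.log p / p) + (p : ℝ) ^ (-(7 / 4) : ℝ) *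
      ∑' w : ℕ, 8 * ((w : ℝ) + 3) * ((2 : ℝ) ^ (-(7 / 8) : ℝ)) ^ w) := by
  have hs := summable_rootWeight_prime_pow hη hη1 hp
  rw [← hs.sum_add_tsum_nat_add 2, Finset.sum_range_succ, Finset.sum_range_one, pow_zero, pow_one,
    rootWeight_one]
  have h1 := rootWeight_prime_le hη hp hA
  have h2 : ∑' w, rootWeight η (p ^ (w + 2)) ≤ (p : ℝ) ^ (-(7 / 4) : ℝ) *
      ∑' w : ℕ, 8 * ((w : ℝ) + 3) * ((2 : ℝ) ^ (-(7 / 8) : ℝ)) ^ w := by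
    rw [← tsum_mul_left]
    exact Summable.tsum_le_tsum (fun w => rootWeight_prime_pow_add_two_le hη1 hp w)
      ((summable_nat_add_iff 2).2 hs) (summable_linear_mul_geometric.mul_left _)
  refine le_trans ?_ (Real.add_one_le_exp _)
  linarith

theorem exists_sum_smooth_rootWeight_le (A : ℝ) : ∃ C : ℝ, 0 < C ∧
    ∀ (η : ℝ) (N : ℕ) (s : Finset ℕ), 0 ≤ η → η ≤ 1 / 8 → 2 ≤ N → η * Real.log N ≤ A →
      (∀ e ∈ s, e ∈ N.smoothNumbers) → ∑ e ∈ s, rootWeight η e ≤ C * Real.log N ^ 3 := by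
  obtain ⟨C1, hC1, hC⟩ := exists_sum_primes_three_add_chiFour_le
  set K : ℝ := ∑' w : ℕ, 8 * ((w : ℝ) + 3) * ((2 : ℝ) ^ (-(7 / 8) : ℝ)) ^ w with hK
  have hK0 : 0 ≤ K := tsum_nonneg fun w => by positivity
  set P : ℝ := ∑' p : ℕ, (p : ℝ) ^ (-(7 / 4) : ℝ) with hP
  refine ⟨Real.exp (C1 + 16 * Real.exp A * A + P * K), Real.exp_pos _, ?_⟩
  intro η N s hη hη1 hN hA hs
  have hlN : 0 < Real.log N := Real.log_pos (by exact_mod_cast hN)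
  have hE := EulerProduct.summable_and_hasSum_smoothNumbers_prod_primesBelow_tsum
    (rootWeight_one η) (fun {m n} h => rootWeight_mul η h)
    (fun {p} hp => (summable_rootWeight_prime_pow hη hη1 hp).norm) N
  have h1 : ∑ e ∈ s, rootWeight η e ≤ ∏ p ∈ N.primesBelow, ∑' v, rootWeight η (p ^ v) := by
    rw [← Finset.sum_subtype_of_mem (p := fun e => e ∈ N.smoothNumbers) (rootWeight η) hs]
    exact sum_le_hasSum _ (fun e _ => rootWeight_nonneg hη e) hE.2
  have hpA : ∀ p ∈ N.primesBelow, η * Real.log p ≤ A := by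
    intro p hp
    refine le_trans ?_ hA
    have := (Nat.prime_of_mem_primesBelow hp).pos
    have := (Nat.lt_of_mem_primesBelow hp).le
    gcongr
  have h2 : ∏ p ∈ N.primesBelow, ∑' v, rootWeight η (p ^ v) ≤
      ∏ p ∈ N.primesBelow, Real.exp ((3 + (ZMod.χ₄ p : ℤ)) / p +
      8 * Real.exp A * η * (Real.log p / p) + (p : ℝ) ^ (-(7 / 4) : ℝ) * K) :=
    Finset.prod_le_prod (fun p _ => tsum_nonneg fun v => rootWeight_nonneg hη _)
      fun p hp => tsum_rootWeight_prime_pow_le hη hη1 (Nat.prime_of_mem_primesBelow hp) (hpA p hp)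
  refine h1.trans (h2.trans ?_)
  rw [← Real.exp_sum, Finset.sum_add_distrib, Finset.sum_add_distrib, ← Finset.mul_sum,
    ← Finset.sum_mul]
  have h3 : ∑ p ∈ N.primesBelow, (p : ℝ) ^ (-(7 / 4) : ℝ) ≤ P :=
    (Real.summable_nat_rpow.2 (by norm_num)).sum_le_tsum _ fun p _ => by positivity
  have h4 := sum_primesBelow_log_div_le N
  have h5 : Real.log N ^ 3 = Real.exp (3 * Real.log (Real.log N)) := by
    rw [mul_comm, Real.exp_mul, Real.exp_log hlN]
    norm_cast
  rw [h5, ← Real.exp_add, Real.exp_le_exp]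
  have h6 : 8 * Real.exp A * η * ∑ p ∈ N.primesBelow, Real.log p / p ≤
      16 * Real.exp A * A := by
    calc _ ≤ 8 * Real.exp A * η * (2 * Real.log N) := by gcongr
      _ = 16 * Real.exp A * (η * Real.log N) := by ring
      _ ≤ _ := by gcongr
  have h7 : (∑ p ∈ N.primesBelow, (p : ℝ) ^ (-(7 / 4) : ℝ)) * K ≤ P * K := by gcongr
  have h8 := hC N hN
  linarith

theorem card_divisors_mul_le (m n : ℕ) :
    (m * n).divisors.card ≤ m.divisors.card * n.divisors.card := by
  rw [Nat.divisors_mul]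
  exact Finset.card_mul_le

theorem card_divisors_rpow_prod_le {ε c : ℝ} (hc : ∀ v : ℕ, (v + 1 : ℝ) ≤ c * (2 : ℝ) ^ (ε * v))
    (hε : 0 < ε) {n : ℕ} (hn : n ≠ 0) :
    (n.divisors.card : ℝ) ≤
      (∏ p ∈ n.primeFactors, if (2 : ℝ) ≤ (p : ℝ) ^ ε then 1 else c) * (n : ℝ) ^ ε := by
  have hn0 : (0 : ℝ) < n := by exact_mod_cast Nat.pos_of_ne_zero hn
  have h1 : tauRpow (-ε) n ≤ ∏ p ∈ n.primeFactors, if (2 : ℝ) ≤ (p : ℝ) ^ ε then 1 else c := by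
    rw [(isMultiplicative_tauRpow (-ε)).multiplicative_factorization _ hn]
    refine Finset.prod_le_prod (fun p hp => ?_) fun p hp => ?_
    · beta_reduce
      rw [tauRpow_prime_pow _ (Nat.prime_of_mem_primeFactors hp)]
      positivity
    have hp' := Nat.prime_of_mem_primeFactors hp
    have hp0 : (0 : ℝ) < p := by exact_mod_cast hp'.pos
    set v := n.factorization p
    beta_reduce
    rw [tauRpow_prime_pow _ hp', neg_mul, Real.rpow_neg hp0.le, ← div_eq_mul_inv,
      div_le_iff₀ (by positivity)]
    split_ifs with h
    · rw [one_mul, Real.rpow_mul hp0.le, Real.rpow_natCast]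
      calc (v + 1 : ℝ) ≤ 2 ^ v := by exact_mod_cast Nat.lt_two_pow_self
        _ ≤ _ := by gcongr
    · have hc0 : 0 ≤ c := by
        have := hc 0
        norm_num at this
        linarith
      refine (hc v).trans ?_
      gcongr
      exact_mod_cast hp'.two_le
  rw [tauRpow_apply, Real.rpow_neg hn0.le, ← div_eq_mul_inv, div_le_iff₀ (by positivity)] at h1
  exact h1

theorem exists_card_divisors_le_rpow {ε : ℝ} (hε : 0 < ε) :
    ∃ C : ℝ, 1 ≤ C ∧ ∀ n : ℕ, n ≠ 0 → (n.divisors.card : ℝ) ≤ C * (n : ℝ) ^ ε := by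
  have hl2 : 0 < Real.log 2 := Real.log_pos one_lt_two
  set c : ℝ := 1 + 1 / (ε * Real.log 2) with hc
  have hc1 : 1 ≤ c := by
    rw [hc]
    have : 0 < 1 / (ε * Real.log 2) := by positivity
    linarith
  have hcv : ∀ v : ℕ, (v + 1 : ℝ) ≤ c * (2 : ℝ) ^ (ε * v) := by
    intro v
    have h1 := Real.add_one_le_exp (Real.log 2 * (ε * v))
    rw [← Real.rpow_def_of_pos (by norm_num)] at h1
    calc (v + 1 : ℝ) ≤ c * (Real.log 2 * (ε * v) + 1) := by
          have h2 : c * (Real.log 2 * (ε * v) + 1) =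
            Real.log 2 * (ε * v) + 1 + v + 1 / (ε * Real.log 2) := by
            rw [hc]
            field_simp
            ring
          rw [h2]
          have : 0 < 1 / (ε * Real.log 2) := by positivity
          have : 0 ≤ Real.log 2 * (ε * v) := by positivity
          linarith
      _ ≤ _ := by gcongr
  set P : ℕ := ⌈(2 : ℝ) ^ (1 / ε)⌉₊ with hP
  refine ⟨c ^ P, one_le_pow₀ hc1, fun n hn => ?_⟩
  refine (card_divisors_rpow_prod_le hcv hε hn).trans ?_
  gcongr
  rw [Finset.prod_ite, Finset.prod_const_one, one_mul, Finset.prod_const]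
  refine pow_le_pow_right₀ hc1 ?_
  refine (Finset.card_le_card (t := Finset.range P) fun p hp => ?_).trans (Finset.card_range P).le
  rw [Finset.mem_filter, not_le] at hp
  rw [Finset.mem_range, hP, Nat.lt_ceil]
  have h1 : (p : ℝ) = ((p : ℝ) ^ ε) ^ (1 / ε) := by
    rw [← Real.rpow_mul (by positivity), mul_one_div_cancel hε.ne', Real.rpow_one]
  rw [h1]
  exact Real.rpow_lt_rpow (by positivity) hp.2 (by positivity)

theorem card_divisors_le_rpow_of_rough {q n : ℕ} (hq : 2 ≤ q) (hn : n ≠ 0)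
    (h : ∀ p, p.Prime → p ∣ n → q ≤ p) :
    (n.divisors.card : ℝ) ≤ (n : ℝ) ^ (Real.log 2 / Real.log q) := by
  have hlq : 0 < Real.log q := Real.log_pos (by exact_mod_cast hq)
  have hl2 : 0 < Real.log 2 := Real.log_pos one_lt_two
  have hε : 0 < Real.log 2 / Real.log q := by positivity
  have hq0 : (0 : ℝ) < q := by positivity
  have hn0 : (0 : ℝ) < n := by exact_mod_cast Nat.pos_of_ne_zero hn
  have hqε : (q : ℝ) ^ (Real.log 2 / Real.log q) = 2 := by
    rw [Real.rpow_def_of_pos hq0, mul_div_cancel₀ _ hlq.ne', Real.exp_log (by norm_num)]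
  have h1 : tauRpow (-(Real.log 2 / Real.log q)) n ≤ 1 := by
    rw [(isMultiplicative_tauRpow _).multiplicative_factorization _ hn]
    refine Finset.prod_le_one (fun p hp => ?_) fun p hp => ?_
    · beta_reduce
      rw [tauRpow_prime_pow _ (Nat.prime_of_mem_primeFactors hp)]
      positivity
    have hp' := Nat.prime_of_mem_primeFactors hp
    have hp0 : (0 : ℝ) < p := by exact_mod_cast hp'.pos
    set v := n.factorization p
    beta_reduce
    rw [tauRpow_prime_pow _ hp', neg_mul, Real.rpow_neg hp0.le, ← div_eq_mul_inv,
      div_le_one (by positivity), Real.rpow_mul hp0.le, Real.rpow_natCast]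
    have h2 : (2 : ℝ) ≤ (p : ℝ) ^ (Real.log 2 / Real.log q) := by
      have hqp : (q : ℝ) ≤ p := by exact_mod_cast h p hp' (Nat.dvd_of_mem_primeFactors hp)
      exact hqε.ge.trans (Real.rpow_le_rpow hq0.le hqp hε.le)
    calc (v + 1 : ℝ) ≤ 2 ^ v := by exact_mod_cast Nat.lt_two_pow_self
      _ ≤ _ := by gcongr
  rwa [tauRpow_apply, Real.rpow_neg hn0.le, ← div_eq_mul_inv, div_le_one (by positivity)] at h1

theorem exists_dvd_le_of_ordered_primes {m : ℕ} (hm : m ≠ 0) {D : ℝ} (hD : 1 ≤ D) :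
    ∃ d, d ∣ m ∧ (d : ℝ) ≤ D ∧ (d = m ∨ ∃ q : ℕ, q.Prime ∧
      (∀ p, p.Prime → p ∣ d → p ≤ q) ∧ (∀ p, p.Prime → p ∣ m / d → q ≤ p) ∧ D < d * q) := by
  set S := m.divisors.filter fun d : ℕ => (d : ℝ) ≤ D ∧
    ∀ p : ℕ, p.Prime → p ∣ d → ∀ p' : ℕ, p'.Prime → p' ∣ m / d → p ≤ p' with hS
  have hne : S.Nonempty := by
    refine ⟨1, ?_⟩
    rw [hS, Finset.mem_filter]
    refine ⟨Nat.one_mem_divisors.2 hm, by simpa using hD, fun p hp h1 => ?_⟩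
    exact absurd (Nat.dvd_one.1 h1) hp.ne_one
  obtain ⟨d, hdS, hmax⟩ := S.exists_max_image id hne
  rw [hS, Finset.mem_filter, Nat.mem_divisors] at hdS
  obtain ⟨⟨hdm, -⟩, hdD, hord⟩ := hdS
  refine ⟨d, hdm, hdD, ?_⟩
  by_cases hd : d = m
  · exact Or.inl hd
  right
  have hd0 : 0 < d := Nat.pos_of_dvd_of_pos hdm (Nat.pos_of_ne_zero hm)
  have hne1 : m / d ≠ 1 := by
    intro h
    have := Nat.div_mul_cancel hdm
    rw [h, one_mul] at this
    exact hd this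
  have hq := Nat.minFac_prime hne1
  set q := (m / d).minFac with hqdef
  have hqd : q ∣ m / d := Nat.minFac_dvd _
  refine ⟨q, hq, fun p hp hpd => hord p hp hpd q hq hqd,
    fun p hp hpd => Nat.minFac_le_of_dvd hp.two_le hpd, ?_⟩
  by_contra hcon
  rw [not_lt] at hcon
  have hmem : d * q ∈ S := by
    rw [hS, Finset.mem_filter, Nat.mem_divisors]
    refine ⟨⟨Nat.mul_dvd_of_dvd_div hdm hqd, hm⟩, by exact_mod_cast hcon, ?_⟩
    intro p hp hpd p' hp' hpd'
    rw [← Nat.div_div_eq_div_mul] at hpd'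
    have hp'd : p' ∣ m / d := hpd'.trans (Nat.div_dvd_of_dvd hqd)
    rcases (hp.dvd_mul).1 hpd with h | h
    · exact hord p hp h p' hp' hp'd
    · rw [(Nat.prime_dvd_prime_iff_eq hp hq).1 h]
      exact Nat.minFac_le_of_dvd hp'.two_le hp'd
  have h1 := hmax _ hmem
  simp only [id] at h1
  nlinarith [hq.two_le]

/-- Landreau-type majorant: `τ(m)` is controlled by one divisor `d ≤ m ^ (1 / 8)` whose prime
factors are small compared with the loss incurred. -/
theorem exists_card_divisors_le_tauRpow : ∃ C : ℝ, 0 < C ∧ ∀ (D : ℝ) (m : ℕ), 1 ≤ D → m ≠ 0 →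
    (m : ℝ) ≤ D ^ (8 : ℝ) → ∃ d, d ∣ m ∧ (d : ℝ) ≤ D ∧
      ((∃ k : ℕ, 1 ≤ k ∧ 14 * (k : ℝ) ≤ Real.log D / 8 ∧
        (∀ p : ℕ, p.Prime → p ∣ d → k * Real.log p ≤ Real.log D) ∧
        (m.divisors.card : ℝ) ≤ C * Real.exp (-k) * tauRpow (14 * k / Real.log D) d) ∨
      ((∀ p : ℕ, p.Prime → p ∣ d → Real.log p ≤ 112) ∧
        (m.divisors.card : ℝ) ≤ C * tauRpow (1 / 8) d)) := by
  obtain ⟨C1, hC1, hdiv⟩ := exists_card_divisors_le_rpow (ε := 1 / 128) (by norm_num)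
  refine ⟨C1 * Real.exp 13, by positivity, fun D m hD hm hmD => ?_⟩
  have hD0 : 0 < D := by linarith
  have hLD : 0 ≤ Real.log D := Real.log_nonneg hD
  obtain ⟨d, hdm, hdD, hcase⟩ := exists_dvd_le_of_ordered_primes hm hD
  have hd0 : 0 < d := Nat.pos_of_dvd_of_pos hdm (Nat.pos_of_ne_zero hm)
  have hd0' : (0 : ℝ) < d := by exact_mod_cast hd0
  have hd1 : (1 : ℝ) ≤ d := by exact_mod_cast hd0
  have hld : 0 ≤ Real.log d := Real.log_nonneg hd1
  have hpD : ∀ p : ℕ, p.Prime → p ∣ d → Real.log p ≤ Real.log D := by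
    intro p hp hpd
    apply Real.log_le_log (by exact_mod_cast hp.pos)
    refine le_trans ?_ hdD
    exact_mod_cast Nat.le_of_dvd hd0 hpd
  have hme : (m / d : ℕ) ≠ 0 := (Nat.div_pos (Nat.le_of_dvd (Nat.pos_of_ne_zero hm) hdm) hd0).ne'
  have hmeD : ((m / d : ℕ) : ℝ) ≤ D ^ (8 : ℝ) :=
    le_trans (by exact_mod_cast Nat.div_le_self m d) hmD
  have hmul : (m.divisors.card : ℝ) ≤ d.divisors.card * (m / d).divisors.card := by
    have := card_divisors_mul_le d (m / d)
    rw [Nat.mul_div_cancel' hdm] at this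
    exact_mod_cast this
  -- It suffices to control the complementary divisor for a suitable `k`.
  suffices h : ∃ k : ℕ, 1 ≤ k ∧ (∀ p : ℕ, p.Prime → p ∣ d → k * Real.log p ≤ Real.log D) ∧
      (k = 1 ∨ Real.log D ≤ 2 * Real.log d) ∧
      ((m / d).divisors.card : ℝ) ≤ Real.exp (6 * (k + 1)) by
    obtain ⟨k, hk1, hkp, hkd, hk⟩ := h
    have hk1' : (1 : ℝ) ≤ k := by exact_mod_cast hk1
    refine ⟨d, hdm, hdD, ?_⟩
    rcases le_or_gt (14 * (k : ℝ)) (Real.log D / 8) with hkD | hkD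
    · left
      refine ⟨k, hk1, hkD, hkp, hmul.trans ?_⟩
      have hLD0 : 0 < Real.log D := by linarith
      have h2 : 7 * (k : ℝ) - 7 ≤ Real.log d * (14 * k / Real.log D) := by
        rcases hkd with rfl | hkd
        · norm_num
          positivity
        · have h3 : Real.log d * (14 * k / Real.log D) =
            (2 * Real.log d / Real.log D) * (7 * k) := by ring
          have h4 : 1 ≤ 2 * Real.log d / Real.log D := by rwa [le_div_iff₀ hLD0, one_mul]
          nlinarith
      rw [tauRpow_apply, Real.rpow_def_of_pos hd0']
      calc (d.divisors.card : ℝ) * (m / d).divisors.card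
          ≤ d.divisors.card * (C1 * Real.exp (6 * (k + 1))) := by
            gcongr
            exact hk.trans (le_mul_of_one_le_left (by positivity) hC1)
        _ ≤ d.divisors.card * (C1 * Real.exp (13 + -k +
            Real.log d * (14 * k / Real.log D))) := by
            gcongr
            linarith
        _ = _ := by
            rw [Real.exp_add, Real.exp_add]
            ring
    · right
      refine ⟨fun p hp hpd => ?_, hmul.trans ?_⟩
      · have := hkp p hp hpd
        by_contra hcon
        rw [not_le] at hcon
        nlinarith
      · have h2 : Real.log D / 16 ≤ 13 + Real.log d * (1 / 8) := by
          rcases hkd with rfl | hkd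
          · norm_num at hkD
            linarith
          · linarith
        rw [tauRpow_apply, Real.rpow_def_of_pos hd0']
        calc (d.divisors.card : ℝ) * (m / d).divisors.card
            ≤ d.divisors.card * (C1 * (D ^ (8 : ℝ)) ^ (1 / 128 : ℝ)) := by
              gcongr
              refine (hdiv _ hme).trans ?_
              gcongr
          _ = d.divisors.card * (C1 * Real.exp (Real.log D / 16)) := by
              rw [← Real.rpow_mul hD0.le, Real.rpow_def_of_pos hD0]
              ring_nf
          _ ≤ d.divisors.card * (C1 * Real.exp (13 + Real.log d * (1 / 8))) := by gcongr
          _ = _ := by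
              rw [Real.exp_add]
              ring
  rcases hcase with rfl | ⟨q, hq, hpq, hqp, hDq⟩
  · refine ⟨1, le_rfl, by simpa using hpD, Or.inl rfl, ?_⟩
    rw [Nat.div_self hd0]
    simp
  have hlq : 0 < Real.log q := Real.log_pos (by exact_mod_cast hq.one_lt)
  have hlq0 : (0 : ℝ) < q := by exact_mod_cast hq.pos
  set κ := Real.log D / Real.log q with hκ
  have hκ0 : 0 ≤ κ := by positivity
  have hκq : κ * Real.log q = Real.log D := by
    rw [hκ]
    field_simp
  have hlt := Nat.lt_floor_add_one κ
  have hfl := Nat.floor_le hκ0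
  have hdq : Real.log D < Real.log d + Real.log q := by
    rw [← Real.log_mul hd0'.ne' hlq0.ne']
    exact Real.log_lt_log hD0 hDq
  have hrough : ((m / d).divisors.card : ℝ) ≤ Real.exp (8 * Real.log 2 * κ) := by
    refine (card_divisors_le_rpow_of_rough hq.two_le hme hqp).trans ?_
    calc ((m / d : ℕ) : ℝ) ^ (Real.log 2 / Real.log q)
        ≤ (D ^ (8 : ℝ)) ^ (Real.log 2 / Real.log q) := by
          gcongr
      _ = _ := by
          rw [← Real.rpow_mul hD0.le, Real.rpow_def_of_pos hD0, hκ]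
          ring_nf
  have hl2 := Real.log_two_lt_d9
  have hl2' := Real.log_two_gt_d9
  refine ⟨max 1 ⌊κ⌋₊, le_max_left _ _, fun p hp hpd => ?_, ?_, hrough.trans ?_⟩
  · rcases Nat.eq_zero_or_pos ⌊κ⌋₊ with h0 | h0
    · rw [h0]
      simpa using hpD p hp hpd
    · rw [max_eq_right (show 1 ≤ ⌊κ⌋₊ from h0), ← hκq]
      have h1 : Real.log p ≤ Real.log q :=
        Real.log_le_log (by exact_mod_cast hp.pos) (by exact_mod_cast hpq p hp hpd)
      gcongr
  · rcases le_or_gt ⌊κ⌋₊ 1 with h0 | h0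
    · left
      exact max_eq_left h0
    · right
      have h1 : (2 : ℝ) ≤ ⌊κ⌋₊ := by exact_mod_cast h0
      have h2 : 2 * Real.log q ≤ Real.log D := by
        rw [← hκq]
        gcongr
        linarith
      linarith
  · rw [Real.exp_le_exp]
    have h1 : κ ≤ ((max 1 ⌊κ⌋₊ : ℕ) : ℝ) + 1 := by
      have : (⌊κ⌋₊ : ℝ) ≤ ((max 1 ⌊κ⌋₊ : ℕ) : ℝ) := by exact_mod_cast le_max_right _ _
      linarith
    nlinarith

theorem sum_Icc_rpow_neg_third_le (n : ℕ) :
    ∑ u ∈ Finset.Icc 1 n, (u : ℝ) ^ (-(1 / 3) : ℝ) ≤ 3 / 2 * (n : ℝ) ^ (2 / 3 : ℝ) := by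
  induction n with
  | zero => simp
  | succ n ih =>
    rw [Finset.sum_Icc_succ_top (by omega)]
    have hn0 : (0 : ℝ) < ((n + 1 : ℕ) : ℝ) := by positivity
    have hs : (1 + -(1 / ((n + 1 : ℕ) : ℝ))) = n / ((n + 1 : ℕ) : ℝ) := by
      push_cast
      field_simp
      ring
    have h1 := rpow_one_add_le_one_add_mul_self (s := -(1 / ((n + 1 : ℕ) : ℝ))) (p := 2 / 3)
      (by
        rw [neg_le_neg_iff, div_le_one hn0]
        push_cast
        linarith [(Nat.cast_nonneg n : (0 : ℝ) ≤ n)]) (by norm_num) (by norm_num)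
    rw [hs, Real.div_rpow (by positivity) (by positivity), div_le_iff₀ (by positivity)] at h1
    have h2 : ((n + 1 : ℕ) : ℝ) ^ (-(1 / 3) : ℝ) =
        ((n + 1 : ℕ) : ℝ) ^ (2 / 3 : ℝ) / ((n + 1 : ℕ) : ℝ) := by
      rw [← Real.rpow_sub_one hn0.ne']
      norm_num
    rw [h2]
    have h3 : (1 + 2 / 3 * -(1 / ((n + 1 : ℕ) : ℝ))) * ((n + 1 : ℕ) : ℝ) ^ (2 / 3 : ℝ) =
        ((n + 1 : ℕ) : ℝ) ^ (2 / 3 : ℝ) -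
          2 / 3 * (((n + 1 : ℕ) : ℝ) ^ (2 / 3 : ℝ) / ((n + 1 : ℕ) : ℝ)) := by ring
    rw [h3] at h1
    linarith

theorem sum_rpow_neg_third_le_of_congr {e b : ℕ} (he : e ≠ 0) {s : Finset ℕ}
    (hs : ∀ h ∈ s, e ≤ h ∧ h ≤ b) (hc : ∀ h ∈ s, ∀ h' ∈ s, h ≡ h' [MOD e]) :
    ∑ h ∈ s, (h : ℝ) ^ (-(1 / 3) : ℝ) ≤ 3 / 2 * (b : ℝ) ^ (2 / 3 : ℝ) / e := by
  have he0 : (0 : ℝ) < e := by exact_mod_cast Nat.pos_of_ne_zero he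
  rw [le_div_iff₀ he0]
  refine le_trans ?_ (sum_Icc_rpow_neg_third_le b)
  have hinj : Set.InjOn (fun q : ℕ × ℕ => q.1 - q.2) (s ×ˢ Finset.range e : Finset (ℕ × ℕ)) := by
    rintro ⟨h, i⟩ h1 ⟨h', i'⟩ h2 heq
    simp only [Finset.coe_product, Set.mem_prod, Finset.mem_coe, Finset.mem_range] at h1 h2 heq
    have hh := hc h h1.1 h' h2.1
    have hle := (hs h h1.1).1
    have hle' := (hs h' h2.1).1
    have hadd : h + i' = h' + i := by omega
    have hi : i' ≡ i [MOD e] := by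
      refine Nat.ModEq.add_left_cancel hh ?_
      rw [hadd]
    have hi' : i' = i := Nat.ModEq.eq_of_lt_of_lt hi h2.2 h1.2
    ext <;> simp only <;> omega
  calc (∑ h ∈ s, (h : ℝ) ^ (-(1 / 3) : ℝ)) * e
      = ∑ q ∈ s ×ˢ Finset.range e, (q.1 : ℝ) ^ (-(1 / 3) : ℝ) := by
        rw [Finset.sum_product, Finset.sum_mul]
        refine Finset.sum_congr rfl fun h _ => ?_
        dsimp only
        rw [Finset.sum_const, Finset.card_range, nsmul_eq_mul, mul_comm]
    _ ≤ ∑ q ∈ s ×ˢ Finset.range e, ((q.1 - q.2 : ℕ) : ℝ) ^ (-(1 / 3) : ℝ) := by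
        refine Finset.sum_le_sum fun q hq => ?_
        rw [Finset.mem_product, Finset.mem_range] at hq
        have := (hs _ hq.1).1
        refine Real.rpow_le_rpow_of_nonpos ?_ ?_ (by norm_num)
        · exact_mod_cast (show 0 < q.1 - q.2 by omega)
        · exact_mod_cast Nat.sub_le _ _
    _ = ∑ u ∈ (s ×ˢ Finset.range e).image fun q : ℕ × ℕ => q.1 - q.2,
          (u : ℝ) ^ (-(1 / 3) : ℝ) := by
        rw [Finset.sum_image hinj]
    _ ≤ _ := by
        refine Finset.sum_le_sum_of_subset_of_nonneg (fun u hu => ?_) fun _ _ _ => by positivity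
        obtain ⟨q, hq, rfl⟩ := Finset.mem_image.1 hu
        rw [Finset.mem_product, Finset.mem_range] at hq
        have := hs _ hq.1
        rw [Finset.mem_Icc]
        omega

theorem sum_dvd_sub_pow_four_le {e b : ℕ} (he : e ≠ 0) {s : Finset ℕ}
    (hs : ∀ a ∈ s, a.Coprime b ∧ a < b ∧ e ≤ b - a ∧ e ∣ b ^ 4 - a ^ 4) :
    ∑ a ∈ s, ((b - a : ℕ) : ℝ) ^ (-(1 / 3) : ℝ) ≤
      numFourthRoots e * (3 / 2 * (b : ℝ) ^ (2 / 3 : ℝ) / e) := by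
  have : NeZero e := ⟨he⟩
  rcases s.eq_empty_or_nonempty with rfl | ⟨a₀, ha₀⟩
  · rw [Finset.sum_empty]
    positivity
  have hpow : ∀ a ∈ s, (a : ZMod e) ^ 4 = (b : ZMod e) ^ 4 := by
    intro a ha
    obtain ⟨-, hab, -, hdvd⟩ := hs a ha
    have h1 := (ZMod.natCast_eq_zero_iff _ _).2 hdvd
    rw [Nat.cast_sub (Nat.pow_le_pow_left hab.le 4), sub_eq_zero] at h1
    push_cast at h1
    exact h1.symm
  have hbe : b.Coprime e := by
    refine Nat.Coprime.symm (Nat.coprime_of_dvd fun p hp hpe hpb => ?_)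
    obtain ⟨hcop, hab, -, hdvd⟩ := hs a₀ ha₀
    have h1 : p ∣ a₀ ^ 4 :=
      (Nat.dvd_sub_iff_right (Nat.pow_le_pow_left hab.le 4) (dvd_pow hpb (by norm_num))).1
        (hpe.trans hdvd)
    exact Nat.not_coprime_of_dvd_of_dvd hp.one_lt (hp.dvd_of_dvd_pow h1) hpb hcop
  have hb1 := ZMod.coe_mul_inv_eq_one b hbe
  set F : Finset (ZMod e) := Finset.univ.filter fun t => t ^ 4 = 1 with hF
  have hmaps : ∀ a ∈ s, (a : ZMod e) * (b : ZMod e)⁻¹ ∈ F := by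
    intro a ha
    rw [hF, Finset.mem_filter]
    refine ⟨Finset.mem_univ _, ?_⟩
    rw [mul_pow, hpow a ha, ← mul_pow, hb1, one_pow]
  have hcard : F.card = numFourthRoots e := by
    rw [numFourthRoots, Nat.card_eq_fintype_card, Fintype.card_subtype]
  rw [← Finset.sum_fiberwise_of_maps_to hmaps, ← hcard, ← nsmul_eq_mul]
  refine Finset.sum_le_card_nsmul _ _ _ fun t _ => ?_
  have hinj : Set.InjOn (fun a => b - a)
      (s.filter fun a => (a : ZMod e) * (b : ZMod e)⁻¹ = t : Finset ℕ) := by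
    intro a ha a' ha' heq
    rw [Finset.mem_coe, Finset.mem_filter] at ha ha'
    have h1 := (hs a ha.1).2.1
    have h2 := (hs a' ha'.1).2.1
    simp only at heq
    omega
  rw [← Finset.sum_image (f := fun h : ℕ => (h : ℝ) ^ (-(1 / 3) : ℝ)) hinj]
  refine sum_rpow_neg_third_le_of_congr he (fun h hh => ?_) fun h hh h' hh' => ?_
  · obtain ⟨a, ha, rfl⟩ := Finset.mem_image.1 hh
    rw [Finset.mem_filter] at ha
    exact ⟨(hs a ha.1).2.2.1, Nat.sub_le _ _⟩
  · obtain ⟨a, ha, rfl⟩ := Finset.mem_image.1 hh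
    obtain ⟨a', ha', rfl⟩ := Finset.mem_image.1 hh'
    rw [Finset.mem_filter] at ha ha'
    have key : ∀ a : ℕ, (a : ZMod e) * (b : ZMod e)⁻¹ = t → (a : ZMod e) = t * b := by
      intro a h
      rw [← h, mul_assoc, mul_comm (b : ZMod e)⁻¹, hb1, mul_one]
    rw [← ZMod.natCast_eq_natCast_iff, Nat.cast_sub (hs a ha.1).2.1.le,
      Nat.cast_sub (hs a' ha'.1).2.1.le, key a ha.2, key a' ha'.2]

theorem exists_smooth_majorant : ∃ C : ℝ, 0 < C ∧ ∀ D : ℝ, 1 ≤ D →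
    ∃ (η : ℕ → ℝ) (N : ℕ → ℕ) (K : ℕ),
      (∀ k, 0 ≤ η k ∧ η k ≤ 1 / 8 ∧ 2 ≤ N k ∧ η k * Real.log (N k) ≤ 15 ∧
        Real.log (N k) ≤ 113 + Real.log D) ∧
      ∀ m : ℕ, m ≠ 0 → (m : ℝ) ≤ D ^ (8 : ℝ) → ∃ k < K, ∃ d, d ∣ m ∧ (d : ℝ) ≤ D ∧
        d ∈ (N k).smoothNumbers ∧ (m.divisors.card : ℝ) ≤ C * Real.exp (-k) * tauRpow (η k) d := by
  obtain ⟨C, hC, hmaj⟩ := exists_card_divisors_le_tauRpow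
  refine ⟨C, hC, fun D hD => ?_⟩
  have hD0 : 0 < D := by linarith
  have hLD : 0 ≤ Real.log D := Real.log_nonneg hD
  have hl2 := Real.log_two_lt_d9
  have hlog : ∀ y : ℝ, 0 ≤ y →
      2 ≤ ⌊Real.exp y⌋₊ + 1 ∧ Real.log (⌊Real.exp y⌋₊ + 1 : ℕ) ≤ 0.7 + y := by
    intro y hy
    have h1 : 1 ≤ ⌊Real.exp y⌋₊ := by
      rw [Nat.one_le_floor_iff]
      exact Real.one_le_exp hy
    refine ⟨by omega, ?_⟩
    have h2 := Nat.floor_le (Real.exp_pos y).le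
    have h3 : ((⌊Real.exp y⌋₊ + 1 : ℕ) : ℝ) ≤ 2 * Real.exp y := by
      push_cast
      linarith [Real.one_le_exp hy]
    calc Real.log (⌊Real.exp y⌋₊ + 1 : ℕ) ≤ Real.log (2 * Real.exp y) :=
          Real.log_le_log (by positivity) h3
      _ = Real.log 2 + y := by rw [Real.log_mul (by norm_num) (by positivity), Real.log_exp]
      _ ≤ _ := by linarith
  have hsmooth : ∀ (y : ℝ) (d : ℕ), d ≠ 0 → (∀ p : ℕ, p.Prime → p ∣ d → Real.log p ≤ y) →
      d ∈ (⌊Real.exp y⌋₊ + 1).smoothNumbers := by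
    intro y d hd h
    rw [Nat.mem_smoothNumbers]
    refine ⟨hd, fun p hp => ?_⟩
    have hp' := Nat.prime_of_mem_primeFactorsList hp
    have h1 := h p hp' (Nat.dvd_of_mem_primeFactorsList hp)
    rw [Real.log_le_iff_le_exp (by exact_mod_cast hp'.pos)] at h1
    exact Nat.lt_succ_of_le (Nat.le_floor h1)
  set P : ℕ → Prop := fun k => 1 ≤ k ∧ 14 * (k : ℝ) ≤ Real.log D / 8 with hP
  refine ⟨fun k => if P k then 14 * k / Real.log D else 1 / 8,
    fun k => ⌊Real.exp (if P k then Real.log D / k else 112)⌋₊ + 1, ⌊Real.log D⌋₊ + 1, ?_, ?_⟩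
  · intro k
    by_cases hk : P k
    · simp only [if_pos hk]
      obtain ⟨hk1, hkD⟩ := hk
      have hk1' : (1 : ℝ) ≤ k := by exact_mod_cast hk1
      have hLD0 : 0 < Real.log D := by linarith
      obtain ⟨h2, h3⟩ := hlog (Real.log D / k) (by positivity)
      have h4 : 14 * k / Real.log D ≤ 1 / 8 := by
        rw [div_le_iff₀ hLD0]
        linarith
      refine ⟨by positivity, h4, h2, ?_, h3.trans ?_⟩
      · calc 14 * k / Real.log D * Real.log (⌊Real.exp (Real.log D / k)⌋₊ + 1 : ℕ)
            ≤ 14 * k / Real.log D * (0.7 + Real.log D / k) := by gcongr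
          _ = 14 * k / Real.log D * 0.7 + 14 := by
            field_simp
          _ ≤ 15 := by linarith
      · have : Real.log D / k ≤ Real.log D := div_le_self hLD hk1'
        linarith
    · simp only [if_neg hk]
      obtain ⟨h2, h3⟩ := hlog 112 (by norm_num)
      exact ⟨by norm_num, by norm_num, h2, by linarith, by linarith⟩
  · intro m hm hmD
    obtain ⟨d, hdm, hdD, ⟨k, hk1, hkD, hkp, hk⟩ | ⟨hp, hτ⟩⟩ := hmaj D m hD hm hmD
    · have hPk : P k := ⟨hk1, hkD⟩
      have hk0 : (0 : ℝ) < k := by exact_mod_cast hk1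
      refine ⟨k, ?_, d, hdm, hdD, ?_, ?_⟩
      · exact Nat.lt_succ_of_le (Nat.le_floor (by linarith))
      · simp only [if_pos hPk]
        refine hsmooth _ _ (ne_zero_of_dvd_ne_zero hm hdm) fun p hp hpd => ?_
        rw [le_div_iff₀ hk0, mul_comm]
        exact hkp p hp hpd
      · simpa only [if_pos hPk] using hk
    · have hP0 : ¬ P 0 := fun h => absurd h.1 (by norm_num)
      refine ⟨0, Nat.succ_pos _, d, hdm, hdD, ?_, ?_⟩
      · simp only [if_neg hP0]
        exact hsmooth _ _ (ne_zero_of_dvd_ne_zero hm hdm) hp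
      · simpa only [if_neg hP0, Nat.cast_zero, neg_zero, Real.exp_zero, mul_one] using hτ

theorem exists_sum_near_card_divisors_le : ∃ C : ℝ, 0 < C ∧ ∀ b : ℕ,
    ∑ a ∈ (Finset.Ico 1 b).filter (fun a => ((b - a : ℕ) : ℝ) < √b),
      ((b ^ 4 - a ^ 4).divisors.card : ℝ) * ((b - a : ℕ) : ℝ) ^ (-(1 / 3) : ℝ) ≤
    C * (b : ℝ) ^ (2 / 3 : ℝ) := by
  obtain ⟨C, hC, hdiv⟩ := exists_card_divisors_le_rpow (ε := 1 / 24) (by norm_num)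
  refine ⟨C, by linarith, fun b => ?_⟩
  set s := (Finset.Ico 1 b).filter (fun a => ((b - a : ℕ) : ℝ) < √b) with hs
  have hcard : (s.card : ℝ) ≤ √b := by
    have hmaps : ∀ a ∈ s, b - a ∈ Finset.Ico 1 ⌈√(b : ℝ)⌉₊ := by
      intro a ha
      rw [hs, Finset.mem_filter, Finset.mem_Ico] at ha
      rw [Finset.mem_Ico, Nat.lt_ceil]
      exact ⟨by omega, ha.2⟩
    have hinj : Set.InjOn (fun a => b - a) (s : Set ℕ) := by
      intro a ha a' ha' heq
      rw [hs, Finset.mem_coe, Finset.mem_filter, Finset.mem_Ico] at ha ha'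
      simp only at heq
      omega
    have h1 := Finset.card_le_card_of_injOn _ hmaps hinj
    rw [Nat.card_Ico] at h1
    rcases Nat.eq_zero_or_pos s.card with h0 | h0
    · rw [h0, Nat.cast_zero]
      positivity
    · have h2 := Nat.ceil_lt_add_one (Real.sqrt_nonneg (b : ℝ))
      have h3 : ((s.card + 1 : ℕ) : ℝ) ≤ ⌈√(b : ℝ)⌉₊ := by exact_mod_cast (by omega)
      push_cast at h3
      linarith
  calc ∑ a ∈ s, ((b ^ 4 - a ^ 4).divisors.card : ℝ) * ((b - a : ℕ) : ℝ) ^ (-(1 / 3) : ℝ)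
      ≤ ∑ a ∈ s, C * (b : ℝ) ^ (1 / 6 : ℝ) := by
        refine Finset.sum_le_sum fun a ha => ?_
        rw [hs, Finset.mem_filter, Finset.mem_Ico] at ha
        have hlt : a ^ 4 < b ^ 4 := Nat.pow_lt_pow_left ha.1.2 (by norm_num)
        have h1 := hdiv (b ^ 4 - a ^ 4) (by omega)
        have h2 : ((b ^ 4 - a ^ 4 : ℕ) : ℝ) ^ (1 / 24 : ℝ) ≤ (b : ℝ) ^ (1 / 6 : ℝ) := by
          calc ((b ^ 4 - a ^ 4 : ℕ) : ℝ) ^ (1 / 24 : ℝ) ≤ ((b : ℝ) ^ 4) ^ (1 / 24 : ℝ) := by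
                gcongr
                exact_mod_cast Nat.sub_le _ _
            _ = _ := by
                rw [← Real.rpow_natCast, ← Real.rpow_mul (by positivity)]
                norm_num
        have h3 : ((b - a : ℕ) : ℝ) ^ (-(1 / 3) : ℝ) ≤ 1 := by
          refine Real.rpow_le_one_of_one_le_of_nonpos ?_ (by norm_num)
          exact_mod_cast (show 1 ≤ b - a by omega)
        calc _ ≤ ((b ^ 4 - a ^ 4).divisors.card : ℝ) * 1 := by gcongr
          _ ≤ C * (b : ℝ) ^ (1 / 6 : ℝ) := by
            rw [mul_one]
            exact h1.trans (by gcongr)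
    _ = C * (s.card * (b : ℝ) ^ (1 / 6 : ℝ)) := by
        rw [Finset.sum_const, nsmul_eq_mul]
        ring
    _ ≤ C * (√b * (b : ℝ) ^ (1 / 6 : ℝ)) := by gcongr
    _ = _ := by
        rw [Real.sqrt_eq_rpow, ← Real.rpow_add_of_nonneg (by positivity) (by norm_num) (by norm_num)]
        norm_num

theorem exists_sum_far_card_divisors_le : ∃ C : ℝ, 0 < C ∧ ∀ b : ℕ, 2 ≤ b →
    ∑ a ∈ (Finset.Ico 1 b).filter (fun a => a.Coprime b ∧ √b ≤ ((b - a : ℕ) : ℝ)),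
      ((b ^ 4 - a ^ 4).divisors.card : ℝ) * ((b - a : ℕ) : ℝ) ^ (-(1 / 3) : ℝ) ≤
    C * (b : ℝ) ^ (2 / 3 : ℝ) * Real.log b ^ 3 := by
  obtain ⟨C, hC, hmaj⟩ := exists_smooth_majorant
  obtain ⟨C', hC', hsum⟩ := exists_sum_smooth_rootWeight_le 15
  refine ⟨C * (2 * (C' * 230 ^ 3) * (3 / 2)), by positivity, fun b hb => ?_⟩
  have hb1 : (1 : ℝ) ≤ b := by exact_mod_cast (by omega)
  have hD1 : 1 ≤ √(b : ℝ) := Real.one_le_sqrt.2 hb1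
  obtain ⟨η, N, K, hηN, hτ⟩ := hmaj (√b) hD1
  have hb8 : √(b : ℝ) ^ (8 : ℝ) = (b : ℝ) ^ 4 := by
    rw [show (8 : ℝ) = ((2 * 4 : ℕ) : ℝ) by norm_num, Real.rpow_natCast, pow_mul,
      Real.sq_sqrt (by positivity)]
  have hlb : 1 / 2 ≤ Real.log b := by
    have h1 := Real.log_two_gt_d9
    have h2 : Real.log 2 ≤ Real.log b := Real.log_le_log (by norm_num) (by exact_mod_cast hb)
    linarith
  have hNb : ∀ k, Real.log (N k) ≤ 230 * Real.log b := by
    intro k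
    have h1 := (hηN k).2.2.2.2
    rw [Real.log_sqrt (by positivity)] at h1
    linarith
  set s := (Finset.Ico 1 b).filter (fun a => a.Coprime b ∧ √b ≤ ((b - a : ℕ) : ℝ)) with hs
  clear_value s
  set E : ℕ → Finset ℕ := fun k =>
    (Finset.Icc 1 ⌊√(b : ℝ)⌋₊).filter fun e => e ∈ (N k).smoothNumbers with hE
  have hpt : ∀ a ∈ s, ((b ^ 4 - a ^ 4).divisors.card : ℝ) ≤ ∑ k ∈ Finset.range K,
      ∑ e ∈ E k, if e ∣ b ^ 4 - a ^ 4 then C * Real.exp (-k) * tauRpowMoebius (η k) e else 0 := by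
    intro a ha
    rw [hs, Finset.mem_filter, Finset.mem_Ico] at ha
    have hlt : a ^ 4 < b ^ 4 := Nat.pow_lt_pow_left ha.1.2 (by norm_num)
    have hm : b ^ 4 - a ^ 4 ≠ 0 := by omega
    obtain ⟨k, hkK, d, hdm, hdD, hds, hk⟩ := hτ (b ^ 4 - a ^ 4) hm (by
      rw [hb8]
      exact_mod_cast Nat.sub_le _ _)
    have hnn : ∀ k e : ℕ, 0 ≤ C * Real.exp (-k) * tauRpowMoebius (η k) e := fun k e =>
      mul_nonneg (by positivity) (tauRpowMoebius_nonneg (hηN k).1 e)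
    have hite : ∀ k e : ℕ, 0 ≤
        if e ∣ b ^ 4 - a ^ 4 then C * Real.exp (-k) * tauRpowMoebius (η k) e else 0 := by
      intro k e
      split_ifs
      exacts [hnn k e, le_rfl]
    refine le_trans ?_ (Finset.single_le_sum (f := fun k : ℕ => ∑ e ∈ E k,
      if e ∣ b ^ 4 - a ^ 4 then C * Real.exp (-k) * tauRpowMoebius (η k) e else 0)
      (fun k _ => Finset.sum_nonneg fun e _ => hite k e) (Finset.mem_range.2 hkK))
    rw [← Finset.sum_filter]
    refine hk.trans ?_
    rw [← sum_divisors_tauRpowMoebius, Finset.mul_sum]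
    refine Finset.sum_le_sum_of_subset_of_nonneg (fun e he => ?_) fun e _ _ => hnn k e
    rw [Nat.mem_divisors] at he
    have he0 : 0 < e := Nat.pos_of_dvd_of_pos he.1 (Nat.pos_of_ne_zero he.2)
    rw [Finset.mem_filter, hE, Finset.mem_filter, Finset.mem_Icc]
    refine ⟨⟨⟨he0, Nat.le_floor (le_trans ?_ hdD)⟩, ?_⟩, he.1.trans hdm⟩
    · exact_mod_cast Nat.le_of_dvd (Nat.pos_of_ne_zero he.2) he.1
    · exact Nat.mem_smoothNumbers_of_dvd hds he.1
  have hinner : ∀ k, ∀ e ∈ E k, ∑ a ∈ s with e ∣ b ^ 4 - a ^ 4,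
      ((b - a : ℕ) : ℝ) ^ (-(1 / 3) : ℝ) ≤
        numFourthRoots e * (3 / 2 * (b : ℝ) ^ (2 / 3 : ℝ) / e) := by
    intro k e he
    rw [hE, Finset.mem_filter, Finset.mem_Icc] at he
    refine sum_dvd_sub_pow_four_le (by omega) fun a ha => ?_
    rw [Finset.mem_filter, hs, Finset.mem_filter, Finset.mem_Ico] at ha
    refine ⟨ha.1.2.1, ha.1.1.2, ?_, ha.2⟩
    have h1 := Nat.floor_le (Real.sqrt_nonneg (b : ℝ))
    have h2 : (e : ℝ) ≤ ⌊√(b : ℝ)⌋₊ := by exact_mod_cast he.1.2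
    exact_mod_cast (h2.trans h1).trans ha.1.2.2
  calc ∑ a ∈ s, ((b ^ 4 - a ^ 4).divisors.card : ℝ) * ((b - a : ℕ) : ℝ) ^ (-(1 / 3) : ℝ)
      ≤ ∑ a ∈ s, (∑ k ∈ Finset.range K, ∑ e ∈ E k,
          if e ∣ b ^ 4 - a ^ 4 then C * Real.exp (-k) * tauRpowMoebius (η k) e else 0) *
            ((b - a : ℕ) : ℝ) ^ (-(1 / 3) : ℝ) := by
        refine Finset.sum_le_sum fun a ha => ?_
        have := hpt a ha
        gcongr
    _ = ∑ k ∈ Finset.range K, ∑ e ∈ E k, C * Real.exp (-k) * tauRpowMoebius (η k) e *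
          ∑ a ∈ s with e ∣ b ^ 4 - a ^ 4, ((b - a : ℕ) : ℝ) ^ (-(1 / 3) : ℝ) := by
        simp_rw [Finset.sum_mul]
        rw [Finset.sum_comm]
        refine Finset.sum_congr rfl fun k _ => ?_
        rw [Finset.sum_comm]
        refine Finset.sum_congr rfl fun e _ => ?_
        rw [Finset.mul_sum, Finset.sum_filter]
        refine Finset.sum_congr rfl fun a _ => ?_
        rw [ite_mul, zero_mul]
    _ ≤ ∑ k ∈ Finset.range K, ∑ e ∈ E k, C * Real.exp (-k) * tauRpowMoebius (η k) e *
          (numFourthRoots e * (3 / 2 * (b : ℝ) ^ (2 / 3 : ℝ) / e)) := by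
        refine Finset.sum_le_sum fun k _ => Finset.sum_le_sum fun e he => ?_
        have h1 := tauRpowMoebius_nonneg (hηN k).1 e
        have h2 := hinner k e he
        gcongr
    _ = ∑ k ∈ Finset.range K, C * (3 / 2 * (b : ℝ) ^ (2 / 3 : ℝ)) * (Real.exp (-k) *
          ∑ e ∈ E k, rootWeight (η k) e) := by
        refine Finset.sum_congr rfl fun k _ => ?_
        rw [Finset.mul_sum, Finset.mul_sum]
        refine Finset.sum_congr rfl fun e _ => ?_
        rw [rootWeight]
        ring
    _ ≤ ∑ k ∈ Finset.range K, C * (3 / 2 * (b : ℝ) ^ (2 / 3 : ℝ)) * ((1 / 2) ^ k *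
          (C' * (230 * Real.log b) ^ 3)) := by
        refine Finset.sum_le_sum fun k _ => ?_
        obtain ⟨h1, h2, h3, h4, -⟩ := hηN k
        have h5 := hsum (η k) (N k) (E k) h1 h2 h3 h4 fun e he => (Finset.mem_filter.1 he).2
        have h6 : 0 ≤ Real.log (N k) := Real.log_natCast_nonneg _
        have h7 := hNb k
        have h8 : Real.exp (-k) ≤ (1 / 2) ^ k := by
          rw [one_div, inv_pow, Real.exp_neg]
          gcongr
          rw [← Real.exp_one_pow]
          gcongr
          linarith [Real.add_one_le_exp (1 : ℝ)]
        have h9 : 0 ≤ ∑ e ∈ E k, rootWeight (η k) e :=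
          Finset.sum_nonneg fun e _ => rootWeight_nonneg h1 e
        gcongr
        exact h5.trans (by gcongr)
    _ = C * (3 / 2 * (b : ℝ) ^ (2 / 3 : ℝ)) * ((∑ k ∈ Finset.range K, (1 / 2) ^ k) *
          (C' * (230 * Real.log b) ^ 3)) := by
        rw [← Finset.mul_sum, Finset.sum_mul]
    _ ≤ C * (3 / 2 * (b : ℝ) ^ (2 / 3 : ℝ)) * (2 * (C' * (230 * Real.log b) ^ 3)) := by
        gcongr
        exact sum_geometric_two_le K
    _ = _ := by ring

theorem exists_sum_coprime_card_divisors_le : ∃ C : ℝ, 0 < C ∧ ∀ b : ℕ,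
    ∑ a ∈ (Finset.Ico 1 b).filter (fun a => a.Coprime b),
      ((b ^ 4 - a ^ 4).divisors.card : ℝ) * ((b - a : ℕ) : ℝ) ^ (-(1 / 3) : ℝ) ≤
    C * (b : ℝ) ^ (2 / 3 : ℝ) * Real.log b ^ 3 := by
  obtain ⟨C₁, hC₁, h₁⟩ := exists_sum_near_card_divisors_le
  obtain ⟨C₂, hC₂, h₂⟩ := exists_sum_far_card_divisors_le
  refine ⟨8 * C₁ + C₂, by positivity, fun b => ?_⟩
  rcases lt_or_ge b 2 with hb | hb
  · interval_cases b <;> simp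
  have hlb : 1 / 2 ≤ Real.log b := by
    have h1 := Real.log_two_gt_d9
    have h2 : Real.log 2 ≤ Real.log b := Real.log_le_log (by norm_num) (by exact_mod_cast hb)
    linarith
  have hlb3 : (1 / 2 : ℝ) ^ 3 ≤ Real.log b ^ 3 := by gcongr
  rw [← Finset.sum_filter_add_sum_filter_not _ (fun a => ((b - a : ℕ) : ℝ) < √b)]
  refine (add_le_add ?_ ?_ : _ ≤ C₁ * (b : ℝ) ^ (2 / 3 : ℝ) +
    C₂ * (b : ℝ) ^ (2 / 3 : ℝ) * Real.log b ^ 3).trans ?_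
  · refine le_trans (Finset.sum_le_sum_of_subset_of_nonneg ?_ fun _ _ _ => by positivity) (h₁ b)
    exact Finset.filter_subset_filter _ (Finset.filter_subset _ _)
  · refine le_trans (le_of_eq ?_) (h₂ b hb)
    rw [Finset.filter_filter]
    simp only [not_lt]
  have h3 : C₁ * (b : ℝ) ^ (2 / 3 : ℝ) * (1 / 2) ^ 3 ≤
      C₁ * (b : ℝ) ^ (2 / 3 : ℝ) * Real.log b ^ 3 := by gcongr
  linarith

theorem exists_sum_card_divisors_le : ∃ C : ℝ, 0 < C ∧ ∀ b : ℕ, b ≠ 0 →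
    ∑ a ∈ Finset.Ico 1 b,
      ((b ^ 4 - a ^ 4).divisors.card : ℝ) * ((b - a : ℕ) : ℝ) ^ (-(1 / 3) : ℝ) ≤
    C * (b : ℝ) ^ (2 / 3 : ℝ) * Real.log b ^ 3 *
      ∑ g ∈ b.divisors, ((g ^ 4).divisors.card : ℝ) / g := by
  obtain ⟨C, hC, hcop⟩ := exists_sum_coprime_card_divisors_le
  refine ⟨C, hC, fun b hb => ?_⟩
  have hmaps : ∀ a ∈ Finset.Ico 1 b, a.gcd b ∈ b.divisors := fun a _ =>
    Nat.mem_divisors.2 ⟨Nat.gcd_dvd_right _ _, hb⟩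
  rw [← Finset.sum_fiberwise_of_maps_to hmaps, Finset.mul_sum]
  refine Finset.sum_le_sum fun g hg => ?_
  obtain ⟨⟨b', rfl⟩, -⟩ := Nat.mem_divisors.1 hg
  have hg0 : 0 < g := Nat.pos_of_ne_zero (left_ne_zero_of_mul hb)
  have hb0 : 0 < b' := Nat.pos_of_ne_zero (right_ne_zero_of_mul hb)
  have hg0' : (0 : ℝ) < g := by exact_mod_cast hg0
  have hsub : (Finset.Ico 1 (g * b')).filter (fun a => a.gcd (g * b') = g) ⊆
      ((Finset.Ico 1 b').filter fun a => a.Coprime b').image fun a => g * a := by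
    intro a ha
    rw [Finset.mem_filter, Finset.mem_Ico] at ha
    obtain ⟨⟨ha1, hab⟩, hgcd⟩ := ha
    obtain ⟨a', rfl⟩ : g ∣ a := hgcd ▸ Nat.gcd_dvd_left a (g * b')
    rw [Nat.gcd_mul_left] at hgcd
    rw [Finset.mem_image]
    refine ⟨a', ?_, rfl⟩
    rw [Finset.mem_filter, Finset.mem_Ico]
    exact ⟨⟨Nat.pos_of_mul_pos_left ha1, Nat.lt_of_mul_lt_mul_left hab⟩,
      Nat.eq_of_mul_eq_mul_left hg0 (by rw [hgcd, mul_one])⟩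
  refine (Finset.sum_le_sum_of_subset_of_nonneg hsub fun _ _ _ => by positivity).trans ?_
  rw [Finset.sum_image fun a _ a' _ h => Nat.eq_of_mul_eq_mul_left hg0 h]
  have hlog : Real.log b' ≤ Real.log (g * b' : ℕ) := by
    refine Real.log_le_log (by exact_mod_cast hb0) ?_
    exact_mod_cast Nat.le_mul_of_pos_left b' hg0
  calc ∑ a ∈ (Finset.Ico 1 b').filter fun a => a.Coprime b',
        (((g * b') ^ 4 - (g * a) ^ 4).divisors.card : ℝ) *
          ((g * b' - g * a : ℕ) : ℝ) ^ (-(1 / 3) : ℝ)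
      ≤ ∑ a ∈ (Finset.Ico 1 b').filter fun a => a.Coprime b',
          ((g ^ 4).divisors.card * (g : ℝ) ^ (-(1 / 3) : ℝ)) *
            (((b' ^ 4 - a ^ 4).divisors.card : ℝ) * ((b' - a : ℕ) : ℝ) ^ (-(1 / 3) : ℝ)) := by
        refine Finset.sum_le_sum fun a _ => ?_
        have h1 : (((g * b') ^ 4 - (g * a) ^ 4).divisors.card : ℝ) ≤
            (g ^ 4).divisors.card * (b' ^ 4 - a ^ 4).divisors.card := by
          rw [mul_pow, mul_pow, ← Nat.mul_sub]
          exact_mod_cast card_divisors_mul_le _ _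
        rw [← Nat.mul_sub, Nat.cast_mul, Real.mul_rpow (by positivity) (by positivity)]
        calc _ ≤ ((g ^ 4).divisors.card * (b' ^ 4 - a ^ 4).divisors.card : ℝ) *
              ((g : ℝ) ^ (-(1 / 3) : ℝ) * ((b' - a : ℕ) : ℝ) ^ (-(1 / 3) : ℝ)) := by gcongr
          _ = _ := by ring
    _ ≤ ((g ^ 4).divisors.card * (g : ℝ) ^ (-(1 / 3) : ℝ)) *
          (C * (b' : ℝ) ^ (2 / 3 : ℝ) * Real.log b' ^ 3) := by
        rw [← Finset.mul_sum]
        gcongr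
        exact hcop b'
    _ ≤ ((g ^ 4).divisors.card * (g : ℝ) ^ (-(1 / 3) : ℝ)) *
          (C * (b' : ℝ) ^ (2 / 3 : ℝ) * Real.log (g * b' : ℕ) ^ 3) := by
        have := Real.log_natCast_nonneg b'
        gcongr
    _ = _ := by
        rw [Nat.cast_mul, Real.mul_rpow (by positivity) (by positivity),
          show (2 / 3 : ℝ) = -(1 / 3) + 1 by norm_num, Real.rpow_add_one hg0'.ne']
        field_simp

theorem sum_Icc_inv_le {m n : ℕ} (hm : 1 ≤ m) (hmn : m ≤ n) :
    ∑ k ∈ Finset.Icc m n, (k : ℝ)⁻¹ ≤ 1 + (Real.log n - Real.log m) := by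
  induction n, hmn using Nat.le_induction with
  | base =>
    rw [Finset.Icc_self, Finset.sum_singleton, sub_self, add_zero]
    exact inv_le_one_of_one_le₀ (by exact_mod_cast hm)
  | succ n hmn ih =>
    rw [Finset.sum_Icc_succ_top (by omega)]
    have hn0 : (0 : ℝ) < n := by exact_mod_cast (by omega)
    have hn1 : (0 : ℝ) < ((n + 1 : ℕ) : ℝ) := by positivity
    have h1 := Real.one_sub_inv_le_log_of_pos (div_pos hn1 hn0)
    rw [Real.log_div hn1.ne' hn0.ne'] at h1
    have h2 : 1 - (((n + 1 : ℕ) : ℝ) / n)⁻¹ = ((n + 1 : ℕ) : ℝ)⁻¹ := by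
      push_cast
      field_simp
      ring
    linarith

theorem sum_inv_le_one_add_log {X y : ℝ} (hX : 0 < X) (hy : 1 ≤ y) {s : Finset ℕ}
    (hs : ∀ n ∈ s, X / y < n ∧ (n : ℝ) ≤ X) : ∑ n ∈ s, (n : ℝ)⁻¹ ≤ 1 + Real.log y := by
  have hy0 : 0 < y := by linarith
  rcases s.eq_empty_or_nonempty with rfl | hne
  · rw [Finset.sum_empty]
    linarith [Real.log_nonneg hy]
  obtain ⟨h1, h2⟩ := hs _ (s.min'_mem hne)
  set m := s.min' hne with hm
  have hm0 : (0 : ℝ) < m := (div_pos hX hy0).trans h1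
  have hm1 : 1 ≤ m := by exact_mod_cast hm0
  have hmX : m ≤ ⌊X⌋₊ := Nat.le_floor h2
  have hX0 : (0 : ℝ) < ⌊X⌋₊ := by exact_mod_cast hm1.trans hmX
  calc ∑ n ∈ s, (n : ℝ)⁻¹ ≤ ∑ n ∈ Finset.Icc m ⌊X⌋₊, (n : ℝ)⁻¹ := by
        refine Finset.sum_le_sum_of_subset_of_nonneg (fun n hn => ?_) fun _ _ _ => by positivity
        exact Finset.mem_Icc.2 ⟨s.min'_le n hn, Nat.le_floor (hs n hn).2⟩
    _ ≤ 1 + (Real.log ⌊X⌋₊ - Real.log m) := sum_Icc_inv_le hm1 hmX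
    _ ≤ 1 + Real.log y := by
        rw [← Real.log_div hX0.ne' hm0.ne']
        gcongr
        rw [div_le_iff₀ hm0]
        rw [div_lt_iff₀ hy0] at h1
        linarith [Nat.floor_le hX.le]

theorem exists_sum_card_divisors_pow_four_div_sq_le : ∃ C : ℝ, 0 < C ∧ ∀ s : Finset ℕ,
    ∑ g ∈ s, ((g ^ 4).divisors.card : ℝ) / (g : ℝ) ^ 2 ≤ C := by
  obtain ⟨C, hC, hdiv⟩ := exists_card_divisors_le_rpow (ε := 1 / 8) (by norm_num)
  have hsum : Summable fun g : ℕ => (g : ℝ) ^ (-(3 / 2) : ℝ) :=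
    Real.summable_nat_rpow.2 (by norm_num)
  have hnn : 0 ≤ ∑' g : ℕ, (g : ℝ) ^ (-(3 / 2) : ℝ) := tsum_nonneg fun _ => by positivity
  refine ⟨C * (∑' g : ℕ, (g : ℝ) ^ (-(3 / 2) : ℝ) + 1), by positivity, fun s => ?_⟩
  calc ∑ g ∈ s, ((g ^ 4).divisors.card : ℝ) / (g : ℝ) ^ 2
      ≤ ∑ g ∈ s, C * (g : ℝ) ^ (-(3 / 2) : ℝ) := by
        refine Finset.sum_le_sum fun g _ => ?_
        rcases Nat.eq_zero_or_pos g with rfl | hg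
        · simp
        have hg0 : (0 : ℝ) < g := by exact_mod_cast hg
        rw [div_le_iff₀ (by positivity), mul_assoc, ← Real.rpow_natCast (g : ℝ) 2,
          ← Real.rpow_add hg0]
        refine (hdiv _ (by positivity)).trans (le_of_eq ?_)
        rw [Nat.cast_pow, ← Real.rpow_natCast, ← Real.rpow_mul hg0.le]
        norm_num
    _ ≤ _ := by
        rw [← Finset.mul_sum]
        gcongr
        linarith [hsum.sum_le_tsum s fun _ _ => by positivity]

theorem exists_sum_inv_mul_sum_divisors_le : ∃ C : ℝ, 0 < C ∧ ∀ (X y : ℝ) (s : Finset ℕ),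
    0 < X → 1 ≤ y → (∀ n ∈ s, X / y < n ∧ (n : ℝ) ≤ X) →
    ∑ b ∈ s, (b : ℝ)⁻¹ * ∑ g ∈ b.divisors, ((g ^ 4).divisors.card : ℝ) / g ≤
      C * (1 + Real.log y) := by
  obtain ⟨C, hC, hsum⟩ := exists_sum_card_divisors_pow_four_div_sq_le
  refine ⟨C, hC, fun X y s hX hy hs => ?_⟩
  have hy0 : 0 < y := by linarith
  have hly := Real.log_nonneg hy
  set T := Finset.Icc 1 ⌊X⌋₊ with hT
  have hpos : ∀ b ∈ s, 0 < b := fun b hb => by exact_mod_cast (div_pos hX hy0).trans (hs b hb).1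
  have hdiv : ∀ b ∈ s, b.divisors = T.filter fun g => g ∣ b := by
    intro b hb
    ext g
    rw [Nat.mem_divisors, Finset.mem_filter, hT, Finset.mem_Icc]
    refine ⟨fun h => ⟨⟨Nat.pos_of_dvd_of_pos h.1 (hpos b hb), ?_⟩, h.1⟩,
      fun h => ⟨h.2, (hpos b hb).ne'⟩⟩
    exact (Nat.le_of_dvd (hpos b hb) h.1).trans (Nat.le_floor (hs b hb).2)
  calc ∑ b ∈ s, (b : ℝ)⁻¹ * ∑ g ∈ b.divisors, ((g ^ 4).divisors.card : ℝ) / g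
      = ∑ b ∈ s, ∑ g ∈ T, if g ∣ b then (b : ℝ)⁻¹ * (((g ^ 4).divisors.card : ℝ) / g) else 0 := by
        refine Finset.sum_congr rfl fun b hb => ?_
        rw [hdiv b hb, Finset.mul_sum, Finset.sum_filter]
    _ = ∑ g ∈ T, ((g ^ 4).divisors.card : ℝ) / g * ∑ b ∈ s with g ∣ b, (b : ℝ)⁻¹ := by
        rw [Finset.sum_comm]
        refine Finset.sum_congr rfl fun g _ => ?_
        rw [Finset.sum_filter, Finset.mul_sum]
        refine Finset.sum_congr rfl fun b _ => ?_
        rw [mul_ite, mul_zero, mul_comm]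
    _ ≤ ∑ g ∈ T, ((g ^ 4).divisors.card : ℝ) / g * ((g : ℝ)⁻¹ * (1 + Real.log y)) := by
        refine Finset.sum_le_sum fun g hg => ?_
        have hg1 : 1 ≤ g := (Finset.mem_Icc.1 hg).1
        have hg0 : (0 : ℝ) < g := by exact_mod_cast hg1
        have hinj : Set.InjOn (fun b => b / g) (s.filter fun b => g ∣ b : Finset ℕ) := by
          intro b hb b' hb' h
          rw [Finset.mem_coe, Finset.mem_filter] at hb hb'
          simp only at h
          rw [← Nat.div_mul_cancel hb.2, h, Nat.div_mul_cancel hb'.2]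
        have h1 : ∑ b ∈ s with g ∣ b, (b : ℝ)⁻¹ =
            (g : ℝ)⁻¹ * ∑ n ∈ (s.filter fun b => g ∣ b).image (fun b => b / g), (n : ℝ)⁻¹ := by
          rw [Finset.sum_image hinj, Finset.mul_sum]
          refine Finset.sum_congr rfl fun b hb => ?_
          rw [Nat.cast_div (Finset.mem_filter.1 hb).2 hg0.ne']
          field_simp
        rw [h1]
        gcongr
        refine sum_inv_le_one_add_log (X := X / g) (by positivity) hy fun n hn => ?_
        obtain ⟨b, hb, rfl⟩ := Finset.mem_image.1 hn
        rw [Finset.mem_filter] at hb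
        obtain ⟨h2, h3⟩ := hs b hb.1
        rw [Nat.cast_div hb.2 hg0.ne', div_right_comm]
        exact ⟨by gcongr, by gcongr⟩
    _ = (∑ g ∈ T, ((g ^ 4).divisors.card : ℝ) / (g : ℝ) ^ 2) * (1 + Real.log y) := by
        rw [Finset.sum_mul]
        refine Finset.sum_congr rfl fun g _ => ?_
        rw [sq, ← div_div]
        ring
    _ ≤ C * (1 + Real.log y) := by
        gcongr
        exact hsum T

theorem divisor_sum_quartic_large_b :
    ∃ C : ℝ, 0 < C ∧ ∀ x : ℝ, 2 ≤ x → ∀ y : ℝ, 0 < y →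
      ∑ q ∈ (Finset.Icc 1 ⌊x⌋₊ ×ˢ Finset.Icc 1 ⌊x⌋₊).filter
          (fun q : ℕ × ℕ => q.1 < q.2 ∧ (q.2 : ℝ) ≤ x ∧ x / y < (q.2 : ℝ)),
        (tauFn (q.2 ^ 4 - q.1 ^ 4) : ℝ) /
          ((q.2 : ℝ) ^ ((5 : ℝ) / 3) * ((q.2 : ℝ) - (q.1 : ℝ)) ^ ((1 : ℝ) / 3)) ≤
      C * Real.log x ^ 3 * Real.log (y + 2) := by
  obtain ⟨C₁, hC₁, h₁⟩ := exists_sum_card_divisors_le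
  obtain ⟨C₂, hC₂, h₂⟩ := exists_sum_inv_mul_sum_divisors_le
  refine ⟨C₁ * (C₂ * 2), by positivity, fun x hx y hy => ?_⟩
  have hx0 : 0 < x := by linarith
  have hlx : 0 ≤ Real.log x := Real.log_nonneg (by linarith)
  rcases le_or_gt y 1 with hy1 | hy1
  · rw [Finset.sum_eq_zero]
    · have := Real.log_nonneg (show 1 ≤ y + 2 by linarith)
      positivity
    · intro q hq
      obtain ⟨-, -, h2, h3⟩ := Finset.mem_filter.1 hq
      have h4 : x ≤ x / y := le_div_self hx0.le hy hy1
      linarith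
  set B := (Finset.Icc 1 ⌊x⌋₊).filter fun b : ℕ => (b : ℝ) ≤ x ∧ x / y < b with hB
  have hlog : 1 + Real.log y ≤ 2 * Real.log (y + 2) := by
    have h1 : Real.log y ≤ Real.log (y + 2) := Real.log_le_log hy (by linarith)
    have h2 : 1 ≤ Real.log (y + 2) := by
      rw [Real.le_log_iff_exp_le (by linarith)]
      linarith [Real.exp_one_lt_d9]
    linarith
  have hBpos : ∀ b ∈ B, 0 < b := fun b hb =>
    (Finset.mem_Icc.1 (Finset.mem_filter.1 hb).1).1
  have hset : (Finset.Icc 1 ⌊x⌋₊ ×ˢ Finset.Icc 1 ⌊x⌋₊).filter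
      (fun q : ℕ × ℕ => q.1 < q.2 ∧ (q.2 : ℝ) ≤ x ∧ x / y < (q.2 : ℝ)) ⊆
      (B.sigma fun b => Finset.Ico 1 b).image fun q => (q.2, q.1) := by
    rintro ⟨a, b⟩ hq
    rw [Finset.mem_filter, Finset.mem_product] at hq
    rw [Finset.mem_image]
    refine ⟨⟨b, a⟩, ?_, rfl⟩
    rw [Finset.mem_sigma, hB, Finset.mem_filter, Finset.mem_Ico]
    exact ⟨⟨hq.1.2, hq.2.2⟩, (Finset.mem_Icc.1 hq.1.1).1, hq.2.1⟩
  have hterm : ∀ b ∈ B, ∀ a ∈ Finset.Ico 1 b, (tauFn (b ^ 4 - a ^ 4) : ℝ) /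
      ((b : ℝ) ^ ((5 : ℝ) / 3) * ((b : ℝ) - (a : ℝ)) ^ ((1 : ℝ) / 3)) =
        (b : ℝ) ^ (-(5 / 3) : ℝ) *
          (((b ^ 4 - a ^ 4).divisors.card : ℝ) * ((b - a : ℕ) : ℝ) ^ (-(1 / 3) : ℝ)) := by
    intro b _ a ha
    rw [tauFn, ← Nat.cast_sub (Finset.mem_Ico.1 ha).2.le, Real.rpow_neg (by positivity),
      Real.rpow_neg (by positivity), div_eq_mul_inv, mul_inv]
    ring
  have hnn : ∀ q ∈ (B.sigma fun b => Finset.Ico 1 b).image (fun q => ((q.2, q.1) : ℕ × ℕ)),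
      0 ≤ (tauFn (q.2 ^ 4 - q.1 ^ 4) : ℝ) /
          ((q.2 : ℝ) ^ ((5 : ℝ) / 3) * ((q.2 : ℝ) - (q.1 : ℝ)) ^ ((1 : ℝ) / 3)) := by
    intro q hq
    obtain ⟨⟨b, a⟩, hba, rfl⟩ := Finset.mem_image.1 hq
    rw [Finset.mem_sigma] at hba
    rw [hterm b hba.1 a hba.2]
    positivity
  refine (Finset.sum_le_sum_of_subset_of_nonneg hset fun q hq _ => hnn q hq).trans ?_
  rw [Finset.sum_image (by
    rintro ⟨b, a⟩ _ ⟨b', a'⟩ _ h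
    simp only [Prod.mk.injEq] at h
    obtain ⟨rfl, rfl⟩ := h
    rfl), Finset.sum_sigma]
  calc _ = ∑ b ∈ B, (b : ℝ) ^ (-(5 / 3) : ℝ) * ∑ a ∈ Finset.Ico 1 b,
          ((b ^ 4 - a ^ 4).divisors.card : ℝ) * ((b - a : ℕ) : ℝ) ^ (-(1 / 3) : ℝ) := by
        refine Finset.sum_congr rfl fun b hb => ?_
        rw [Finset.mul_sum]
        exact Finset.sum_congr rfl fun a ha => hterm b hb a ha
    _ ≤ ∑ b ∈ B, (b : ℝ) ^ (-(5 / 3) : ℝ) * (C₁ * (b : ℝ) ^ (2 / 3 : ℝ) * Real.log x ^ 3 *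
          ∑ g ∈ b.divisors, ((g ^ 4).divisors.card : ℝ) / g) := by
        refine Finset.sum_le_sum fun b hb => ?_
        have hb0 := hBpos b hb
        have hlb := Real.log_natCast_nonneg b
        have hlbx : Real.log b ≤ Real.log x :=
          Real.log_le_log (by exact_mod_cast hb0) (Finset.mem_filter.1 hb).2.1
        have hlog3 : Real.log b ^ 3 ≤ Real.log x ^ 3 := by gcongr
        refine mul_le_mul_of_nonneg_left ((h₁ b hb0.ne').trans ?_) (by positivity)
        exact mul_le_mul_of_nonneg_right (mul_le_mul_of_nonneg_left hlog3 (by positivity))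
          (Finset.sum_nonneg fun _ _ => by positivity)
    _ = C₁ * Real.log x ^ 3 *
          ∑ b ∈ B, (b : ℝ)⁻¹ * ∑ g ∈ b.divisors, ((g ^ 4).divisors.card : ℝ) / g := by
        rw [Finset.mul_sum]
        refine Finset.sum_congr rfl fun b hb => ?_
        have hb0 : (0 : ℝ) < b := by exact_mod_cast hBpos b hb
        have h3 : (b : ℝ)⁻¹ = (b : ℝ) ^ (-(5 / 3) : ℝ) * (b : ℝ) ^ (2 / 3 : ℝ) := by
          rw [← Real.rpow_add hb0, ← Real.rpow_neg_one]
          norm_num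
        rw [h3]
        ring
    _ ≤ C₁ * Real.log x ^ 3 * (C₂ * (1 + Real.log y)) := by
        gcongr
        exact h₂ x y B hx0 hy1.le fun b hb => (Finset.mem_filter.1 hb).2.symm
    _ ≤ C₁ * Real.log x ^ 3 * (C₂ * (2 * Real.log (y + 2))) := by gcongr
    _ = _ := by ring
end
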